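/- arXiv:2112.14996 — 3 statements merged into one kernel-verified Lean document; each statement's English description precedes it below -/
import Mathlib

section
/- Let L = {⊥} ∪ {φⁿ : n ≥ 1 and φ is an FO sentence having a model of cardinality exactly n}, where φⁿ denotes the n-fold conjunction φ ∧ ⋯ ∧ φ. Then: (i) L is a computable set of FO sentences; (ii) L has the same expressive power as FO over finite models; and (iii) the set of (codes of) finitely satisfiable sentences of L is computable. -/
open FirstOrder Language

/-- The vocabulary `V`: a relational language with countably many relation
symbols of each arity and no function symbols. -/
def V : FirstOrder.Language := ⟨fun _ => Empty, fun _ => ℕ⟩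

instance : ∀ n, IsEmpty (V.Functions n) := fun _ => inferInstanceAs (IsEmpty Empty)
instance : ∀ n, Encodable (V.Relations n) := fun _ => inferInstanceAs (Encodable ℕ)
instance : ∀ n, Encodable (V.Functions n) := fun _ => inferInstanceAs (Encodable Empty)

/-- A computable encoding of (sigma-)bounded `V`-formulas as naturals, via
Mathlib's list encoding of bounded formulas. -/
instance : Encodable (Σ n, V.BoundedFormula Empty n) :=
  Encodable.ofLeftInjection (fun φ => φ.2.listEncode)
    (fun l => (BoundedFormula.listDecode l)[0]?)
    (fun φ => BoundedFormula.encoding.decode_encode φ)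

/-- A computable encoding of `V`-sentences as naturals. -/
instance : Encodable V.Sentence :=
  Encodable.ofLeftInjection (fun φ => (⟨0, φ⟩ : Σ n, V.BoundedFormula Empty n))
    (fun p => match p with
      | ⟨0, φ⟩ => some φ
      | _ => none)
    (fun _ => rfl)

/-- A `V`-sentence is finitely satisfiable if some finite nonempty structure satisfies it. -/
def FinSat (φ : V.Sentence) : Prop :=
  ∃ (M : Type) (_ : V.Structure M), Finite M ∧ Nonempty M ∧ M ⊨ φ

/-- `L` has the same expressive power as full first-order logic over finite models:
every sentence is equivalent, over finite nonempty structures, to a member of `L`. -/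
def SameExprFin (L : Set V.Sentence) : Prop :=
  ∀ φ : V.Sentence, ∃ ψ ∈ L,
    ∀ (M : Type) (_ : V.Structure M), Finite M → Nonempty M → (M ⊨ φ ↔ M ⊨ ψ)

/-- `iterConj φ n` is the `(n+1)`-fold conjunction `φ ∧ ⋯ ∧ φ`. -/
def iterConj (φ : V.Sentence) : ℕ → V.Sentence
  | 0 => φ
  | n + 1 => iterConj φ n ⊓ φ

/-- The fragment `{⊥} ∪ {φⁿ : n ≥ 1 and φ has a model of cardinality exactly n}`. -/
def L6 : Set V.Sentence :=
  insert ⊥ {ψ | ∃ (φ : V.Sentence) (n : ℕ), ψ = iterConj φ n ∧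
    ∃ (M : Type) (_ : V.Structure M), Finite M ∧ Nat.card M = n + 1 ∧ Sentence.Realize M φ}


namespace FinModelCheck

open Encodable Denumerable

section PrimrecHelpers

variable {α β σ : Type*} [Primcodable α] [Primcodable β] [Primcodable σ]

theorem primrec_filter {f : α → List β} {p : α → β → Prop} [∀ a, DecidablePred (p a)]
    (hf : Primrec f) (hp : PrimrecRel p) : Primrec fun a => (f a).filter (p a ·) := by
  have h : Primrec fun a => (f a).filterMap fun b => if p a b then some b else none :=
    Primrec.listFilterMap hf
      (Primrec.ite hp (Primrec.option_some.comp Primrec.snd) (Primrec.const none))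
  refine h.of_eq fun a => ?_
  rw [← List.filterMap_eq_filter]
  congr 1
  funext b
  simp [Option.guard]

theorem primrecPred_mem {f : α → β} {g : α → List β} (hf : Primrec f) (hg : Primrec g) :
    PrimrecPred fun a => f a ∈ g a := by
  refine ((PrimrecRel.exists_mem_list (R := fun x y : β => x = y) Primrec.eq).comp hg hf).of_eq ?_
  intro a
  simp

theorem primrecPred_exists_lt {f : α → ℕ} {p : α → ℕ → Prop} (hf : Primrec f)
    (hp : PrimrecRel p) : PrimrecPred fun a => ∃ i < f a, p a i :=
  ((PrimrecRel.exists_mem_list (R := fun i a => p a i) hp.swap).comp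
    (Primrec.list_range.comp hf) Primrec.id).of_eq fun a => by simp

theorem primrecPred_forall_lt {f : α → ℕ} {p : α → ℕ → Prop} (hf : Primrec f)
    (hp : PrimrecRel p) : PrimrecPred fun a => ∀ i < f a, p a i :=
  ((PrimrecRel.forall_mem_list (R := fun i a => p a i) hp.swap).comp
    (Primrec.list_range.comp hf) Primrec.id).of_eq fun a => by simp

theorem primrec_replicate {f : α → ℕ} {g : α → β} (hf : Primrec f) (hg : Primrec g) :
    Primrec fun a => List.replicate (f a) (g a) := by
  have h : Primrec fun a => (List.range (f a)).map fun _ => g a :=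
    Primrec.list_map (Primrec.list_range.comp hf) (hg.comp Primrec.fst).to₂
  exact h.of_eq fun a => by simp

theorem primrec_div_const {f : α → ℕ} (c : ℕ) (hf : Primrec f) : Primrec fun a => f a / c :=
  Primrec.nat_div.comp hf (Primrec.const c)

theorem primrecPred_mod_eq {f : α → ℕ} (c d : ℕ) (hf : Primrec f) :
    PrimrecPred fun a => f a % c = d :=
  Primrec.eq.comp (Primrec.nat_mod.comp hf (Primrec.const c)) (Primrec.const d)

theorem primrecPred_eq_const {f : α → ℕ} (c : ℕ) (hf : Primrec f) :
    PrimrecPred fun a => f a = c :=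
  Primrec.eq.comp hf (Primrec.const c)

end PrimrecHelpers

/-! ### Tables of satisfying assignments -/

/-- All lists of length `n` with entries less than `m`. -/
def tuples (m : ℕ) : ℕ → List (List ℕ)
  | 0 => [ [] ]
  | n + 1 => (tuples m n).flatMap fun x => (List.range m).map fun a => x ++ [a]

/-- The assignments satisfying an equation between two variables. -/
def eqTable (m n i j : ℕ) : List (List ℕ) :=
  (tuples m n).filter fun x => x.getD i 0 = x.getD j 0

/-- The assignments satisfying an atom with relation token `a`, where `v` lists the codes of
the true ground atoms. -/
def relTable (m : ℕ) (v : List ℕ) (a n : ℕ) (is : List ℕ) : List (List ℕ) :=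
  (tuples m n).filter fun x => encode (a :: is.map fun i => x.getD i 0) ∈ v

/-- The assignments satisfying an implication. -/
def impTable (m n : ℕ) (A B : List (List ℕ)) : List (List ℕ) :=
  (tuples m n).filter fun x => x ∉ A ∨ x ∈ B

/-- The assignments satisfying a universal quantification. -/
def allTable (m n : ℕ) (A : List (List ℕ)) : List (List ℕ) :=
  (tuples m n).filter fun x => ∀ a < m, x ++ [a] ∈ A

/-! ### A stack machine evaluating token lists from right to left -/

/-- Stack entries `(n, t, A)`: the formula with `n` free variables and table `A` if `t = 0`, the
variable `i` among `n` variables if `t = i + 1`. -/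
abbrev Item := ℕ × ℕ × List (List ℕ)

/-- Pops a formula from the stack, where two variables on top form an equation. -/
def popFormula (m : ℕ) (s : List Item) : Option (ℕ × List (List ℕ) × List Item) :=
  s.head?.bind fun x =>
    if x.2.1 = 0 then some (x.1, x.2.2, s.tail)
    else s.tail.head?.bind fun y =>
      if x.1 = y.1 ∧ y.2.1 ≠ 0 then
        some (x.1, eqTable m x.1 (x.2.1 - 1) (y.2.1 - 1), s.tail.tail)
      else none

/-- Replaces the two formulas on top of the stack by their implication. -/
def impStep (m : ℕ) (s : List Item) : Option (List Item) :=
  (popFormula m s).bind fun x => (popFormula m x.2.2).bind fun y =>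
    if x.1 = y.1 then some ((x.1, 0, impTable m x.1 x.2.1 y.2.1) :: y.2.2) else none

/-- Quantifies the formula on top of the stack universally. -/
def allStep (m : ℕ) (s : List Item) : Option (List Item) :=
  (popFormula m s).bind fun x =>
    if x.1 = 0 then none else some ((x.1 - 1, 0, allTable m (x.1 - 1) x.2.1) :: x.2.2)

/-- Replaces the variables on top of the stack by an atom with relation token `a` in `k`
variables. -/
def relStep (m : ℕ) (v : List ℕ) (a k : ℕ) (s : List Item) : Option (List Item) :=
  let n := (a / 4).unpair.1
  let is := (s.take n).map fun x => x.2.1 - 1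
  if is.length = n ∧ s.take n = is.map fun i => (k, i + 1, []) then
    some ((k, 0, relTable m v a k is) :: s.drop n)
  else none

/-- The code of the variable `i` among `k` variables, as a token. -/
def varToken (k i : ℕ) : ℕ := 2 * Nat.pair k (Nat.pair (4 * i + 2) 0 + 1)

/-- The code of the relation symbol `R` of arity `n`, as a token. -/
def relToken (n R : ℕ) : ℕ := 4 * Nat.pair n R + 1

/-- The index of the variable with token `a`. -/
def varIndex (a : ℕ) : ℕ := ((a / 2).unpair.2 - 1).unpair.1 / 4

/-- The state of the machine after reading a list `l`: the stack (if any) after reading `l`, the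
stack after reading `l.tail`, and `l.head?`. -/
abbrev State := Option (List Item) × Option (List Item) × Option ℕ

/-- The stack after reading the token `a` in the state `st`. -/
def stackStep (m : ℕ) (v : List ℕ) (a : ℕ) (st : State) : Option (List Item) :=
  if a % 2 = 0 then
    if varIndex a < (a / 2).unpair.1 ∧ a = varToken (a / 2).unpair.1 (varIndex a) then
      st.1.bind fun s => some (((a / 2).unpair.1, varIndex a + 1, []) :: s)
    else none
  else if a % 4 = 1 then
    st.2.2.bind fun b => if b % 4 = 3 then st.2.1.bind (relStep m v a (b / 4)) else none
  else if a / 4 = 0 then st.1.bind (impStep m)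
  else if a / 4 = 1 then st.1.bind (allStep m)
  else st.1.bind fun s => some ((a / 4 - 2, 0, []) :: s)

/-- The state of the machine after reading the list `l` from right to left. -/
def run (m : ℕ) (v : List ℕ) (l : List ℕ) : State :=
  l.foldr (fun a st => (stackStep m v a st, st.1, some a)) (some [], none, none)

/-- Whether the token list `l` encodes a sentence true in the structure on `Fin m` described
by `v`. -/
def Accepts (m : ℕ) (v : List ℕ) (l : List ℕ) : Prop :=
  ((run m v l).1.bind (popFormula m)).any
    (fun x => decide (x.1 = 0 ∧ x.2.2 = [] ∧ [] ∈ x.2.1)) = true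

section Primrec

variable {α : Type*} [Primcodable α]

open Primrec

theorem primrec_tuples {f g : α → ℕ} (hf : Primrec f) (hg : Primrec g) :
    Primrec fun a => tuples (f a) (g a) := by
  have h : Primrec fun a => (g a).rec (motive := fun _ => List (List ℕ)) [ [] ]
      fun _ T => T.flatMap fun x => (List.range (f a)).map fun b => x ++ [b] := by
    refine nat_rec' (β := List (List ℕ)) hg (const [ [] ])
      (h := fun a p => p.2.flatMap fun x => (List.range (f a)).map fun b => x ++ [b]) ?_
    refine list_flatMap (snd.comp snd) ?_
    refine list_map (list_range.comp (hf.comp (fst.comp fst))) ?_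
    exact list_concat.comp (snd.comp fst) snd
  refine h.of_eq fun a => ?_
  induction g a with
  | zero => rfl
  | succ n ih => rw [tuples, ← ih]

theorem primrec_eqTable {m n i j : α → ℕ} (hm : Primrec m) (hn : Primrec n) (hi : Primrec i)
    (hj : Primrec j) : Primrec fun a => eqTable (m a) (n a) (i a) (j a) :=
  primrec_filter (primrec_tuples hm hn)
    (Primrec.eq.comp ((list_getD 0).comp snd (hi.comp fst))
      ((list_getD 0).comp snd (hj.comp fst)))

theorem primrec_relTable {m b n : α → ℕ} {v is : α → List ℕ} (hm : Primrec m) (hv : Primrec v)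
    (hb : Primrec b) (hn : Primrec n) (his : Primrec is) :
    Primrec fun a => relTable (m a) (v a) (b a) (n a) (is a) := by
  refine primrec_filter (primrec_tuples hm hn) (primrecPred_mem ?_ (hv.comp fst))
  refine Primrec.encode.comp (list_cons.comp (hb.comp fst) (list_map (his.comp fst) ?_))
  exact (list_getD 0).comp (snd.comp fst) snd

theorem primrec_impTable {m n : α → ℕ} {A B : α → List (List ℕ)} (hm : Primrec m)
    (hn : Primrec n) (hA : Primrec A) (hB : Primrec B) :
    Primrec fun a => impTable (m a) (n a) (A a) (B a) :=
  primrec_filter (primrec_tuples hm hn)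
    ((primrecPred_mem snd (hA.comp fst)).not.or (primrecPred_mem snd (hB.comp fst)))

theorem primrec_allTable {m n : α → ℕ} {A : α → List (List ℕ)} (hm : Primrec m)
    (hn : Primrec n) (hA : Primrec A) : Primrec fun a => allTable (m a) (n a) (A a) := by
  refine primrec_filter (primrec_tuples hm hn) ?_
  refine primrecPred_forall_lt (hm.comp fst) ?_
  exact primrecPred_mem (list_concat.comp (snd.comp fst) snd) (hA.comp (fst.comp fst))

theorem primrec_popFormula {m : α → ℕ} {s : α → List Item} (hm : Primrec m) (hs : Primrec s) :
    Primrec fun a => popFormula (m a) (s a) := by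
  have ht := list_tail.comp hs
  refine option_bind (list_head?.comp hs) (ite (primrecPred_eq_const 0 (fst.comp (snd.comp snd)))
    (option_some.comp ((fst.comp snd).pair ((snd.comp (snd.comp snd)).pair (ht.comp fst))))
    (option_bind (list_head?.comp (ht.comp fst)) (ite ?_ (option_some.comp ?_) (const none))))
  · exact (Primrec.eq.comp (fst.comp (snd.comp fst)) (fst.comp snd)).and
      (primrecPred_eq_const 0 (fst.comp (snd.comp snd))).not
  · refine (fst.comp (snd.comp fst)).pair ((primrec_eqTable (hm.comp (fst.comp fst))
      (fst.comp (snd.comp fst)) ?_ ?_).pair (list_tail.comp (ht.comp (fst.comp fst))))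
    · exact nat_sub.comp (fst.comp (snd.comp (snd.comp fst))) (const 1)
    · exact nat_sub.comp (fst.comp (snd.comp snd)) (const 1)

theorem primrec_impStep {m : α → ℕ} {s : α → List Item} (hm : Primrec m) (hs : Primrec s) :
    Primrec fun a => impStep (m a) (s a) := by
  refine option_bind (primrec_popFormula hm hs) (option_bind
    (primrec_popFormula (hm.comp fst) (snd.comp (snd.comp snd))) (ite ?_ (option_some.comp ?_)
      (const none)))
  · exact Primrec.eq.comp (fst.comp (snd.comp fst)) (fst.comp snd)
  · refine list_cons.comp ((fst.comp (snd.comp fst)).pair ((const 0).pair (primrec_impTable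
      (hm.comp (fst.comp fst)) (fst.comp (snd.comp fst)) ?_ ?_))) (snd.comp (snd.comp snd))
    · exact fst.comp (snd.comp (snd.comp fst))
    · exact fst.comp (snd.comp snd)

theorem primrec_allStep {m : α → ℕ} {s : α → List Item} (hm : Primrec m) (hs : Primrec s) :
    Primrec fun a => allStep (m a) (s a) := by
  refine option_bind (primrec_popFormula hm hs) (ite (primrecPred_eq_const 0 (fst.comp snd))
    (const none) (option_some.comp ?_))
  have h1 := nat_sub.comp (fst.comp snd) (const 1)
    (α := α × ℕ × List (List ℕ) × List Item)
  exact list_cons.comp (h1.pair ((const 0).pair (primrec_allTable (hm.comp fst) h1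
    (fst.comp (snd.comp snd))))) (snd.comp (snd.comp snd))

theorem primrec_relStep {m b k : α → ℕ} {v : α → List ℕ} {s : α → List Item} (hm : Primrec m)
    (hv : Primrec v) (hb : Primrec b) (hk : Primrec k) (hs : Primrec s) :
    Primrec fun a => relStep (m a) (v a) (b a) (k a) (s a) := by
  have hn : Primrec fun a => (b a / 4).unpair.1 :=
    fst.comp (unpair.comp (primrec_div_const 4 hb))
  have ht := list_take.comp hn hs
  have his : Primrec fun a => ((s a).take (b a / 4).unpair.1).map fun x => x.2.1 - 1 :=
    list_map ht (nat_sub.comp (fst.comp (snd.comp snd)) (const 1))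
  refine ite ((Primrec.eq.comp (list_length.comp his) hn).and (Primrec.eq.comp ht
    (list_map his ?_))) (option_some.comp ?_) (const none)
  · exact (hk.comp fst).pair ((succ.comp snd).pair (const []))
  · exact list_cons.comp (hk.pair ((const 0).pair (primrec_relTable hm hv hb hk his)))
      (list_drop.comp hn hs)

theorem primrec_varToken {k i : α → ℕ} (hk : Primrec k) (hi : Primrec i) :
    Primrec fun a => varToken (k a) (i a) :=
  nat_mul.comp (const 2) (Primrec₂.natPair.comp hk (succ.comp (Primrec₂.natPair.comp
    (nat_add.comp (nat_mul.comp (const 4) hi) (const 2)) (const 0))))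

theorem primrec_stackStep {m b : α → ℕ} {v : α → List ℕ} {st : α → State} (hm : Primrec m)
    (hv : Primrec v) (hb : Primrec b) (hst : Primrec st) :
    Primrec fun a => stackStep (m a) (v a) (b a) (st a) := by
  have hu := unpair.comp (primrec_div_const 2 hb)
  have hk := fst.comp hu
  have hi : Primrec fun a => varIndex (b a) :=
    primrec_div_const 4 (fst.comp (unpair.comp (nat_sub.comp (snd.comp hu) (const 1))))
  have hd := primrec_div_const 4 hb
  have h1 := fst.comp hst
  have h2 := fst.comp (snd.comp hst)
  have h3 := snd.comp (snd.comp hst)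
  refine ite (primrecPred_mod_eq 2 0 hb) (ite ?_ (option_bind h1 (option_some.comp
    (list_cons.comp (Primrec.pair (hk.comp fst) ((succ.comp (hi.comp fst)).pair (const [])))
      snd))) (const none)) ?_
  · exact (nat_lt.comp hi hk).and (Primrec.eq.comp hb (primrec_varToken hk hi))
  refine ite (primrecPred_mod_eq 4 1 hb) (option_bind h3 (ite (primrecPred_mod_eq 4 3 snd)
    (option_bind (h2.comp fst) (primrec_relStep (hm.comp (fst.comp fst)) (hv.comp (fst.comp fst))
      (hb.comp (fst.comp fst)) (primrec_div_const 4 (snd.comp fst)) snd)) (const none))) ?_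
  refine ite (primrecPred_eq_const 0 hd) (option_bind h1 (primrec_impStep (hm.comp fst) snd)) ?_
  refine ite (primrecPred_eq_const 1 hd) (option_bind h1 (primrec_allStep (hm.comp fst) snd)) ?_
  exact option_bind h1 (option_some.comp (list_cons.comp (Primrec.pair (nat_sub.comp
    (hd.comp fst) (const 2)) (const ((0, []) : ℕ × List (List ℕ)))) snd))

theorem primrec_run {m : α → ℕ} {v l : α → List ℕ} (hm : Primrec m) (hv : Primrec v)
    (hl : Primrec l) : Primrec fun a => run (m a) (v a) (l a) := by
  refine list_foldr hl (const ((some [], none, none) : State))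
    (h := fun a p => (stackStep (m a) (v a) p.1 p.2, p.2.1, some p.1)) ?_
  exact Primrec.pair (primrec_stackStep (hm.comp fst) (hv.comp fst) (fst.comp snd)
    (snd.comp snd)) ((fst.comp (snd.comp snd)).pair (option_some.comp (fst.comp snd)))

theorem primrecPred_accepts {m : α → ℕ} {v l : α → List ℕ} (hm : Primrec m) (hv : Primrec v)
    (hl : Primrec l) : PrimrecPred fun a => Accepts (m a) (v a) (l a) := by
  have h : Primrec fun a => ((run (m a) (v a) (l a)).1.bind (popFormula (m a))).casesOn
      (motive := fun _ => Bool) false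
      (fun x => decide (x.1 = 0 ∧ x.2.2 = [] ∧ [] ∈ x.2.1)) := by
    refine option_casesOn (option_bind (fst.comp (primrec_run hm hv hl))
      (primrec_popFormula (hm.comp fst) snd)) (const false) ?_
    refine PrimrecPred.decide ?_
    exact (primrecPred_eq_const 0 (fst.comp snd)).and ((Primrec.eq.comp (snd.comp (snd.comp snd))
      (const [])).and (primrecPred_mem (const []) (fst.comp (snd.comp snd))))
  refine (Primrec.eq.comp h (const true)).of_eq fun a => ?_
  rw [Accepts]
  cases (run (m a) (v a) (l a)).1.bind (popFormula (m a)) <;> rfl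

end Primrec

/-! ### Token lists of formulas -/

/-- The list of codes of the symbols of a formula. -/
def tokens {n : ℕ} (φ : V.BoundedFormula Empty n) : List ℕ :=
  φ.listEncode.map encode

theorem encode_map_encode {α : Type*} [Encodable α] (l : List α) :
    encode (l.map encode) = encode l := by
  induction l with
  | nil => rfl
  | cons a l ih => rw [List.map_cons, encode_list_cons, encode_list_cons, ih]; rfl

theorem encode_sentence (φ : V.Sentence) : encode φ = encode (tokens φ) :=
  (encode_map_encode _).symm

theorem exists_eq_var {n : ℕ} (t : V.Term (Empty ⊕ Fin n)) : ∃ i, t = Term.var (Sum.inr i) := by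
  cases t with
  | var x =>
    cases x with
    | inl e => exact e.elim
    | inr i => exact ⟨i, rfl⟩
  | func f _ => exact isEmptyElim f

theorem tokens_falsum (n : ℕ) :
    tokens (BoundedFormula.falsum : V.BoundedFormula Empty n) = [4 * (n + 2) + 3] := by
  simp only [tokens, BoundedFormula.listEncode, List.map_cons, List.map_nil, encode_inr,
    encode_nat]
  congr 1
  omega

theorem encode_var {n : ℕ} (i : Fin n) :
    encode (Sum.inl (⟨n, Term.var (Sum.inr i)⟩ : Σ k, V.Term (Empty ⊕ Fin k)) :
      (Σ k, V.Term (Empty ⊕ Fin k)) ⊕ ((Σ n, V.Relations n) ⊕ ℕ)) = varToken n i := by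
  rw [encode_inl, Encodable.encode_sigma_val, varToken]
  change 2 * Nat.pair n (Nat.pair (2 * (2 * (i : ℕ) + 1)) 0 + 1) = _
  congr 4
  ring

theorem tokens_equal {n : ℕ} (i j : Fin n) :
    tokens (BoundedFormula.equal (Term.var (Sum.inr i)) (Term.var (Sum.inr j)) :
      V.BoundedFormula Empty n) = [varToken n i, varToken n j] := by
  simp only [tokens, BoundedFormula.listEncode, List.map_cons, List.map_nil, encode_var]

theorem tokens_rel {n k : ℕ} (R : V.Relations n) (f : Fin n → Fin k) :
    tokens (BoundedFormula.rel R (fun i => Term.var (Sum.inr (f i))) :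
      V.BoundedFormula Empty k) =
      relToken n R :: (4 * k + 3) :: List.ofFn (fun i => varToken k (f i)) := by
  simp only [tokens, BoundedFormula.listEncode, List.map_cons,
    List.map_map, List.cons_append, List.nil_append, List.ofFn_eq_map, List.cons.injEq]
  refine ⟨?_, ?_, ?_⟩
  · rw [encode_inr, encode_inl, Encodable.encode_sigma_val]
    change 2 * (2 * Nat.pair n R) + 1 = 4 * Nat.pair n R + 1
    ring
  · rw [encode_inr, encode_inr, encode_nat]
    ring
  · exact List.map_congr_left fun i _ => encode_var _

theorem tokens_imp {n : ℕ} (φ ψ : V.BoundedFormula Empty n) :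
    tokens (φ.imp ψ) = 3 :: (tokens φ ++ tokens ψ) := by
  simp only [tokens, BoundedFormula.listEncode, List.map_cons, List.map_append, List.cons_append]
  rfl

theorem tokens_all {n : ℕ} (φ : V.BoundedFormula Empty (n + 1)) :
    tokens φ.all = 7 :: tokens φ := by
  simp only [tokens, BoundedFormula.listEncode, List.map_cons]
  rfl

/-! ### Correctness of the tables -/

theorem mem_tuples {m n : ℕ} {x : List ℕ} :
    x ∈ tuples m n ↔ ∃ xs : Fin n → Fin m, x = List.ofFn fun i => (xs i : ℕ) := by
  induction n generalizing x with
  | zero => simp [tuples]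
  | succ n ih =>
    simp only [tuples, List.mem_flatMap, List.mem_map, List.mem_range, ih]
    constructor
    · rintro ⟨_, ⟨xs, rfl⟩, a, ha, rfl⟩
      refine ⟨Fin.snoc xs ⟨a, ha⟩, ?_⟩
      rw [List.ofFn_succ', List.concat_eq_append]
      simp
    · rintro ⟨xs, rfl⟩
      refine ⟨_, ⟨fun i => xs i.castSucc, rfl⟩, xs (Fin.last n), (xs (Fin.last n)).2, ?_⟩
      rw [List.ofFn_succ', List.concat_eq_append]

/-- The table `A` lists the assignments satisfying `φ`. -/
def IsTable {m : ℕ} (S : V.Structure (Fin m)) {n : ℕ} (φ : V.BoundedFormula Empty n)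
    (A : List (List ℕ)) : Prop :=
  ∀ x : List ℕ, x ∈ A ↔ ∃ xs : Fin n → Fin m, x = List.ofFn (fun i => (xs i : ℕ)) ∧
    φ.Realize default xs

/-- The list `v` of true ground atoms agrees with `S` for the relation tokens in `l`. -/
def Agrees {m : ℕ} (S : V.Structure (Fin m)) (v l : List ℕ) : Prop :=
  ∀ (n : ℕ) (R : V.Relations n), relToken n R ∈ l → ∀ xs : Fin n → Fin m,
    S.RelMap R xs ↔ encode (relToken n R :: List.ofFn fun i => (xs i : ℕ)) ∈ v

theorem ofFn_val_injective {m n : ℕ} {xs ys : Fin n → Fin m}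
    (h : (List.ofFn fun i => (xs i : ℕ)) = List.ofFn fun i => (ys i : ℕ)) : xs = ys := by
  funext i
  exact Fin.ext (congrFun (List.ofFn_injective h) i)

theorem getD_ofFn {n : ℕ} (f : Fin n → ℕ) (i : Fin n) : (List.ofFn f).getD i 0 = f i := by
  simp [List.getD_eq_getElem?_getD]

section Tables

variable {m n : ℕ} {S : V.Structure (Fin m)}

theorem isTable_falsum : IsTable S (BoundedFormula.falsum : V.BoundedFormula Empty n) [] := by
  intro x
  simp [BoundedFormula.Realize]

theorem isTable_filter {φ : V.BoundedFormula Empty n} {p : List ℕ → Prop} [DecidablePred p]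
    (h : ∀ xs : Fin n → Fin m, p (List.ofFn fun i => (xs i : ℕ)) ↔ φ.Realize default xs) :
    IsTable S φ ((tuples m n).filter (p ·)) := by
  intro x
  rw [List.mem_filter, mem_tuples, decide_eq_true_iff]
  constructor
  · rintro ⟨⟨xs, rfl⟩, hp⟩
    exact ⟨xs, rfl, (h xs).1 hp⟩
  · rintro ⟨xs, rfl, hr⟩
    exact ⟨⟨xs, rfl⟩, (h xs).2 hr⟩

theorem IsTable.mem_ofFn {φ : V.BoundedFormula Empty n} {A : List (List ℕ)}
    (h : IsTable S φ A) (xs : Fin n → Fin m) :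
    (List.ofFn fun i => (xs i : ℕ)) ∈ A ↔ φ.Realize default xs := by
  rw [h]
  constructor
  · rintro ⟨ys, hy, hr⟩
    rwa [ofFn_val_injective hy]
  · exact fun hr => ⟨xs, rfl, hr⟩

theorem isTable_equal (i j : Fin n) :
    IsTable S (BoundedFormula.equal (Term.var (Sum.inr i)) (Term.var (Sum.inr j)) :
      V.BoundedFormula Empty n) (eqTable m n i j) := by
  refine isTable_filter fun xs => ?_
  rw [getD_ofFn, getD_ofFn]
  simp [BoundedFormula.Realize, Fin.ext_iff]

theorem isTable_rel {k : ℕ} {v l : List ℕ} (hv : Agrees S v l) (R : V.Relations n)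
    (hR : relToken n R ∈ l) (f : Fin n → Fin k) :
    IsTable S (BoundedFormula.rel R (fun i => Term.var (Sum.inr (f i))) :
      V.BoundedFormula Empty k)
      (relTable m v (relToken n R) k (List.ofFn fun i => (f i : ℕ))) := by
  refine isTable_filter fun xs => ?_
  rw [List.map_ofFn]
  have h : ((fun i => (List.ofFn fun i => (xs i : ℕ)).getD i 0) ∘ fun i => (f i : ℕ)) =
      fun i => (xs (f i) : ℕ) := by
    funext i
    exact getD_ofFn _ _
  rw [h, ← hv n R hR]
  simp [BoundedFormula.Realize]

theorem IsTable.imp {φ ψ : V.BoundedFormula Empty n} {A B : List (List ℕ)}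
    (hA : IsTable S φ A) (hB : IsTable S ψ B) : IsTable S (φ.imp ψ) (impTable m n A B) := by
  refine isTable_filter fun xs => ?_
  rw [hA.mem_ofFn, hB.mem_ofFn, BoundedFormula.realize_imp, imp_iff_not_or]

theorem IsTable.all {φ : V.BoundedFormula Empty (n + 1)} {A : List (List ℕ)}
    (hA : IsTable S φ A) : IsTable S φ.all (allTable m n A) := by
  refine isTable_filter fun xs => ?_
  rw [BoundedFormula.realize_all, Fin.forall_iff]
  refine forall₂_congr fun a ha => ?_
  rw [← hA.mem_ofFn, List.ofFn_succ', List.concat_eq_append]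
  simp

end Tables

/-! ### Soundness of the machine -/

/-- The stack entry describes the variable or formula with the given tokens. -/
inductive IsItem {m : ℕ} (S : V.Structure (Fin m)) : Item → List ℕ → Prop
  | var {k : ℕ} (i : Fin k) : IsItem S (k, i + 1, []) [varToken k i]
  | formula {n : ℕ} (φ : V.BoundedFormula Empty n) {A : List (List ℕ)} (h : IsTable S φ A) :
    IsItem S (n, 0, A) (tokens φ)

/-- The stack describes the variables and formulas with the given concatenation of tokens. -/
inductive IsStack {m : ℕ} (S : V.Structure (Fin m)) : List Item → List ℕ → Prop
  | nil : IsStack S [] []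
  | cons {x : Item} {s : List Item} {t l : List ℕ} (hx : IsItem S x t) (hs : IsStack S s l) :
    IsStack S (x :: s) (t ++ l)

theorem run_cons (m : ℕ) (v : List ℕ) (a : ℕ) (l : List ℕ) :
    run m v (a :: l) = (stackStep m v a (run m v l), (run m v l).1, some a) := rfl

theorem run_head (m : ℕ) (v l : List ℕ) : (run m v l).2.2 = l.head? := by
  cases l <;> rfl

theorem stackStep_var {m : ℕ} {v : List ℕ} {k i : ℕ} (hi : i < k) (st : State) :
    stackStep m v (varToken k i) st = st.1.bind fun s => some ((k, i + 1, []) :: s) := by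
  have h1 : (varToken k i / 2).unpair = (k, Nat.pair (4 * i + 2) 0 + 1) := by
    rw [varToken, Nat.mul_div_cancel_left _ two_pos, Nat.unpair_pair]
  have h2 : varIndex (varToken k i) = i := by
    rw [varIndex, h1, Nat.add_sub_cancel, Nat.unpair_pair]
    simp only
    omega
  have h3 : varToken k i % 2 = 0 := Nat.mul_mod_right _ _
  rw [stackStep, if_pos h3, h1, h2, if_pos ⟨hi, rfl⟩]

theorem stackStep_rel {m : ℕ} {v : List ℕ} (n R k : ℕ) (st : State)
    (hst : st.2.2 = some (4 * k + 3)) :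
    stackStep m v (relToken n R) st = st.2.1.bind (relStep m v (relToken n R) k) := by
  have h1 : relToken n R % 2 ≠ 0 := by rw [relToken]; omega
  have h2 : relToken n R % 4 = 1 := by rw [relToken]; omega
  have h3 : (4 * k + 3) / 4 = k := by omega
  rw [stackStep, if_neg h1, if_pos h2, hst, Option.bind_some, if_pos (by omega), h3]

theorem stackStep_imp {m : ℕ} {v : List ℕ} (st : State) :
    stackStep m v 3 st = st.1.bind (impStep m) := by
  simp [stackStep]

theorem stackStep_all {m : ℕ} {v : List ℕ} (st : State) :
    stackStep m v 7 st = st.1.bind (allStep m) := by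
  simp [stackStep]

theorem stackStep_falsum {m : ℕ} {v : List ℕ} (n : ℕ) (st : State) :
    stackStep m v (4 * (n + 2) + 3) st = st.1.bind fun s => some ((n, 0, []) :: s) := by
  have h : (4 * (n + 2) + 3) / 4 = n + 2 := by omega
  rw [stackStep, if_neg (by omega), if_neg (by omega), h, if_neg (by omega), if_neg (by omega)]
  simp

theorem relToken_unpair {a : ℕ} (h : a % 4 = 1) :
    a = relToken (a / 4).unpair.1 (a / 4).unpair.2 := by
  rw [relToken, Nat.pair_unpair]
  omega

section Soundness

variable {m : ℕ} {S : V.Structure (Fin m)} {v : List ℕ}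

theorem IsStack.popFormula {s s' : List Item} {l : List ℕ} {n : ℕ} {A : List (List ℕ)}
    (hs : IsStack S s l) (h : popFormula m s = some (n, A, s')) :
    ∃ (φ : V.BoundedFormula Empty n) (l' : List ℕ),
      l = tokens φ ++ l' ∧ IsTable S φ A ∧ IsStack S s' l' := by
  cases hs with
  | nil => simp [FinModelCheck.popFormula] at h
  | cons hx hs =>
    cases hx with
    | formula φ hφ =>
      simp only [FinModelCheck.popFormula, List.head?_cons, Option.bind_some, if_true,
        List.tail_cons, Option.some.injEq, Prod.mk.injEq] at h
      obtain ⟨rfl, rfl, rfl⟩ := h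
      exact ⟨φ, _, rfl, hφ, hs⟩
    | var i =>
      cases hs with
      | nil => simp [FinModelCheck.popFormula] at h
      | cons hy hs =>
        cases hy with
        | formula φ hφ => simp [FinModelCheck.popFormula] at h
        | var j =>
          simp only [FinModelCheck.popFormula, List.head?_cons, Option.bind_some,
            List.tail_cons, Nat.succ_ne_zero, if_false, Nat.add_sub_cancel,
            Option.ite_none_right_eq_some, Option.some.injEq, Prod.mk.injEq] at h
          obtain ⟨⟨rfl, -⟩, rfl, rfl, rfl⟩ := h
          exact ⟨_, _, by rw [tokens_equal i j]; rfl, isTable_equal i j, hs⟩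

theorem IsStack.impStep {s s' : List Item} {l : List ℕ} (hs : IsStack S s l)
    (h : impStep m s = some s') : IsStack S s' (3 :: l) := by
  simp only [FinModelCheck.impStep, Option.bind_eq_some_iff, Option.ite_none_right_eq_some,
    Option.some.injEq] at h
  obtain ⟨⟨n, A, s₁⟩, h1, ⟨n', B, s₂⟩, h2, hn, rfl⟩ := h
  obtain rfl : n = n' := hn
  obtain ⟨φ, l₁, rfl, hφ, hs₁⟩ := hs.popFormula h1
  obtain ⟨ψ, l₂, rfl, hψ, hs₂⟩ := hs₁.popFormula h2
  have := IsStack.cons (IsItem.formula _ (hφ.imp hψ)) hs₂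
  rwa [tokens_imp, List.cons_append, List.append_assoc] at this

theorem IsStack.allStep {s s' : List Item} {l : List ℕ} (hs : IsStack S s l)
    (h : allStep m s = some s') : IsStack S s' (7 :: l) := by
  simp only [FinModelCheck.allStep, Option.bind_eq_some_iff, Option.ite_none_left_eq_some,
    Option.some.injEq] at h
  obtain ⟨⟨n, A, s₁⟩, h1, hn, rfl⟩ := h
  cases n with
  | zero => exact absurd rfl hn
  | succ n =>
    obtain ⟨φ, l₁, rfl, hφ, hs₁⟩ := hs.popFormula h1
    have := IsStack.cons (IsItem.formula _ hφ.all) hs₁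
    rwa [tokens_all, List.cons_append] at this

theorem IsStack.of_vars {k : ℕ} {is : List ℕ} {s : List Item} {l : List ℕ}
    (hs : IsStack S ((is.map fun i => (k, i + 1, [])) ++ s) l) :
    (∀ i ∈ is, i < k) ∧ ∃ l', l = is.map (varToken k) ++ l' ∧ IsStack S s l' := by
  induction is generalizing l with
  | nil => exact ⟨by simp, l, rfl, hs⟩
  | cons i is ih =>
    rw [List.map_cons, List.cons_append] at hs
    cases hs with
    | cons hx hs =>
      cases hx with
      | var i =>
        obtain ⟨h1, l', rfl, h2⟩ := ih hs
        exact ⟨List.forall_mem_cons.2 ⟨i.2, h1⟩, l', rfl, h2⟩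

theorem IsStack.relStep {s s' : List Item} {l L : List ℕ} {a k : ℕ} (hs : IsStack S s l)
    (hv : Agrees S v L) (ha : a % 4 = 1) (haL : a ∈ L) (h : relStep m v a k s = some s') :
    IsStack S s' (a :: (4 * k + 3) :: l) := by
  simp only [FinModelCheck.relStep, Option.ite_none_right_eq_some, Option.some.injEq] at h
  obtain ⟨⟨hlen, htake⟩, rfl⟩ := h
  set is := (s.take (a / 4).unpair.1).map fun x => x.2.1 - 1 with his
  clear_value is
  rw [← List.take_append_drop (a / 4).unpair.1 s, htake] at hs
  obtain ⟨hlt, l', rfl, hs'⟩ := hs.of_vars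
  have ha' := relToken_unpair ha
  generalize (a / 4).unpair.1 = n at *
  generalize (a / 4).unpair.2 = R at *
  subst ha' hlen
  have h1 : (List.ofFn fun i : Fin is.length => is[i]) = is := List.ofFn_getElem
  have h2 := isTable_rel hv (R : V.Relations is.length) haL
    fun i => (⟨is[i], hlt _ (List.getElem_mem _)⟩ : Fin k)
  have h3 := tokens_rel (R : V.Relations is.length)
    fun i => (⟨is[i], hlt _ (List.getElem_mem _)⟩ : Fin k)
  have := IsStack.cons (IsItem.formula _ h2) hs'
  rw [h3] at this
  simp only [h1] at this
  convert this using 3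
  rw [List.cons_append, List.cons_append]
  congr 3
  conv_lhs => rw [← h1]
  rw [List.map_ofFn]
  rfl

theorem IsStack.stackStep {l L : List ℕ} {a : ℕ} {st : State} {s : List Item}
    (hv : Agrees S v L) (haL : a ∈ L) (h1 : ∀ s, st.1 = some s → IsStack S s l)
    (h2 : ∀ s, st.2.1 = some s → IsStack S s l.tail) (h3 : st.2.2 = l.head?)
    (h : stackStep m v a st = some s) : IsStack S s (a :: l) := by
  unfold FinModelCheck.stackStep at h
  split_ifs at h with c1 c2 c3 c4 c5
  · obtain ⟨s', hs', h⟩ := Option.bind_eq_some_iff.1 h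
    obtain rfl := Option.some.inj h
    obtain ⟨hi, ha⟩ := c2
    have := IsStack.cons (IsItem.var ⟨_, hi⟩) (h1 _ hs')
    rwa [List.singleton_append, ← ha] at this
  · obtain ⟨b, hb, h⟩ := Option.bind_eq_some_iff.1 h
    obtain ⟨hb4, h⟩ := Option.ite_none_right_eq_some.1 h
    obtain ⟨s', hs', h⟩ := Option.bind_eq_some_iff.1 h
    have := (h2 _ hs').relStep hv c3 haL h
    rw [h3] at hb
    obtain ⟨l', rfl⟩ := List.head?_eq_some_iff.1 hb
    rwa [show 4 * (b / 4) + 3 = b by omega] at this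
  · obtain ⟨s', hs', h⟩ := Option.bind_eq_some_iff.1 h
    obtain rfl : a = 3 := by omega
    exact (h1 _ hs').impStep h
  · obtain ⟨s', hs', h⟩ := Option.bind_eq_some_iff.1 h
    obtain rfl : a = 7 := by omega
    exact (h1 _ hs').allStep h
  · obtain ⟨s', hs', h⟩ := Option.bind_eq_some_iff.1 h
    obtain rfl := Option.some.inj h
    have := IsStack.cons (IsItem.formula _ (isTable_falsum (n := a / 4 - 2))) (h1 _ hs')
    rwa [tokens_falsum, List.singleton_append,
      show 4 * (a / 4 - 2 + 2) + 3 = a by omega] at this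

theorem isStack_run {l L : List ℕ} (hv : Agrees S v L) (hl : l ⊆ L) :
    (∀ s, (run m v l).1 = some s → IsStack S s l) ∧
      ∀ s, (run m v l).2.1 = some s → IsStack S s l.tail := by
  induction l with
  | nil =>
    refine ⟨fun s h => ?_, fun s h => ?_⟩
    · obtain rfl := Option.some.inj h
      exact IsStack.nil
    · exact absurd h (by simp [run])
  | cons a l ih =>
    obtain ⟨h1, h2⟩ := ih (List.subset_of_cons_subset hl)
    exact ⟨fun s h => IsStack.stackStep hv (hl List.mem_cons_self) h1 h2 (run_head ..) h, h1⟩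

/-- If the machine accepts `l` then `l` encodes a sentence true in `S`. -/
theorem exists_realize_of_accepts {l : List ℕ} (hv : Agrees S v l) (h : Accepts m v l) :
    ∃ φ : V.Sentence, tokens φ = l ∧ Sentence.Realize (Fin m) φ := by
  rw [Accepts, Option.any_eq_true] at h
  obtain ⟨⟨n, A, s⟩, h, hd⟩ := h
  obtain ⟨s₀, hs₀, h⟩ := Option.bind_eq_some_iff.1 h
  obtain ⟨hn, hs, hA⟩ := of_decide_eq_true hd
  simp only at hn hs hA
  subst hn hs
  obtain ⟨φ, l', rfl, hφ, hl'⟩ := ((isStack_run hv (List.Subset.refl l)).1 _ hs₀).popFormula h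
  cases hl'
  refine ⟨φ, (List.append_nil _).symm, ?_⟩
  obtain ⟨xs, -, hr⟩ := (hφ []).1 hA
  rwa [Sentence.Realize, Formula.Realize, Subsingleton.elim default xs]

end Soundness

/-! ### Completeness of the machine -/

section Completeness

variable {m : ℕ} {S : V.Structure (Fin m)} {v : List ℕ}

theorem run_vars {l : List ℕ} {s : List Item} (h : (run m v l).1 = some s) {k : ℕ}
    {is : List ℕ} (his : ∀ i ∈ is, i < k) :
    (run m v (is.map (varToken k) ++ l)).1 = some ((is.map fun i => (k, i + 1, [])) ++ s) := by
  induction is with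
  | nil => exact h
  | cons i is ih =>
    rw [List.forall_mem_cons] at his
    rw [List.map_cons, List.cons_append, run_cons, stackStep_var his.1, ih his.2]
    rfl

theorem relStep_vars (n R k : ℕ) {is : List ℕ} (his : is.length = n) (s : List Item) :
    relStep m v (relToken n R) k ((is.map fun i => (k, i + 1, [])) ++ s) =
      some ((k, 0, relTable m v (relToken n R) k is) :: s) := by
  have h1 : (relToken n R / 4).unpair.1 = n := by
    rw [relToken, show (4 * Nat.pair n R + 1) / 4 = Nat.pair n R by omega, Nat.unpair_pair]
  have h2 : ((is.map fun i => ((k, i + 1, []) : Item)) ++ s).take n =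
      is.map fun i => (k, i + 1, []) := by
    rw [List.take_left' (by simpa using his)]
  have h3 : ((is.map fun i => ((k, i + 1, []) : Item)) ++ s).drop n = s := by
    rw [List.drop_left' (by simpa using his)]
  have h4 : (is.map fun i => ((k, i + 1, []) : Item)).map (fun x => x.2.1 - 1) = is := by
    simp [Function.comp_def]
  simp only [relStep, h1, h2, h3, h4]
  rw [if_pos ⟨his, trivial⟩]

theorem popFormula_cons (n : ℕ) (A : List (List ℕ)) (s : List Item) :
    popFormula m ((n, 0, A) :: s) = some (n, A, s) := by
  simp [popFormula]

theorem run_tokens {L : List ℕ} (hv : Agrees S v L) {n : ℕ} (φ : V.BoundedFormula Empty n)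
    (hφ : tokens φ ⊆ L) {l : List ℕ} {s : List Item} (h : (run m v l).1 = some s) :
    ∃ s₀ A, (run m v (tokens φ ++ l)).1 = some s₀ ∧ popFormula m s₀ = some (n, A, s) ∧
      IsTable S φ A := by
  induction φ generalizing l s with
  | @falsum n =>
    refine ⟨(n, 0, []) :: s, [], ?_, popFormula_cons .., isTable_falsum⟩
    rw [tokens_falsum, List.singleton_append, run_cons, stackStep_falsum, h]
    rfl
  | @equal n t₁ t₂ =>
    obtain ⟨i, rfl⟩ := exists_eq_var t₁
    obtain ⟨j, rfl⟩ := exists_eq_var t₂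
    refine ⟨(n, (i : ℕ) + 1, []) :: (n, (j : ℕ) + 1, []) :: s, eqTable m n i j, ?_, ?_,
      isTable_equal i j⟩
    · rw [tokens_equal]
      exact run_vars h (is := [(i : ℕ), (j : ℕ)]) (by simp)
    · simp [popFormula]
  | @rel k n R ts =>
    choose f hf using fun i => exists_eq_var (ts i)
    obtain rfl : ts = fun i => Term.var (Sum.inr (f i)) := funext hf
    rw [tokens_rel] at hφ ⊢
    refine ⟨_, _, ?_, popFormula_cons .., isTable_rel hv R (hφ List.mem_cons_self) f⟩
    have hr := run_vars h (k := k) (is := List.ofFn fun i => (f i : ℕ))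
      (by simp [List.mem_ofFn])
    rw [List.map_ofFn] at hr
    rw [List.cons_append, List.cons_append, run_cons]
    refine (stackStep_rel n R k (run m v ((4 * k + 3) :: _)) rfl).trans ?_
    refine (congrArg (Option.bind · _) hr).trans ?_
    exact relStep_vars n R k (by simp) s
  | imp φ ψ ihφ ihψ =>
    rw [tokens_imp] at hφ ⊢
    have hsub := List.append_subset.1 (List.subset_of_cons_subset hφ)
    obtain ⟨s₁, B, h1, hp1, hB⟩ := ihψ hsub.2 h
    obtain ⟨s₂, A, h2, hp2, hA⟩ := ihφ hsub.1 h1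
    refine ⟨_, _, ?_, popFormula_cons .., hA.imp hB⟩
    rw [List.cons_append, List.append_assoc, run_cons, stackStep_imp, h2]
    simp [impStep, hp2, hp1]
  | all φ ih =>
    rw [tokens_all] at hφ ⊢
    obtain ⟨s₁, A, h1, hp1, hA⟩ := ih (List.subset_of_cons_subset hφ) h
    refine ⟨_, _, ?_, popFormula_cons .., hA.all⟩
    rw [List.cons_append, run_cons, stackStep_all, h1]
    simp [allStep, hp1]

/-- The machine accepts the tokens of every sentence true in `S`. -/
theorem accepts_tokens {φ : V.Sentence} (hv : Agrees S v (tokens φ))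
    (h : Sentence.Realize (Fin m) φ) : Accepts m v (tokens φ) := by
  obtain ⟨s₀, A, h1, hp, hA⟩ := run_tokens hv φ (List.Subset.refl _) (l := []) (s := []) rfl
  rw [List.append_nil] at h1
  rw [Accepts, h1, Option.bind_some, hp]
  have : [] ∈ A := (hA.mem_ofFn default).2 h
  simp [this]

end Completeness

/-! ### Iterated conjunctions -/

/-- The tokens of the `(n+1)`-fold conjunction of the sentence with tokens `b`. -/
def conjTokens (b : List ℕ) (n : ℕ) : List ℕ :=
  n.rec b fun _ l => 3 :: 3 :: (l ++ 3 :: (b ++ [11, 11]))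

theorem tokens_bot : tokens (⊥ : V.Sentence) = [11] :=
  tokens_falsum 0

theorem tokens_inf (φ ψ : V.Sentence) :
    tokens (φ ⊓ ψ) = 3 :: 3 :: (tokens φ ++ 3 :: (tokens ψ ++ [11, 11])) := by
  change tokens ((BoundedFormula.imp φ (BoundedFormula.imp ψ BoundedFormula.falsum)).imp
    BoundedFormula.falsum) = _
  simp [tokens_imp, tokens_falsum]

theorem tokens_iterConj (φ : V.Sentence) (n : ℕ) :
    tokens (iterConj φ n) = conjTokens (tokens φ) n := by
  induction n with
  | zero => rfl
  | succ n ih => rw [iterConj, tokens_inf, ih]; rfl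

theorem realize_iterConj {M : Type} [V.Structure M] (φ : V.Sentence) (n : ℕ) :
    Sentence.Realize M (iterConj φ n) ↔ Sentence.Realize M φ := by
  induction n with
  | zero => rfl
  | succ n ih =>
    rw [iterConj, Sentence.Realize, Formula.realize_inf]
    exact ⟨fun h => h.2, fun h => ⟨ih.2 h, h⟩⟩

theorem not_finSat_bot : ¬ FinSat ⊥ := by
  rintro ⟨M, _, -, -, h⟩
  exact h

theorem primrec_conjTokens {α : Type*} [Primcodable α] {b : α → List ℕ} {n : α → ℕ}
    (hb : Primrec b) (hn : Primrec n) : Primrec fun a => conjTokens (b a) (n a) := by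
  refine Primrec.nat_rec' (β := List ℕ) hn hb
    (h := fun a p => 3 :: 3 :: (p.2 ++ 3 :: (b a ++ [11, 11]))) ?_
  refine Primrec.list_cons.comp (Primrec.const 3) (Primrec.list_cons.comp (Primrec.const 3)
    (Primrec.list_append.comp (Primrec.snd.comp Primrec.snd) (Primrec.list_cons.comp
      (Primrec.const 3) (Primrec.list_append.comp (hb.comp Primrec.fst) (Primrec.const _)))))

theorem sublist_conjTokens (b : List ℕ) (n : ℕ) : b.Sublist (conjTokens b n) := by
  induction n with
  | zero => exact List.Sublist.refl b
  | succ n ih =>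
    exact ((ih.trans (List.sublist_append_left _ _)).cons _).cons _

theorem le_length_conjTokens (b : List ℕ) (n : ℕ) : n ≤ (conjTokens b n).length := by
  induction n with
  | zero => exact Nat.zero_le _
  | succ n ih =>
    change n + 1 ≤ (3 :: 3 :: (conjTokens b n ++ 3 :: (b ++ [11, 11]))).length
    simp only [List.length_cons, List.length_append]
    omega

/-! ### Bounds on codes of lists -/

theorem pair_le_pair {a a' b b' : ℕ} (ha : a ≤ a') (hb : b ≤ b') :
    Nat.pair a b ≤ Nat.pair a' b' :=
  ((StrictMono.monotone fun _ _ => Nat.pair_lt_pair_left b) ha).trans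
    ((StrictMono.monotone fun _ _ => Nat.pair_lt_pair_right a') hb)

theorem encode_cons_le_encode_cons {a b : ℕ} {l l' : List ℕ} (h : a ≤ b)
    (hl : encode l ≤ encode l') : encode (a :: l) ≤ encode (b :: l') := by
  rw [encode_list_cons, encode_list_cons]
  exact Nat.succ_le_succ (pair_le_pair h hl)

theorem encode_le_encode_of_sublist {l l' : List ℕ} (h : l.Sublist l') :
    encode l ≤ encode l' := by
  induction h with
  | slnil => exact le_rfl
  | @cons l l' a _ ih =>
    rw [encode_list_cons]
    exact ih.trans ((Nat.right_le_pair _ _).trans (Nat.le_succ _))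
  | cons_cons a _ ih => exact encode_cons_le_encode_cons le_rfl ih

theorem le_encode_of_mem {a : ℕ} {l : List ℕ} (h : a ∈ l) : a ≤ encode l := by
  refine le_trans ?_ (encode_le_encode_of_sublist (List.singleton_sublist.2 h))
  rw [encode_list_cons]
  exact (Nat.left_le_pair _ _).trans (Nat.le_succ _)

theorem encode_le_encode_replicate {l : List ℕ} {N C : ℕ} (hlen : l.length ≤ N)
    (hl : ∀ a ∈ l, a ≤ C) : encode l ≤ encode (List.replicate N C) := by
  refine le_trans ?_ (encode_le_encode_of_sublist (List.replicate_sublist_replicate C |>.2 hlen))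
  clear hlen
  induction l with
  | nil => exact le_rfl
  | cons a l ih =>
    rw [List.forall_mem_cons] at hl
    exact encode_cons_le_encode_cons hl.1 (ih hl.2)

/-! ### Bounded search for a model -/

/-- A strict bound for the codes of ground atoms on `Fin m` with relation tokens at most `k`. -/
def atomBound (m k : ℕ) : ℕ := encode (List.replicate (k + 1) (k + m)) + 1

/-- A strict bound for the codes of structures on `Fin m` with relation tokens at most `k`. -/
def structBound (m k : ℕ) : ℕ :=
  encode (List.replicate (atomBound m k) (atomBound m k)) + 1

theorem primrec_structBound {α : Type*} [Primcodable α] {m k : α → ℕ} (hm : Primrec m)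
    (hk : Primrec k) : Primrec fun a => structBound (m a) (k a) := by
  have h : Primrec fun a => atomBound (m a) (k a) :=
    Primrec.succ.comp (Primrec.encode.comp (primrec_replicate (Primrec.succ.comp hk)
      (Primrec.nat_add.comp hk hm)))
  exact Primrec.succ.comp (Primrec.encode.comp (primrec_replicate h h))

theorem encode_atom_lt {m n k R : ℕ} (h : relToken n R ≤ k) (xs : Fin n → Fin m) :
    encode (relToken n R :: List.ofFn fun i => (xs i : ℕ)) < atomBound m k := by
  have hn : n ≤ k := by
    have := Nat.left_le_pair n R
    rw [relToken] at h
    omega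
  refine Nat.lt_succ_of_le (encode_le_encode_replicate ?_ ?_)
  · simpa using hn
  · rw [List.forall_mem_cons]
    refine ⟨by omega, fun a ha => ?_⟩
    obtain ⟨i, rfl⟩ := List.mem_ofFn.1 ha
    have := (xs i).2
    omega

theorem relToken_inj {n n' R R' : ℕ} (h : relToken n R = relToken n' R') : n = n' ∧ R = R' := by
  rw [relToken, relToken] at h
  exact Nat.pair_eq_pair.1 (by omega)

/-- Every structure on `Fin m` is described by a list with small code. -/
theorem exists_agrees {m k : ℕ} (S : V.Structure (Fin m)) {l : List ℕ} (hl : ∀ a ∈ l, a ≤ k) :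
    ∃ v, Agrees S v l ∧ encode v < structBound m k := by
  classical
  let p : ℕ → Prop := fun c => ∃ (n : ℕ) (R : V.Relations n) (xs : Fin n → Fin m),
    S.RelMap R xs ∧ c = encode (relToken n R :: List.ofFn fun i => (xs i : ℕ))
  refine ⟨(List.range (atomBound m k)).filter (p ·), fun n R hR xs => ?_,
    Nat.lt_succ_of_le (encode_le_encode_replicate ?_ fun a ha => ?_)⟩
  · rw [List.mem_filter, List.mem_range, decide_eq_true_iff]
    refine ⟨fun h => ⟨encode_atom_lt (hl _ hR) xs, n, R, xs, h, rfl⟩, ?_⟩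
    rintro ⟨-, n', R', xs', h, he⟩
    obtain ⟨h1, h2⟩ := List.cons.inj (encode_injective he)
    obtain ⟨rfl, h3⟩ := relToken_inj h1
    cases h3
    rwa [ofFn_val_injective h2]
  · exact (List.length_filter_le _ _).trans List.length_range.le
  · exact (List.mem_range.1 (List.mem_of_mem_filter ha)).le

/-- The structure on `Fin m` described by a list of codes of true ground atoms. -/
abbrev structureOf (m : ℕ) (v : List ℕ) : V.Structure (Fin m) where
  funMap f := isEmptyElim f
  RelMap {n} R xs := encode (relToken n R :: List.ofFn fun i => (xs i : ℕ)) ∈ v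

theorem agrees_structureOf (m : ℕ) (v l : List ℕ) : Agrees (structureOf m v) v l :=
  fun _ _ _ _ => Iff.rfl

/-- Having a model with `m` elements amounts to a bounded search. -/
theorem exists_accepts_iff {m : ℕ} {b : List ℕ} :
    (∃ w < structBound m (encode b), Accepts m (ofNat (List ℕ) w) b) ↔
      ∃ φ : V.Sentence, tokens φ = b ∧
        ∃ (M : Type) (_ : V.Structure M), Finite M ∧ Nat.card M = m ∧ Sentence.Realize M φ := by
  constructor
  · rintro ⟨w, -, hw⟩
    let S := structureOf m (ofNat (List ℕ) w)
    obtain ⟨φ, hφ, hr⟩ := exists_realize_of_accepts (agrees_structureOf m _ b) hw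
    exact ⟨φ, hφ, Fin m, S, inferInstance, Nat.card_fin m, hr⟩
  · rintro ⟨φ, rfl, M, SM, _, hM, hr⟩
    let e : M ≃ Fin m := Finite.equivFinOfCardEq hM
    let S : V.Structure (Fin m) := e.inducedStructure
    obtain ⟨v, hv, hlt⟩ := exists_agrees S (l := tokens φ) fun a ha => le_encode_of_mem ha
    refine ⟨encode v, hlt, ?_⟩
    rw [ofNat_encode]
    exact accepts_tokens hv
      ((StrongHomClass.realize_sentence (e.inducedStructureEquiv (L := V)) φ).1 hr)

/-! ### The fragment -/

/-- Membership of a code in the fragment, as a bounded search. -/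
theorem exists_mem_L6_iff (k : ℕ) :
    (∃ ψ ∈ L6, encode ψ = k) ↔
      k = encode [11] ∨ ∃ n < k + 1, ∃ b < k + 1, encode (conjTokens (ofNat (List ℕ) b) n) = k ∧
        ∃ w < structBound (n + 1) b, Accepts (n + 1) (ofNat (List ℕ) w) (ofNat (List ℕ) b) := by
  constructor
  · rintro ⟨ψ, rfl | ⟨φ, n, rfl, hφ⟩, rfl⟩
    · exact Or.inl (by rw [encode_sentence, tokens_bot])
    · right
      rw [encode_sentence, tokens_iterConj]
      refine ⟨n, ?_, encode (tokens φ), ?_, ?_⟩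
      · exact Nat.lt_succ_of_le ((le_length_conjTokens _ n).trans (length_le_encode _))
      · exact Nat.lt_succ_of_le (encode_le_encode_of_sublist (sublist_conjTokens _ n))
      · rw [ofNat_encode]
        exact ⟨rfl, exists_accepts_iff.2 ⟨φ, rfl, hφ⟩⟩
  · rintro (rfl | ⟨n, -, b, -, rfl, h⟩)
    · exact ⟨⊥, Set.mem_insert _ _, by rw [encode_sentence, tokens_bot]⟩
    · obtain ⟨b, rfl⟩ : ∃ l : List ℕ, encode l = b := ⟨ofNat (List ℕ) b, encode_ofNat b⟩
      rw [ofNat_encode] at h ⊢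
      obtain ⟨φ, rfl, hφ⟩ := exists_accepts_iff.1 h
      exact ⟨iterConj φ n, Or.inr ⟨φ, n, rfl, hφ⟩, by rw [encode_sentence, tokens_iterConj]⟩

theorem primrecPred_mem_L6 : PrimrecPred fun k => ∃ ψ ∈ L6, encode ψ = k := by
  refine PrimrecPred.of_eq ?_ fun k => (exists_mem_L6_iff k).symm
  refine (primrecPred_eq_const _ Primrec.id).or ?_
  refine primrecPred_exists_lt Primrec.succ ?_
  refine primrecPred_exists_lt (Primrec.succ.comp Primrec.fst) ?_
  have hn : Primrec fun p : (ℕ × ℕ) × ℕ => p.1.2 := Primrec.snd.comp Primrec.fst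
  have hb : Primrec fun p : (ℕ × ℕ) × ℕ => ofNat (List ℕ) p.2 :=
    (Primrec.ofNat (List ℕ)).comp Primrec.snd
  refine (Primrec.eq.comp (Primrec.encode.comp (primrec_conjTokens hb hn))
    (Primrec.fst.comp Primrec.fst)).and ?_
  refine primrecPred_exists_lt (primrec_structBound (Primrec.succ.comp hn) Primrec.snd) ?_
  exact primrecPred_accepts (Primrec.succ.comp (hn.comp Primrec.fst))
    ((Primrec.ofNat (List ℕ)).comp Primrec.snd) (hb.comp Primrec.fst)

theorem sameExprFin_L6 : SameExprFin L6 := by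
  intro φ
  by_cases h : FinSat φ
  · obtain ⟨M, SM, hM, hne, hr⟩ := h
    have hcard : Nat.card M = (Nat.card M - 1) + 1 := (Nat.sub_add_cancel Nat.card_pos).symm
    exact ⟨iterConj φ (Nat.card M - 1), Or.inr ⟨φ, _, rfl, M, SM, hM, hcard, hr⟩,
      fun N _ _ _ => (realize_iterConj φ _).symm⟩
  · exact ⟨⊥, Set.mem_insert _ _, fun N SN hN hne =>
      ⟨fun hr => (h ⟨N, SN, hN, hne, hr⟩).elim, fun hr => hr.elim⟩⟩

theorem finSat_iff_ne_bot {ψ : V.Sentence} (h : ψ ∈ L6) : FinSat ψ ↔ ψ ≠ ⊥ := by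
  refine ⟨fun hs he => not_finSat_bot (he ▸ hs), fun hne => ?_⟩
  obtain rfl | ⟨φ, n, rfl, M, SM, hM, hcard, hr⟩ := h
  · exact absurd rfl hne
  · exact ⟨M, SM, hM, (Nat.card_pos_iff.1 (by omega)).1, (realize_iterConj φ n).2 hr⟩

theorem primrecPred_finSat_L6 : PrimrecPred fun k => ∃ ψ ∈ L6, encode ψ = k ∧ FinSat ψ := by
  refine (primrecPred_mem_L6.and
    (primrecPred_eq_const (encode (⊥ : V.Sentence)) Primrec.id).not).of_eq fun k => ?_
  constructor
  · rintro ⟨⟨ψ, hψ, rfl⟩, hne⟩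
    exact ⟨ψ, hψ, rfl, (finSat_iff_ne_bot hψ).2 fun h => hne (congrArg encode h)⟩
  · rintro ⟨ψ, hψ, rfl, hs⟩
    exact ⟨⟨ψ, hψ, rfl⟩, fun h => (finSat_iff_ne_bot hψ).1 hs (encode_injective h)⟩

end FinModelCheck

/-- `L6` is computable, equi-expressive with FO over finite models, and has a
computable finite satisfiability problem. -/
theorem L6_props :
    (ComputablePred fun k => ∃ ψ ∈ L6, Encodable.encode ψ = k) ∧
    SameExprFin L6 ∧
    (ComputablePred fun k => ∃ ψ ∈ L6, Encodable.encode ψ = k ∧ FinSat ψ) := by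
  exact ⟨FinModelCheck.primrecPred_mem_L6.computablePred, FinModelCheck.sameExprFin_L6,
    FinModelCheck.primrecPred_finSat_L6.computablePred⟩
end

section
/- Let L be a computable set of FO sentences which has the same expressive power as FO over all models, i.e., for every FO sentence φ there exists ψ ∈ L such that φ and ψ are satisfied by exactly the same nonempty V-structures (of any cardinality). Then the satisfiability problem of L is undecidable: the set of (codes of) sentences of L that have a nonempty model is not a computable subset of ℕ. -/
open FirstOrder Language

/-- A `V`-sentence is satisfiable if it has a nonempty model. -/
def Sat (φ : V.Sentence) : Prop :=
  ∃ (M : Type) (_ : V.Structure M), Nonempty M ∧ M ⊨ φ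

/-- `L` has the same expressive power as full first-order logic over all models. -/
def SameExprAll (L : Set V.Sentence) : Prop :=
  ∀ φ : V.Sentence, ∃ ψ ∈ L,
    ∀ (M : Type) (_ : V.Structure M), Nonempty M → (M ⊨ φ ↔ M ⊨ ψ)

section Codes

variable {n : ℕ}

/-- The code of the symbol `m` used by the list encoding of formulas for connectives and levels. -/
def markCode (m : ℕ) : ℕ := 2 * (2 * m + 1) + 1

/-- The code of the `R`-th relation symbol of arity `k`. -/
def relCode (k R : ℕ) : ℕ := 2 * (2 * Nat.pair k R) + 1

/-- The code of the `i`-th bound variable in a formula of level `n`. -/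
def varCode (n i : ℕ) : ℕ := 2 * Nat.pair n (Nat.pair (2 * (2 * i + 1)) 0 + 1)

/-- The list of codes of the symbols of a formula. -/
def formulaCode (φ : V.BoundedFormula Empty n) : List ℕ :=
  φ.listEncode.map Encodable.encode

/-- The index of a relation symbol. -/
def relIndex {k : ℕ} (R : V.Relations k) : ℕ := R

/-- The index of the variable that a term of the relational language `V` consists of. -/
def varIndex : V.Term (Empty ⊕ Fin n) → Fin n
  | .var (.inr i) => i
  | .var (.inl e) => e.elim
  | .func f _ => isEmptyElim f

theorem eq_var_varIndex : ∀ t : V.Term (Empty ⊕ Fin n), t = .var (.inr (varIndex t))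
  | .var (.inr _) => rfl
  | .var (.inl e) => e.elim
  | .func f _ => isEmptyElim f

theorem realize_eq_varIndex {M : Type} [V.Structure M] (v : Empty → M) (xs : Fin n → M)
    (t : V.Term (Empty ⊕ Fin n)) : t.realize (Sum.elim v xs) = xs (varIndex t) := by
  conv_lhs => rw [eq_var_varIndex t]
  rfl

theorem encode_term (t : V.Term (Empty ⊕ Fin n)) :
    Encodable.encode (⟨n, t⟩ : Σ k, V.Term (Empty ⊕ Fin k)) = Nat.pair n
      (Nat.pair (2 * (2 * varIndex t + 1)) 0 + 1) := by
  rw [eq_var_varIndex t]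
  rfl

theorem formulaCode_falsum :
    formulaCode (.falsum : V.BoundedFormula Empty n) = [markCode (n + 2)] := rfl

theorem formulaCode_equal (t₁ t₂ : V.Term (Empty ⊕ Fin n)) :
    formulaCode (.equal t₁ t₂) = [varCode n (varIndex t₁), varCode n (varIndex t₂)] := by
  change [2 * Encodable.encode (⟨n, t₁⟩ : Σ k, V.Term (Empty ⊕ Fin k)),
    2 * Encodable.encode (⟨n, t₂⟩ : Σ k, V.Term (Empty ⊕ Fin k))] = _
  rw [encode_term, encode_term]
  rfl

theorem formulaCode_rel {k : ℕ} (R : V.Relations k) (ts : Fin k → V.Term (Empty ⊕ Fin n)) :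
    formulaCode (.rel R ts) = relCode k (relIndex R) :: markCode n ::
      (List.ofFn fun i => (varIndex (ts i) : ℕ)).map (varCode n) := by
  rw [List.ofFn_eq_map, List.map_map]
  refine congrArg (fun l => relCode k (relIndex R) :: markCode n :: l) ?_
  refine List.map_map.trans (List.map_congr_left fun i _ => ?_)
  change 2 * Encodable.encode (⟨n, ts i⟩ : Σ k, V.Term (Empty ⊕ Fin k)) = _
  rw [encode_term]
  rfl

theorem formulaCode_imp (φ ψ : V.BoundedFormula Empty n) :
    formulaCode (φ.imp ψ) = markCode 0 :: formulaCode φ ++ formulaCode ψ := by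
  simp only [formulaCode, BoundedFormula.listEncode, List.map_append, List.map_cons]
  rfl

theorem formulaCode_all (φ : V.BoundedFormula Empty (n + 1)) :
    formulaCode φ.all = markCode 1 :: formulaCode φ := by
  simp only [formulaCode, BoundedFormula.listEncode, List.map_cons]
  rfl

theorem formulaCode_injective :
    Function.Injective (formulaCode : V.BoundedFormula Empty n → List ℕ) := fun φ ψ h => by
  have := BoundedFormula.listEncode_sigma_injective (L := V) (α := Empty) (a₁ := ⟨n, φ⟩)
    (a₂ := ⟨n, ψ⟩) (Encodable.encode_injective.list_map h)
  simpa using this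

theorem encode_sentence (φ : V.Sentence) :
    Encodable.encode φ = Encodable.encode (formulaCode φ) := by
  have h : ∀ l : List ((Σ k, V.Term (Empty ⊕ Fin k)) ⊕ ((Σ n, V.Relations n) ⊕ ℕ)),
      Encodable.encode l = Encodable.encode (l.map Encodable.encode) := by
    intro l
    induction l with
    | nil => rfl
    | cons a l ih =>
      rw [List.map_cons, Encodable.encode_list_cons, Encodable.encode_list_cons, ih]
      rfl
  exact h _

theorem primrec_markCode : Primrec markCode := by
  have h : Primrec fun m : ℕ => 2 * m + 1 :=
    Primrec.succ.comp (Primrec.nat_mul.comp (Primrec.const 2) Primrec.id)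
  exact h.comp h

theorem primrec_relCode : Primrec₂ relCode :=
  Primrec.succ.comp (Primrec.nat_mul.comp (Primrec.const 2)
    (Primrec.nat_mul.comp (Primrec.const 2) Primrec₂.natPair))

theorem primrec_varCode : Primrec₂ varCode := by
  have h : Primrec fun m : ℕ => 2 * m + 1 :=
    Primrec.succ.comp (Primrec.nat_mul.comp (Primrec.const 2) Primrec.id)
  exact Primrec.nat_mul.comp (Primrec.const 2) (Primrec₂.natPair.comp Primrec.fst
    (Primrec.succ.comp (Primrec₂.natPair.comp (Primrec.nat_mul.comp (Primrec.const 2)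
      (h.comp Primrec.snd)) (Primrec.const 0))))

end Codes

section RecursivelyEnumerable

variable {α β : Type*} [Primcodable α]

/-- Unbounded existential quantification of a computable predicate is recursively enumerable. -/
theorem rePred_exists_of_computablePred [Denumerable β] {p : α × β → Prop}
    (hp : ComputablePred p) : REPred fun a => ∃ b, p (a, b) := by
  obtain ⟨_, h⟩ := hp
  have h1 : Computable₂ fun (a : α) (k : ℕ) => decide (p (a, Denumerable.ofNat β k)) :=
    h.comp (Computable.pair Computable.fst ((Computable.ofNat β).comp Computable.snd))
  have h2 : Partrec fun a : α =>
      Nat.rfind fun k => Part.some (decide (p (a, Denumerable.ofNat β k))) := Partrec.rfind h1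
  refine h2.dom_re.of_eq fun a => ?_
  refine Nat.rfind_dom.trans ?_
  constructor
  · rintro ⟨n, hn, -⟩
    exact ⟨_, by simpa using hn⟩
  · rintro ⟨b, hb⟩
    exact ⟨Encodable.encode b, by simpa using hb, fun _ => trivial⟩

/-- All Boolean lists of a given length. -/
def boolLists : ℕ → List (List Bool)
  | 0 => [ [] ]
  | n + 1 => (boolLists n).flatMap fun l => [true :: l, false :: l]

theorem mem_boolLists : ∀ {n : ℕ} {l : List Bool}, l ∈ boolLists n ↔ l.length = n
  | 0, l => by simp [boolLists]
  | n + 1, [] => by simp [boolLists]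
  | n + 1, b :: l => by cases b <;> simp [boolLists, mem_boolLists]

theorem primrec_boolLists : Primrec boolLists := by
  have h : Primrec fun L : List (List Bool) => L.flatMap fun l => [true :: l, false :: l] :=
    Primrec.list_flatMap Primrec.id
      (Primrec.list_cons.comp (Primrec.list_cons.comp (Primrec.const true) Primrec.snd)
        (Primrec.list_cons.comp (Primrec.list_cons.comp (Primrec.const false) Primrec.snd)
          (Primrec.const [])))
  refine (Primrec.nat_rec₁ [ [] ] (h.comp Primrec.snd).to₂).of_eq fun n => ?_
  induction n with
  | zero => rfl
  | succ n ih => simp only [boolLists, ← ih]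

/-- A valuation satisfies a propositional clause, given as a list of signed atoms. -/
def SatisfiesClause (T : ℕ → Bool) (C : List (ℕ × Bool)) : Prop :=
  ∃ x ∈ C, T x.1 = x.2

/-- Propositional compactness, in a form suited to a search over finite partial valuations. -/
theorem not_satisfiable_iff_exists_bound (cls : ℕ → List (List (ℕ × Bool))) :
    (¬ ∃ T : ℕ → Bool, ∀ b, ∀ C ∈ cls b, SatisfiesClause T C) ↔
      ∃ N, ∀ l ∈ boolLists N, ∃ b < N, ∃ C ∈ cls b, ∀ x ∈ C, l[x.1]? = some (!x.2) := by
  constructor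
  · intro h
    by_contra hN
    push Not at hN
    let K : ℕ → Set (ℕ → Bool) := fun N =>
      {T | ∀ b < N, ∀ C ∈ cls b, ∃ x ∈ C, N ≤ x.1 ∨ T x.1 = x.2}
    have hK : ∀ N, IsClosed (K N) := by
      intro N
      have : K N = ⋂ b, ⋂ (_ : b < N), ⋂ C, ⋂ (_ : C ∈ cls b),
          ⋃ x ∈ {x | x ∈ C}, {T | N ≤ x.1 ∨ T x.1 = x.2} := by
        ext T; simp [K]
      rw [this]
      refine isClosed_iInter fun b => isClosed_iInter fun _ => isClosed_iInter fun C =>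
        isClosed_iInter fun _ => (List.finite_toSet C).isClosed_biUnion fun x _ => ?_
      exact (isClosed_const).union (isClosed_eq (continuous_apply x.1) continuous_const)
    have hne : (⋂ N, K N).Nonempty := by
      refine IsCompact.nonempty_iInter_of_sequence_nonempty_isCompact_isClosed K ?_ ?_
        (hK 0).isCompact hK
      · intro N T hT b hb C hC
        obtain ⟨x, hx, hx'⟩ := hT b (by omega) C hC
        exact ⟨x, hx, hx'.imp (by omega) id⟩
      · intro N
        obtain ⟨l, hl, hl'⟩ := hN N
        rw [mem_boolLists] at hl
        refine ⟨fun i => l.getD i true, fun b hb C hC => ?_⟩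
        obtain ⟨x, hx, hx'⟩ := hl' b hb C hC
        refine ⟨x, hx, ?_⟩
        by_cases hlt : x.1 < N
        · right
          rw [List.getElem?_eq_getElem (by omega)] at hx'
          beta_reduce
          rw [List.getD_eq_getElem l true (by omega)]
          simpa using hx'
        · left; omega
    obtain ⟨T, hT⟩ := hne
    refine h ⟨T, fun b C hC => ?_⟩
    obtain ⟨M, hM⟩ : ∃ M, ∀ x ∈ C, x.1 < M := by
      refine ⟨(C.map Prod.fst).sum + 1, fun x hx => ?_⟩
      have := List.le_sum_of_mem (List.mem_map_of_mem (f := Prod.fst) hx)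
      omega
    obtain ⟨x, hx, hx'⟩ := Set.mem_iInter.1 hT (max M (b + 1)) b (by omega) C hC
    have := hM x hx
    exact ⟨x, hx, hx'.resolve_left (by omega)⟩
  · rintro ⟨N, hN⟩ ⟨T, hT⟩
    obtain ⟨b, -, C, hC, hl⟩ := hN ((List.range N).map T) (by simp [mem_boolLists])
    obtain ⟨x, hx, hx'⟩ := hT b C hC
    have := hl x hx
    by_cases hlt : x.1 < N
    · simp [List.getElem?_range hlt, hx'] at this
    · simp [List.getElem?_eq_none (l := List.range N) (by simpa using hlt)] at this

/-- The search for a finite refutation of a primitive recursive family of clauses. -/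
theorem primrecPred_refutation {cls : α → ℕ → List (List (ℕ × Bool))} (h : Primrec₂ cls) :
    PrimrecPred fun p : α × ℕ => ∀ l ∈ boolLists p.2, ∃ b < p.2, ∃ C ∈ cls p.1 b,
      ∀ x ∈ C, l[x.1]? = some (!x.2) := by
  have h1 : PrimrecRel fun (x : ℕ × Bool) (l : List Bool) => l[x.1]? = some (!x.2) :=
    Primrec.eq.comp
      (Primrec.list_getElem?.comp Primrec.snd (Primrec.fst.comp Primrec.fst))
      (Primrec.option_some.comp (Primrec.not.comp (Primrec.snd.comp Primrec.fst)))
  have h2 := h1.forall_mem_list.exists_mem_list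
  have h3 : PrimrecRel fun (b : ℕ) (q : α × List Bool) => ∃ C ∈ cls q.1 b,
      ∀ x ∈ C, q.2[x.1]? = some (!x.2) :=
    h2.comp (h.comp (Primrec.fst.comp Primrec.snd) Primrec.fst) (Primrec.snd.comp Primrec.snd)
  have h4 : PrimrecRel fun (l : List Bool) (p : α × ℕ) => ∃ b ∈ List.range p.2, ∃ C ∈ cls p.1 b,
      ∀ x ∈ C, l[x.1]? = some (!x.2) :=
    (h3.exists_mem_list.comp (f := fun q : List Bool × α × ℕ => List.range q.2.2)
      (g := fun q => (q.2.1, q.1)) (Primrec.list_range.comp (Primrec.snd.comp Primrec.snd))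
      (Primrec.pair (Primrec.fst.comp Primrec.snd) Primrec.fst) :)
  simp only [List.mem_range] at h4
  exact h4.forall_mem_list.comp (primrec_boolLists.comp Primrec.snd) Primrec.id

end RecursivelyEnumerable

section Clauses

/-- Propositional atoms: `Sum.inl (r, es)` asserts the relation `r` of the elements `es`, where `0`
stands for equality and `R + 1` for the `R`-th relation symbol of arity `es.length`, and
`Sum.inr (s, l, v)` asserts that the formula with code `l` has truth value `s` at `v`. -/
abbrev HenkinAtom := (ℕ × List ℕ) ⊕ (Bool × List ℕ × List ℕ)

/-- The number of the atom for a relation between elements. -/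
def relAtom (r : ℕ) (es : List ℕ) : ℕ := Encodable.encode (Sum.inl (r, es) : HenkinAtom)

/-- The number of the atom for the truth value of a formula. -/
def valAtom (s : Bool) (l v : List ℕ) : ℕ := Encodable.encode (Sum.inr (s, l, v) : HenkinAtom)

/-- The Henkin witness for the universal quantification of the formula with code `l` at `v`. -/
def henkinWitness (l v : List ℕ) : ℕ := Encodable.encode (l, v)

/-- The clause linking the truth value of an atomic formula to the relation it expresses. -/
def atomicClause (s : Bool) (r : ℕ) (pre v a : List ℕ) : List (ℕ × Bool) :=
  if ∀ i ∈ a, i < v.length then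
    [(relAtom r (a.map (v.getD · 0)), !s), (valAtom s (pre ++ a.map (varCode v.length)) v, true)]
  else [(0, true), (0, false)]

/-- The clause computing the truth value of an implication. -/
def impClause (s t : Bool) (a b v : List ℕ) : List (ℕ × Bool) :=
  [(valAtom s a v, false), (valAtom t b v, false),
    (valAtom (!s || t) (markCode 0 :: a ++ b) v, true)]

/-- The clause computing the truth value of a universal formula from one instance. -/
def allClause (s : Bool) (k : ℕ) (a v : List ℕ) : List (ℕ × Bool) :=
  [(valAtom s a (v ++ [k]), false), (valAtom s (markCode 1 :: a) v, true)]

/-- The clause expressing that equality is a congruence for the relation `r`. -/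
def congrClause (r : ℕ) (ps : List ℕ) : List (ℕ × Bool) :=
  (ps.map fun p => (relAtom 0 [p.unpair.1, p.unpair.2], false)) ++
    [(relAtom r (ps.map fun p => p.unpair.1), false),
      (relAtom r (ps.map fun p => p.unpair.2), true)]

/-- Parameters of the clauses. -/
abbrev ClauseParam := ℕ × ℕ × List ℕ × List ℕ × List ℕ

/-- The clauses, with the given parameters, that describe the models of the sentence with code
`c.1` in which the sentence with code `c.2` fails. -/
def henkinClauses (c : List ℕ × List ℕ) (p : ClauseParam) : List (List (ℕ × Bool)) :=
  match p with
  | (r, k, a, b, v) =>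
    [ [(valAtom false c.1 [], false)],
      [(valAtom true c.2 [], false)],
      [(valAtom false [markCode (v.length + 2)] v, true)],
      impClause true true a b v, impClause true false a b v,
      impClause false true a b v, impClause false false a b v,
      allClause false k a v, allClause true (henkinWitness a v) a v,
      atomicClause true (r + 1) [relCode a.length r, markCode v.length] v a,
      atomicClause false (r + 1) [relCode a.length r, markCode v.length] v a,
      atomicClause true 0 [] v [r, k], atomicClause false 0 [] v [r, k],
      [(relAtom 0 [k, k], true)],
      congrClause r a]

section Primrec

variable {α : Type*} [Primcodable α]

theorem primrec_singleton {σ : Type*} [Primcodable σ] {f : α → σ} (hf : Primrec f) :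
    Primrec fun x => [f x] := Primrec.list_cons.comp hf (Primrec.const [])

theorem primrec_relAtom {f : α → ℕ} {g : α → List ℕ} (hf : Primrec f) (hg : Primrec g) :
    Primrec fun x => relAtom (f x) (g x) :=
  Primrec.encode.comp (Primrec.sumInl.comp (Primrec.pair hf hg))

theorem primrec_valAtom {s : Bool} {f g : α → List ℕ} (hf : Primrec f) (hg : Primrec g) :
    Primrec fun x => valAtom s (f x) (g x) :=
  Primrec.encode.comp (Primrec.sumInr.comp (Primrec.pair (Primrec.const s) (Primrec.pair hf hg)))

theorem primrec_literal {s : Bool} {f : α → ℕ} (hf : Primrec f) : Primrec fun x => (f x, s) :=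
  Primrec.pair hf (Primrec.const s)

theorem primrec_atomicClause {s : Bool} {r : α → ℕ} {pre v a : α → List ℕ} (hr : Primrec r)
    (hpre : Primrec pre) (hv : Primrec v) (ha : Primrec a) :
    Primrec fun x => atomicClause s (r x) (pre x) (v x) (a x) := by
  have h1 : PrimrecPred fun x => ∀ i ∈ a x, i < (v x).length :=
    Primrec.nat_lt.forall_mem_list.comp ha (Primrec.list_length.comp hv)
  refine Primrec.ite h1 ?_ (Primrec.const _)
  refine Primrec.list_cons.comp (primrec_literal (primrec_relAtom hr ?_))
    (primrec_singleton (primrec_literal (primrec_valAtom ?_ hv)))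
  · exact Primrec.list_map ha ((Primrec.list_getD 0).comp (hv.comp Primrec.fst) Primrec.snd)
  · exact Primrec.list_append.comp hpre (Primrec.list_map ha
      (primrec_varCode.comp (Primrec.list_length.comp (hv.comp Primrec.fst)) Primrec.snd))

theorem primrec_impClause {s t : Bool} {a b v : α → List ℕ} (ha : Primrec a) (hb : Primrec b)
    (hv : Primrec v) : Primrec fun x => impClause s t (a x) (b x) (v x) :=
  Primrec.list_cons.comp (primrec_literal (primrec_valAtom ha hv))
    (Primrec.list_cons.comp (primrec_literal (primrec_valAtom hb hv))
      (primrec_singleton (primrec_literal (primrec_valAtom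
        (Primrec.list_append.comp (Primrec.list_cons.comp (Primrec.const _) ha) hb) hv))))

theorem primrec_allClause {s : Bool} {k : α → ℕ} {a v : α → List ℕ} (hk : Primrec k)
    (ha : Primrec a) (hv : Primrec v) : Primrec fun x => allClause s (k x) (a x) (v x) :=
  Primrec.list_cons.comp
    (primrec_literal (primrec_valAtom ha (Primrec.list_append.comp hv (primrec_singleton hk))))
    (primrec_singleton (primrec_literal
      (primrec_valAtom (Primrec.list_cons.comp (Primrec.const _) ha) hv)))

theorem primrec_congrClause {r : α → ℕ} {ps : α → List ℕ} (hr : Primrec r) (hps : Primrec ps) :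
    Primrec fun x => congrClause (r x) (ps x) := by
  have h1 : Primrec₂ fun (_ : α) (p : ℕ) => p.unpair.1 :=
    Primrec.fst.comp (Primrec.unpair.comp Primrec.snd)
  have h2 : Primrec₂ fun (_ : α) (p : ℕ) => p.unpair.2 :=
    Primrec.snd.comp (Primrec.unpair.comp Primrec.snd)
  refine Primrec.list_append.comp (Primrec.list_map hps ?_) (Primrec.list_cons.comp
    (primrec_literal (primrec_relAtom hr (Primrec.list_map hps h1)))
    (primrec_singleton (primrec_literal (primrec_relAtom hr (Primrec.list_map hps h2)))))
  exact primrec_literal (primrec_relAtom (Primrec.const 0)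
    (Primrec.list_cons.comp h1 (primrec_singleton h2)))

theorem primrec_henkinClauses : Primrec₂ henkinClauses := by
  have hc1 : Primrec fun q : (List ℕ × List ℕ) × ClauseParam => q.1.1 :=
    Primrec.fst.comp Primrec.fst
  have hc2 : Primrec fun q : (List ℕ × List ℕ) × ClauseParam => q.1.2 :=
    Primrec.snd.comp Primrec.fst
  have hr : Primrec fun q : (List ℕ × List ℕ) × ClauseParam => q.2.1 :=
    Primrec.fst.comp Primrec.snd
  have hs := Primrec.snd.comp
    (Primrec.snd (α := List ℕ × List ℕ) (β := ClauseParam))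
  have hk : Primrec fun q : (List ℕ × List ℕ) × ClauseParam => q.2.2.1 := Primrec.fst.comp hs
  have ha : Primrec fun q : (List ℕ × List ℕ) × ClauseParam => q.2.2.2.1 :=
    Primrec.fst.comp (Primrec.snd.comp hs)
  have hb : Primrec fun q : (List ℕ × List ℕ) × ClauseParam => q.2.2.2.2.1 :=
    Primrec.fst.comp (Primrec.snd.comp (Primrec.snd.comp hs))
  have hv : Primrec fun q : (List ℕ × List ℕ) × ClauseParam => q.2.2.2.2.2 :=
    Primrec.snd.comp (Primrec.snd.comp (Primrec.snd.comp hs))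
  have hlen := Primrec.list_length.comp hv
  have hpre := Primrec.list_cons.comp (primrec_relCode.comp (Primrec.list_length.comp ha) hr)
    (primrec_singleton (primrec_markCode.comp hlen))
  have hrk := Primrec.list_cons.comp hr (primrec_singleton hk)
  have hnil := Primrec.const (α := (List ℕ × List ℕ) × ClauseParam) ([] : List ℕ)
  have hzero := Primrec.const (α := (List ℕ × List ℕ) × ClauseParam) 0
  have cons {f : (List ℕ × List ℕ) × ClauseParam → List (ℕ × Bool)}
      {g : (List ℕ × List ℕ) × ClauseParam → List (List (ℕ × Bool))} (hf : Primrec f)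
      (hg : Primrec g) : Primrec fun q => f q :: g q := Primrec.list_cons.comp hf hg
  refine Primrec₂.mk ?_
  refine cons (primrec_singleton (primrec_literal (primrec_valAtom hc1 hnil))) ?_
  refine cons (primrec_singleton (primrec_literal (primrec_valAtom hc2 hnil))) ?_
  refine cons (primrec_singleton (primrec_literal (primrec_valAtom (primrec_singleton
    (primrec_markCode.comp (Primrec.succ.comp (Primrec.succ.comp hlen)))) hv))) ?_
  refine cons (primrec_impClause ha hb hv) (cons (primrec_impClause ha hb hv) ?_)
  refine cons (primrec_impClause ha hb hv) (cons (primrec_impClause ha hb hv) ?_)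
  refine cons (primrec_allClause hk ha hv) (cons (primrec_allClause
    (Primrec.encode.comp (Primrec.pair ha hv)) ha hv) ?_)
  refine cons (primrec_atomicClause (Primrec.succ.comp hr) hpre hv ha)
    (cons (primrec_atomicClause (Primrec.succ.comp hr) hpre hv ha) ?_)
  refine cons (primrec_atomicClause hzero hnil hv hrk)
    (cons (primrec_atomicClause hzero hnil hv hrk) ?_)
  exact cons (primrec_singleton (primrec_literal (primrec_relAtom hzero
    (Primrec.list_cons.comp hk (primrec_singleton hk)))))
    (primrec_singleton (primrec_congrClause hr ha))

end Primrec

end Clauses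

section HenkinModel

variable {T : ℕ → Bool} {c : List ℕ × List ℕ}

/-- The propositional valuation `T` makes the elements `x` and `y` equal. -/
def HenkinEq (T : ℕ → Bool) (x y : ℕ) : Prop := T (relAtom 0 [x, y]) = true

theorem HenkinEq.congr (hT : ∀ p, ∀ C ∈ henkinClauses c p, SatisfiesClause T C) (r : ℕ)
    {xs ys : List ℕ} (h : List.Forall₂ (HenkinEq T) xs ys) (hx : T (relAtom r xs) = true) :
    T (relAtom r ys) = true := by
  have hlen := h.length_eq
  have h1 : (List.zipWith Nat.pair xs ys).map (fun p => p.unpair.1) = xs := by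
    rw [List.map_zipWith]
    simp only [Nat.unpair_pair]
    clear h hx
    induction xs generalizing ys <;> cases ys <;> simp_all
  have h2 : (List.zipWith Nat.pair xs ys).map (fun p => p.unpair.2) = ys := by
    rw [List.map_zipWith]
    simp only [Nat.unpair_pair]
    clear h hx h1
    induction xs generalizing ys <;> cases ys <;> simp_all
  have h3 : ∀ p ∈ List.zipWith Nat.pair xs ys, HenkinEq T p.unpair.1 p.unpair.2 := by
    clear hx hlen h1 h2
    induction h with
    | nil => simp
    | cons h _ ih => simpa [h] using ih
  obtain ⟨x, hx1, hx2⟩ := hT (r, 0, List.zipWith Nat.pair xs ys, [], [])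
    (congrClause r (List.zipWith Nat.pair xs ys)) (by simp [henkinClauses])
  simp only [congrClause, h1, h2, List.mem_append, List.mem_map, List.mem_cons, List.not_mem_nil,
    or_false] at hx1
  rcases hx1 with ⟨p, hp, rfl⟩ | rfl | rfl
  · exact absurd (h3 p hp) (by simp [HenkinEq, hx2])
  · simp [hx] at hx2
  · exact hx2

theorem HenkinEq.refl (hT : ∀ p, ∀ C ∈ henkinClauses c p, SatisfiesClause T C) (x : ℕ) :
    HenkinEq T x x := by
  obtain ⟨y, hy1, hy2⟩ := hT (0, x, [], [], []) [(relAtom 0 [x, x], true)] (by simp [henkinClauses])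
  obtain rfl : y = _ := by simpa using hy1
  exact hy2

theorem HenkinEq.symm (hT : ∀ p, ∀ C ∈ henkinClauses c p, SatisfiesClause T C) {x y : ℕ}
    (h : HenkinEq T x y) : HenkinEq T y x :=
  HenkinEq.congr hT 0 (xs := [x, x]) (by simp [h, HenkinEq.refl hT]) (HenkinEq.refl hT x)

theorem HenkinEq.trans (hT : ∀ p, ∀ C ∈ henkinClauses c p, SatisfiesClause T C) {x y z : ℕ}
    (h : HenkinEq T x y) (h' : HenkinEq T y z) : HenkinEq T x z :=
  HenkinEq.congr hT 0 (xs := [x, y]) (by simp [h', HenkinEq.refl hT]) h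

/-- The equality of elements decided by a valuation satisfying the Henkin clauses. -/
def henkinSetoid (hT : ∀ p, ∀ C ∈ henkinClauses c p, SatisfiesClause T C) : Setoid ℕ where
  r := HenkinEq T
  iseqv := ⟨HenkinEq.refl hT, HenkinEq.symm hT, HenkinEq.trans hT⟩

theorem exists_countermodel_of_satisfies {ψ φ : V.Sentence}
    (hT : ∀ p, ∀ C ∈ henkinClauses (formulaCode ψ, formulaCode φ) p, SatisfiesClause T C) :
    ∃ (M : Type) (_ : V.Structure M), Nonempty M ∧ M ⊨ ψ ∧ ¬ M ⊨ φ := by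
  let M := Quotient (henkinSetoid hT)
  let mk : ℕ → M := Quotient.mk (henkinSetoid hT)
  have mk_eq {x y : ℕ} : mk x = mk y ↔ T (relAtom 0 [x, y]) = true := Quotient.eq
  let str : V.Structure M :=
    { funMap := fun f => isEmptyElim f
      RelMap := fun R xs =>
        T (relAtom (relIndex R + 1) (List.ofFn fun i => (xs i).out)) = true }
  have rel_iff {k : ℕ} (R : V.Relations k) (es : Fin k → ℕ) :
      Structure.RelMap R (fun i => mk (es i)) ↔
        T (relAtom (relIndex R + 1) (List.ofFn es)) = true := by
    have hout (i : Fin k) : HenkinEq T (mk (es i)).out (es i) :=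
      Quotient.exact (s := henkinSetoid hT) (Quotient.out_eq _)
    constructor
    · refine HenkinEq.congr hT _ (List.forall₂_iff_get.2 ⟨by simp, fun i _ _ => ?_⟩)
      simpa using hout _
    · refine HenkinEq.congr hT _ (List.forall₂_iff_get.2 ⟨by simp, fun i _ _ => ?_⟩)
      simpa using HenkinEq.symm hT (hout _)
  have key : ∀ {n : ℕ} (χ : V.BoundedFormula Empty n) (v : List ℕ), v.length = n → ∀ s : Bool,
      (χ.Realize default (fun i => mk (v.getD i 0)) ↔ s = true) →
        T (valAtom s (formulaCode χ) v) = true := by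
    intro n χ
    have atomic (r : ℕ) (s : Bool) (pre v a : List ℕ) (ha : ∀ i ∈ a, i < v.length)
        (h : SatisfiesClause T (atomicClause s r pre v a))
        (h' : T (relAtom r (a.map (v.getD · 0))) = true ↔ s = true) :
        T (valAtom s (pre ++ a.map (varCode v.length)) v) = true := by
      obtain ⟨x, hx, hx'⟩ := h
      rw [atomicClause, if_pos ha] at hx
      simp only [List.mem_cons, List.not_mem_nil, or_false] at hx
      rcases hx with rfl | rfl
      · rw [hx'] at h'
        cases s <;> simp at h'
      · exact hx'
    induction χ with
    | falsum =>
      rintro v rfl s hs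
      obtain rfl : s = false := by simpa [BoundedFormula.Realize] using hs
      obtain ⟨x, hx, hx'⟩ := hT (0, 0, [], [], v)
        [(valAtom false [markCode (v.length + 2)] v, true)] (by simp [henkinClauses])
      obtain rfl : x = _ := by simpa using hx
      exact hx'
    | equal t₁ t₂ =>
      rintro v rfl s hs
      rw [formulaCode_equal]
      refine atomic 0 s [] v [(varIndex t₁ : ℕ), varIndex t₂] (by simp)
        (hT (varIndex t₁, varIndex t₂, [], [], v) _ ?_) ?_
      · cases s <;> simp [henkinClauses]
      · rw [← hs, BoundedFormula.Realize, realize_eq_varIndex, realize_eq_varIndex, mk_eq]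
        simp
    | @rel _ k R ts =>
      rintro v rfl s hs
      rw [formulaCode_rel]
      refine atomic (relIndex R + 1) s [relCode k (relIndex R), markCode v.length] v
        (List.ofFn fun i => (varIndex (ts i) : ℕ)) (by simp [List.mem_ofFn])
        (hT (relIndex R, 0, List.ofFn fun i => (varIndex (ts i) : ℕ), [], v) _ ?_) ?_
      · cases s <;> simp [henkinClauses]
      · rw [← hs, BoundedFormula.Realize]
        simp only [realize_eq_varIndex]
        rw [rel_iff, List.map_ofFn]
        rfl
    | imp φ₁ φ₂ ih₁ ih₂ =>
      intro v hv s hs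
      rw [formulaCode_imp]
      classical
      have h₁ := ih₁ v hv (decide (φ₁.Realize default fun i => mk (v.getD i 0))) (by simp)
      have h₂ := ih₂ v hv (decide (φ₂.Realize default fun i => mk (v.getD i 0))) (by simp)
      generalize hs₁ : decide (φ₁.Realize default fun i => mk (v.getD i 0)) = s₁ at h₁
      generalize hs₂ : decide (φ₂.Realize default fun i => mk (v.getD i 0)) = s₂ at h₂
      obtain rfl : s = (!s₁ || s₂) := by
        rw [Bool.eq_iff_iff, ← hs, ← hs₁, ← hs₂]
        simp [imp_iff_not_or]
      obtain ⟨x, hx, hx'⟩ := hT (0, 0, formulaCode φ₁, formulaCode φ₂, v)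
        (impClause s₁ s₂ (formulaCode φ₁) (formulaCode φ₂) v)
        (by cases s₁ <;> cases s₂ <;> simp [henkinClauses])
      simp only [impClause, List.mem_cons, List.not_mem_nil, or_false] at hx
      rcases hx with rfl | rfl | rfl
      · simp [h₁] at hx'
      · simp [h₂] at hx'
      · exact hx'
    | @all n χ ih =>
      rintro v rfl s hs
      rw [formulaCode_all]
      have inst (k : ℕ) (hk : χ.Realize default (Fin.snoc (fun i => mk (v.getD i 0)) (mk k)) ↔
          s = true) (h : SatisfiesClause T (allClause s k (formulaCode χ) v)) :
          T (valAtom s (markCode 1 :: formulaCode χ) v) = true := by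
        have hsnoc : (Fin.snoc (fun i : Fin v.length => mk (v.getD i 0)) (mk k) :
            Fin (v.length + 1) → M) =
              fun i : Fin (v.length + 1) => mk ((v ++ [k]).getD (i : ℕ) 0) := by
          funext i
          refine Fin.lastCases ?_ (fun j => ?_) i
          · simp
          · simp
        rw [hsnoc] at hk
        have hk' := ih (v ++ [k]) (by simp) s hk
        obtain ⟨x, hx, hx'⟩ := h
        simp only [allClause, List.mem_cons, List.not_mem_nil, or_false] at hx
        rcases hx with rfl | rfl
        · simp [hk'] at hx'
        · exact hx'
      cases s with
      | true =>
        refine inst (henkinWitness (formulaCode χ) v) ?_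
          (hT (0, 0, formulaCode χ, [], v) _ (by simp [henkinClauses]))
        simpa using (BoundedFormula.realize_all.1 (hs.2 rfl) _)
      | false =>
        have : ¬ ∀ a, χ.Realize default (Fin.snoc (fun i => mk (v.getD i 0)) a) := by
          simpa using hs
        push Not at this
        obtain ⟨a, ha⟩ := this
        obtain ⟨k, rfl⟩ := Quotient.exists_rep a
        exact inst k (by simpa using ha)
          (hT (0, k, formulaCode χ, [], v) _ (by simp [henkinClauses]))
  have hrealize (χ : V.Sentence) : BoundedFormula.Realize χ (default : Empty → M)
      (fun i : Fin 0 => mk (([] : List ℕ).getD i 0)) ↔ M ⊨ χ := by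
    rw [Sentence.Realize, Formula.Realize]
    exact iff_of_eq (congrArg₂ (BoundedFormula.Realize χ) (Subsingleton.elim _ _)
      (Subsingleton.elim _ _))
  refine ⟨M, str, ⟨mk 0⟩, ?_, ?_⟩
  · by_contra hψ
    have h := key ψ [] rfl false ((hrealize ψ).trans (by simpa using hψ))
    obtain ⟨x, hx, hx'⟩ := hT (0, 0, [], [], []) [(valAtom false (formulaCode ψ) [], false)]
      (by simp [henkinClauses])
    obtain rfl : x = _ := by simpa using hx
    simp [h] at hx'
  · intro hφ
    have h := key φ [] rfl true ((hrealize φ).trans (by simpa using hφ))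
    obtain ⟨x, hx, hx'⟩ := hT (0, 0, [], [], []) [(valAtom true (formulaCode φ) [], false)]
      (by simp [henkinClauses])
    obtain rfl : x = _ := by simpa using hx
    simp [h] at hx'

end HenkinModel

section HenkinValuation

theorem lt_encode_of_mem {k : ℕ} {l : List ℕ} (h : k ∈ l) : k < Encodable.encode l := by
  induction l with
  | nil => simp at h
  | cons a l ih =>
    rw [Encodable.encode_list_cons, Encodable.encode_nat]
    rcases List.mem_cons.1 h with rfl | h
    · exact Nat.lt_succ_of_le (Nat.left_le_pair _ _)
    · exact (ih h).trans (Nat.lt_succ_of_le (Nat.right_le_pair _ _))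

theorem lt_of_mem_ofNat {k m : ℕ} (h : k ∈ (Denumerable.ofNat (List ℕ × List ℕ) m).2) :
    k < m := by
  refine (lt_encode_of_mem h).trans_le ?_
  conv_rhs => rw [← Denumerable.encode_ofNat (α := List ℕ × List ℕ) m]
  exact Nat.right_le_pair _ _

variable (M : Type) [V.Structure M] [Nonempty M]

open Classical in
/-- An element falsifying the formula with code `l` over the tuple `u`, if there is one. -/
noncomputable def falsifier {M : Type} [V.Structure M] [Nonempty M] (l : List ℕ) {n : ℕ}
    (u : Fin n → M) : M :=
  if h : ∃ x, ∃ χ : V.BoundedFormula Empty (n + 1), formulaCode χ = l ∧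
    ¬ χ.Realize default (Fin.snoc u x : Fin (n + 1) → M) then h.choose else Classical.arbitrary M

/-- The interpretation of the Henkin constants in a structure. -/
noncomputable def henkinVal (m : ℕ) : M :=
  falsifier (Denumerable.ofNat (List ℕ × List ℕ) m).1
    (fun i : Fin (Denumerable.ofNat (List ℕ × List ℕ) m).2.length =>
      henkinVal ((Denumerable.ofNat (List ℕ × List ℕ) m).2.get i))
termination_by m
decreasing_by exact lt_of_mem_ofNat (List.get_mem _ _)

theorem henkinVal_witness (l v : List ℕ) : henkinVal M (henkinWitness l v) =
    falsifier l (fun i : Fin v.length => henkinVal M (v.getD i 0)) := by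
  rw [henkinVal, henkinWitness, Denumerable.ofNat_encode]
  simp

/-- The relation numbered `r`, with `0` standing for equality, holds of a list of elements. -/
def RelHolds {N : Type} [V.Structure N] (r : ℕ) (u : List N) : Prop :=
  match r with
  | 0 => u[0]? = u[1]?
  | R + 1 => ∃ (k : ℕ) (xs : Fin k → N), List.ofFn xs = u ∧
    Structure.RelMap (L := V) (show V.Relations k from R) xs

theorem relHolds_ofFn {N : Type} [V.Structure N] {R k : ℕ} (xs : Fin k → N) :
    RelHolds (R + 1) (List.ofFn xs) ↔ Structure.RelMap (L := V) (show V.Relations k from R) xs := by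
  constructor
  · rintro ⟨k', ys, h, h'⟩
    obtain rfl : k' = k := by simpa using congrArg List.length h
    rwa [← List.ofFn_injective h]
  · exact fun h => ⟨k, xs, rfl, h⟩

/-- The interpretation of the propositional atoms in a structure. -/
def AtomHolds : HenkinAtom → Prop
  | .inl (r, es) => RelHolds r (es.map (henkinVal M))
  | .inr (s, l, v) => ∃ (n : ℕ) (χ : V.BoundedFormula Empty n), v.length = n ∧ formulaCode χ = l ∧
    (χ.Realize default (fun i => henkinVal M (v.getD i 0)) ↔ s = true)

open Classical in
/-- The propositional valuation given by a structure. -/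
noncomputable def henkinValuation (m : ℕ) : Bool :=
  decide (∃ x ∈ (Encodable.decode m : Option HenkinAtom), AtomHolds M x)

theorem henkinValuation_relAtom {r : ℕ} {es : List ℕ} :
    henkinValuation M (relAtom r es) = true ↔ RelHolds r (es.map (henkinVal M)) := by
  classical
  refine decide_eq_true_iff.trans ?_
  rw [relAtom, Encodable.encodek]
  simp [AtomHolds]

theorem henkinValuation_valAtom {s : Bool} {l v : List ℕ} :
    henkinValuation M (valAtom s l v) = true ↔ ∃ (n : ℕ) (χ : V.BoundedFormula Empty n),
      v.length = n ∧ formulaCode χ = l ∧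
      (χ.Realize default (fun i => henkinVal M (v.getD i 0)) ↔ s = true) := by
  classical
  refine decide_eq_true_iff.trans ?_
  rw [valAtom, Encodable.encodek]
  simp [AtomHolds]

theorem henkinValuation_formulaCode {s : Bool} {n : ℕ} {χ : V.BoundedFormula Empty n}
    {v : List ℕ} (hv : v.length = n) : henkinValuation M (valAtom s (formulaCode χ) v) = true ↔
      (χ.Realize default (fun i => henkinVal M (v.getD i 0)) ↔ s = true) := by
  rw [henkinValuation_valAtom]
  constructor
  · rintro ⟨_, χ', rfl, h, h'⟩
    subst hv
    rwa [← formulaCode_injective h]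
  · exact fun h => ⟨n, χ, hv, rfl, h⟩

variable {M}

theorem realize_default_iff {N : Type} [V.Structure N] (χ : V.Sentence) (xs : Fin 0 → N) :
    BoundedFormula.Realize χ default xs ↔ N ⊨ χ := by
  rw [Sentence.Realize, Formula.Realize]
  exact iff_of_eq (congrArg₂ (BoundedFormula.Realize χ) (Subsingleton.elim _ _)
    (Subsingleton.elim _ _))

theorem satisfiesClause_impClause (s t : Bool) (a b v : List ℕ) :
    SatisfiesClause (henkinValuation M) (impClause s t a b v) := by
  by_cases ha : henkinValuation M (valAtom s a v) = true
  · by_cases hb : henkinValuation M (valAtom t b v) = true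
    · refine ⟨_, List.mem_cons_of_mem _ (List.mem_cons_of_mem _ List.mem_cons_self), ?_⟩
      obtain ⟨n, χ, hv, rfl, h⟩ := (henkinValuation_valAtom M).1 ha
      obtain ⟨_, χ', rfl, rfl, h'⟩ := (henkinValuation_valAtom M).1 hb
      subst hv
      dsimp only
      rw [← formulaCode_imp, henkinValuation_formulaCode M rfl, BoundedFormula.realize_imp, h, h']
      cases s <;> cases t <;> simp
    · exact ⟨_, List.mem_cons_of_mem _ List.mem_cons_self, by simpa using hb⟩
  · exact ⟨_, List.mem_cons_self, by simpa using ha⟩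

theorem satisfiesClause_allClause {s : Bool} {k : ℕ} {a v : List ℕ}
    (h : ∀ χ : V.BoundedFormula Empty (v.length + 1), formulaCode χ = a →
      (χ.Realize default (Fin.snoc (fun i : Fin v.length => henkinVal M (v.getD i 0))
        (henkinVal M k)) ↔ s = true) →
      (χ.all.Realize default (fun i => henkinVal M (v.getD i 0)) ↔ s = true)) :
    SatisfiesClause (henkinValuation M) (allClause s k a v) := by
  by_cases ha : henkinValuation M (valAtom s a (v ++ [k])) = true
  · refine ⟨_, List.mem_cons_of_mem _ List.mem_cons_self, ?_⟩
    obtain ⟨n, χ, hv, rfl, h'⟩ := (henkinValuation_valAtom M).1 ha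
    obtain rfl : v.length + 1 = n := by simpa using hv
    dsimp only
    rw [← formulaCode_all, henkinValuation_formulaCode M rfl]
    refine h χ rfl ?_
    rw [← h']
    refine iff_of_eq (congrArg _ ?_)
    funext i
    refine Fin.lastCases ?_ (fun j => ?_) i
    · simp
    · simp
  · exact ⟨_, List.mem_cons_self, by simpa using ha⟩

theorem satisfiesClause_atomicClause {s : Bool} {r : ℕ} {pre v a : List ℕ}
    (h : (∀ i ∈ a, i < v.length) → ∃ χ : V.BoundedFormula Empty v.length,
      formulaCode χ = pre ++ a.map (varCode v.length) ∧
      (χ.Realize default (fun i => henkinVal M (v.getD i 0)) ↔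
        RelHolds r ((a.map (v.getD · 0)).map (henkinVal M)))) :
    SatisfiesClause (henkinValuation M) (atomicClause s r pre v a) := by
  rw [atomicClause]
  split_ifs with ha
  · obtain ⟨χ, hχ, hr⟩ := h ha
    rw [← henkinValuation_relAtom] at hr
    by_cases hs : henkinValuation M (relAtom r (a.map (v.getD · 0))) = !s
    · exact ⟨_, List.mem_cons_self, hs⟩
    · refine ⟨_, List.mem_cons_of_mem _ List.mem_cons_self, ?_⟩
      dsimp only
      rw [← hχ, henkinValuation_formulaCode M rfl, hr]
      revert hs
      cases henkinValuation M (relAtom r (a.map (v.getD · 0))) <;> cases s <;> simp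
  · cases h0 : henkinValuation M 0
    · exact ⟨_, List.mem_cons_of_mem _ List.mem_cons_self, h0⟩
    · exact ⟨_, List.mem_cons_self, h0⟩

theorem satisfiesClause_atomicClause_rel (s : Bool) (R : ℕ) (v a : List ℕ) :
    SatisfiesClause (henkinValuation M)
      (atomicClause s (R + 1) [relCode a.length R, markCode v.length] v a) := by
  refine satisfiesClause_atomicClause fun ha => ?_
  let ts : Fin a.length → Fin v.length := fun i => ⟨a.get i, ha _ (List.get_mem _ _)⟩
  refine ⟨.rel (show V.Relations a.length from R) fun i => .var (.inr (ts i)), ?_, ?_⟩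
  · rw [formulaCode_rel]
    refine congrArg (fun l => [_, _] ++ List.map _ l) ?_
    exact List.ofFn_get a
  · have h : (a.map (v.getD · 0)).map (henkinVal M) =
        List.ofFn fun i => henkinVal M (v.getD (ts i) 0) := by
      rw [List.map_map]
      refine List.ext_getElem (by simp) fun i h1 h2 => ?_
      simp [ts]
    rw [h, relHolds_ofFn]
    rfl

theorem satisfiesClause_congrClause (r : ℕ) (ps : List ℕ) :
    SatisfiesClause (henkinValuation M) (congrClause r ps) := by
  by_cases h : ∀ p ∈ ps, henkinVal M p.unpair.1 = henkinVal M p.unpair.2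
  · have h' : (ps.map fun p => p.unpair.1).map (henkinVal M) =
        (ps.map fun p => p.unpair.2).map (henkinVal M) := by
      rw [List.map_map, List.map_map]
      exact List.map_congr_left h
    by_cases hr : henkinValuation M (relAtom r (ps.map fun p => p.unpair.1)) = true
    · refine ⟨(relAtom r (ps.map fun p => p.unpair.2), true), by simp [congrClause], ?_⟩
      rw [henkinValuation_relAtom] at hr
      dsimp only
      rwa [henkinValuation_relAtom, ← h']
    · exact ⟨(relAtom r (ps.map fun p => p.unpair.1), false), by simp [congrClause],
        by simpa using hr⟩
  · push Not at h
    obtain ⟨p, hp, hne⟩ := h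
    refine ⟨(relAtom 0 [p.unpair.1, p.unpair.2], false),
      List.mem_append_left _ (List.mem_map.2 ⟨p, hp, rfl⟩), ?_⟩
    dsimp only
    rw [← Bool.not_eq_true, henkinValuation_relAtom]
    simpa [RelHolds] using hne

theorem satisfiesClause_atomicClause_equal (s : Bool) (i j : ℕ) (v : List ℕ) :
    SatisfiesClause (henkinValuation M) (atomicClause s 0 [] v [i, j]) := by
  refine satisfiesClause_atomicClause fun ha => ?_
  refine ⟨.equal (.var (.inr ⟨i, ha i (by simp)⟩)) (.var (.inr ⟨j, ha j (by simp)⟩)),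
    formulaCode_equal _ _, ?_⟩
  rw [BoundedFormula.Realize, realize_eq_varIndex, realize_eq_varIndex]
  simp [RelHolds, varIndex]

theorem satisfiesClause_henkinClauses {ψ φ : V.Sentence} (hψ : M ⊨ ψ) (hφ : ¬ M ⊨ φ)
    (p : ClauseParam) : ∀ C ∈ henkinClauses (formulaCode ψ, formulaCode φ) p,
      SatisfiesClause (henkinValuation M) C := by
  obtain ⟨r, k, a, b, v⟩ := p
  simp only [henkinClauses, List.forall_mem_cons, List.not_mem_nil, false_imp_iff,
    implies_true, and_true, satisfiesClause_impClause, satisfiesClause_atomicClause_rel,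
    satisfiesClause_atomicClause_equal, satisfiesClause_congrClause, true_and]
  refine ⟨?_, ?_, ?_, ?_, ?_, ?_⟩
  · refine ⟨_, List.mem_cons_self, ?_⟩
    dsimp only
    rw [← Bool.not_eq_true, henkinValuation_formulaCode M (n := 0) rfl, realize_default_iff]
    simpa using hψ
  · refine ⟨_, List.mem_cons_self, ?_⟩
    dsimp only
    rw [← Bool.not_eq_true, henkinValuation_formulaCode M (n := 0) rfl, realize_default_iff]
    simpa using hφ
  · refine ⟨_, List.mem_cons_self, ?_⟩
    dsimp only
    rw [← formulaCode_falsum, henkinValuation_formulaCode M rfl]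
    simp [BoundedFormula.Realize]
  · refine satisfiesClause_allClause fun χ _ h => ?_
    simp only [Bool.false_eq_true, iff_false, BoundedFormula.realize_all] at h ⊢
    exact fun h' => h (h' _)
  · refine satisfiesClause_allClause fun χ hχ h => ?_
    simp only [iff_true, BoundedFormula.realize_all] at h ⊢
    by_contra! h'
    have hex : ∃ x, ∃ χ : V.BoundedFormula Empty (v.length + 1), formulaCode χ = a ∧
      ¬ χ.Realize default (Fin.snoc (fun i : Fin v.length => henkinVal M (v.getD i 0)) x :
        Fin (v.length + 1) → M) := h'.imp fun x hx => ⟨χ, hχ, hx⟩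
    rw [henkinVal_witness, falsifier, dif_pos hex] at h
    obtain ⟨χ', hχ', h''⟩ := hex.choose_spec
    rw [← hχ] at hχ'
    obtain rfl := formulaCode_injective hχ'
    exact h'' h
  · refine ⟨_, List.mem_cons_self, ?_⟩
    dsimp only
    rw [henkinValuation_relAtom]
    simp [RelHolds]

end HenkinValuation

/-- A sentence `φ` fails in some model of `ψ` exactly when the Henkin clauses are satisfiable. -/
theorem exists_countermodel_iff (ψ φ : V.Sentence) :
    (∃ (M : Type) (_ : V.Structure M), Nonempty M ∧ M ⊨ ψ ∧ ¬ M ⊨ φ) ↔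
      ∃ T, ∀ b, ∀ C ∈ henkinClauses (formulaCode ψ, formulaCode φ)
        (Denumerable.ofNat ClauseParam b), SatisfiesClause T C := by
  constructor
  · rintro ⟨M, _, _, hψ, hφ⟩
    exact ⟨henkinValuation M, fun b => satisfiesClause_henkinClauses hψ hφ _⟩
  · rintro ⟨T, hT⟩
    refine exists_countermodel_of_satisfies (T := T) fun p => ?_
    have := hT (Encodable.encode p)
    rwa [Denumerable.ofNat_encode] at this

/-- The clauses for the pair of codes `c` are refuted by those numbered below `N`. -/
def HenkinRefuted (c : List ℕ × List ℕ) (N : ℕ) : Prop :=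
  ∀ l ∈ boolLists N, ∃ b < N, ∃ C ∈ henkinClauses c (Denumerable.ofNat ClauseParam b),
    ∀ x ∈ C, l[x.1]? = some (!x.2)

theorem primrecPred_henkinRefuted :
    PrimrecPred fun p : (List ℕ × List ℕ) × ℕ => HenkinRefuted p.1 p.2 :=
  primrecPred_refutation
    (cls := fun c b => henkinClauses c (Denumerable.ofNat ClauseParam b))
    (primrec_henkinClauses.comp Primrec.fst ((Primrec.ofNat ClauseParam).comp Primrec.snd))

theorem exists_henkinRefuted_iff (ψ φ : V.Sentence) :
    (∃ N, HenkinRefuted (formulaCode ψ, formulaCode φ) N) ↔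
      ∀ (M : Type) (_ : V.Structure M), Nonempty M → M ⊨ ψ → M ⊨ φ := by
  refine (not_satisfiable_iff_exists_bound _).symm.trans ?_
  rw [← exists_countermodel_iff]
  push Not
  rfl

/-- If satisfiability in a fragment as expressive as first-order logic is decidable, then
satisfiability of a computable family of sentences is semidecidable. -/
theorem rePred_sat_of_computablePred {L : Set V.Sentence} (hexpr : SameExprAll L)
    (hL : ComputablePred fun k => ∃ φ ∈ L, Encodable.encode φ = k ∧ Sat φ)
    {α : Type*} [Primcodable α] {φ : α → V.Sentence} (hφ : Primrec fun a => formulaCode (φ a)) :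
    REPred fun a => Sat (φ a) := by
  have h1 : ComputablePred fun p : α × List ℕ × ℕ =>
      (∃ ψ ∈ L, Encodable.encode ψ = Encodable.encode p.2.1 ∧ Sat ψ) ∧
        HenkinRefuted (p.2.1, formulaCode (φ p.1)) p.2.2 := by
    obtain ⟨_, h⟩ := hL
    obtain ⟨_, h'⟩ := primrecPred_henkinRefuted
    classical
    have h2 := Primrec.and.to_comp.comp
      (h.comp (Computable.encode.comp (Computable.fst.comp
        (Computable.snd (α := α) (β := List ℕ × ℕ)))))
      (h'.to_comp.comp (Computable.pair (Computable.pair (Computable.fst.comp Computable.snd)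
        (hφ.to_comp.comp Computable.fst)) (Computable.snd.comp Computable.snd)))
    exact ⟨inferInstance, h2.of_eq fun p => Bool.eq_iff_iff.2 (by
      simp only [Bool.and_eq_true, decide_eq_true_iff])⟩
  refine (rePred_exists_of_computablePred h1).of_eq fun a => ?_
  constructor
  · rintro ⟨⟨l, N⟩, ⟨ψ, -, hl, M, _, hM, hψ⟩, hN⟩
    rw [encode_sentence] at hl
    obtain rfl : formulaCode ψ = l := Encodable.encode_injective hl
    exact ⟨M, _, hM, (exists_henkinRefuted_iff ψ (φ a)).1 ⟨N, hN⟩ M _ hM hψ⟩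
  · rintro ⟨M, _, hM, h⟩
    obtain ⟨ψ, hψL, hψ⟩ := hexpr (φ a)
    obtain ⟨N, hN⟩ := (exists_henkinRefuted_iff ψ (φ a)).2 fun M' _ hM' => (hψ M' _ hM').2
    exact ⟨(formulaCode ψ, N), ⟨ψ, hψL, encode_sentence ψ, M, _, hM, (hψ M _ hM).1 h⟩, hN⟩

section Axioms

open Nat.Partrec (Code)

variable {n : ℕ}

/-- The formula stating that the `i`-th variable is zero. -/
def zeroAt (i : Fin n) : V.BoundedFormula Empty n :=
  .rel (show V.Relations 1 from (0 : ℕ)) ![.var (.inr i)]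

/-- The formula applying the `R`-th binary relation symbol to two variables. -/
def binAt (R : ℕ) (i j : Fin n) : V.BoundedFormula Empty n :=
  .rel (show V.Relations 2 from R) ![.var (.inr i), .var (.inr j)]

/-- The formula stating that the `k`-th variable is the pair of the `i`-th and `j`-th variables. -/
def pairAt (i j k : Fin n) : V.BoundedFormula Empty n :=
  .rel (show V.Relations 3 from (0 : ℕ)) ![.var (.inr i), .var (.inr j), .var (.inr k)]

/-- The binary relation symbol for the graph of the partial function computed by a code. -/
def graphSymbol (d : Code) : ℕ := Encodable.encode d + 1

section Realize

variable {M : Type} [V.Structure M]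

/-- The interpretation of the predicate for zero. -/
def ZeroRel (x : M) : Prop := Structure.RelMap (L := V) (show V.Relations 1 from (0 : ℕ)) ![x]

/-- The interpretation of the `R`-th binary relation symbol. -/
def BinRel (R : ℕ) (x y : M) : Prop :=
  Structure.RelMap (L := V) (show V.Relations 2 from R) ![x, y]

/-- The interpretation of the relation for pairing. -/
def PairRel (x y z : M) : Prop :=
  Structure.RelMap (L := V) (show V.Relations 3 from (0 : ℕ)) ![x, y, z]

@[simp]
theorem realize_zeroAt (i : Fin n) (v : Empty → M) (xs : Fin n → M) :
    (zeroAt i).Realize v xs ↔ ZeroRel (xs i) := by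
  refine iff_of_eq (congrArg (Structure.RelMap (L := V) _) ?_)
  funext k
  fin_cases k
  rfl

@[simp]
theorem realize_binAt (R : ℕ) (i j : Fin n) (v : Empty → M) (xs : Fin n → M) :
    (binAt R i j).Realize v xs ↔ BinRel R (xs i) (xs j) := by
  refine iff_of_eq (congrArg (Structure.RelMap (L := V) _) ?_)
  funext k
  fin_cases k <;> rfl

@[simp]
theorem realize_pairAt (i j k : Fin n) (v : Empty → M) (xs : Fin n → M) :
    (pairAt i j k).Realize v xs ↔ PairRel (xs i) (xs j) (xs k) := by
  refine iff_of_eq (congrArg (Structure.RelMap (L := V) _) ?_)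
  funext k
  fin_cases k <;> rfl

end Realize

/-- The universal closure of a Horn clause. -/
def hornClause (body : List (V.BoundedFormula Empty n)) (head : V.BoundedFormula Empty n) :
    V.Sentence := (body.foldr BoundedFormula.imp head).alls

theorem realize_hornClause {M : Type} [V.Structure M] (body : List (V.BoundedFormula Empty n))
    (head : V.BoundedFormula Empty n) : M ⊨ hornClause body head ↔
      ∀ xs : Fin n → M, (∀ φ ∈ body, φ.Realize default xs) → head.Realize default xs := by
  refine BoundedFormula.realize_alls.trans (forall_congr' fun xs => ?_)
  induction body with
  | nil => simp
  | cons φ body ih => simp [ih, and_imp]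

/-- The sentence expressing that zero exists. -/
def zeroExists : V.Sentence := ∼ (hornClause [zeroAt (0 : Fin 1)] ⊥)

/-- The sentence expressing that every element has a successor. -/
def succTotal : V.Sentence := (∼ (∼ (binAt (n := 2) (graphSymbol .succ) 0 1)).all).all

/-- Axioms for zero, successor, order and pairing. -/
def arithAxioms : List V.Sentence :=
  [ zeroExists,
    succTotal,
    hornClause [binAt (n := 2) (graphSymbol .succ) 0 1] (binAt 0 0 1),
    hornClause [binAt (n := 3) 0 0 1, binAt (graphSymbol .succ) 1 2] (binAt 0 0 2),
    hornClause [zeroAt (n := 1) 0] (pairAt 0 0 0),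
    hornClause [pairAt (n := 5) 0 1 2, binAt (graphSymbol .succ) 2 3,
      binAt (graphSymbol .succ) 0 4, binAt 0 4 1] (pairAt 4 1 3),
    hornClause [pairAt (n := 5) 0 1 2, binAt (graphSymbol .succ) 2 3,
      binAt (graphSymbol .succ) 0 1, zeroAt 4] (pairAt 1 4 3),
    hornClause [pairAt (n := 5) 0 1 2, binAt (graphSymbol .succ) 2 3,
      binAt (graphSymbol .succ) 1 4, binAt 0 1 0] (pairAt 0 4 3),
    hornClause [pairAt (n := 5) 0 0 1, binAt (graphSymbol .succ) 1 2,
      binAt (graphSymbol .succ) 0 3, zeroAt 4] (pairAt 4 3 2)]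

/-- Axioms describing the computation of a code. -/
def codeAxioms : Code → List V.Sentence
  | .zero => [hornClause [zeroAt (n := 2) 1] (binAt (graphSymbol .zero) 0 1)]
  | .succ => []
  | .left => [hornClause [pairAt (n := 3) 0 1 2] (binAt (graphSymbol .left) 2 0)]
  | .right => [hornClause [pairAt (n := 3) 0 1 2] (binAt (graphSymbol .right) 2 1)]
  | .pair f g => hornClause [binAt (n := 4) (graphSymbol f) 0 1, binAt (graphSymbol g) 0 2,
      pairAt 1 2 3] (binAt (graphSymbol (.pair f g)) 0 3) :: (codeAxioms f ++ codeAxioms g)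
  | .comp f g => hornClause [binAt (n := 3) (graphSymbol g) 0 1, binAt (graphSymbol f) 1 2]
      (binAt (graphSymbol (.comp f g)) 0 2) :: (codeAxioms f ++ codeAxioms g)
  | .prec f g =>
      hornClause [pairAt (n := 4) 0 1 2, zeroAt 1, binAt (graphSymbol f) 0 3]
        (binAt (graphSymbol (.prec f g)) 2 3) ::
      hornClause [pairAt (n := 9) 0 1 2, binAt (graphSymbol (.prec f g)) 2 3,
        binAt (graphSymbol .succ) 1 4, pairAt 0 4 5, pairAt 1 3 6, pairAt 0 6 7,
        binAt (graphSymbol g) 7 8] (binAt (graphSymbol (.prec f g)) 5 8) ::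
      (codeAxioms f ++ codeAxioms g)
  | .rfind' f =>
      hornClause [pairAt (n := 4) 0 1 2, binAt (graphSymbol f) 2 3, zeroAt 3]
        (binAt (graphSymbol (.rfind' f)) 2 1) ::
      hornClause [pairAt (n := 8) 0 1 2, binAt (graphSymbol f) 2 3,
        binAt (graphSymbol .succ) 4 3, binAt (graphSymbol .succ) 1 5, pairAt 0 5 6,
        binAt (graphSymbol (.rfind' f)) 6 7] (binAt (graphSymbol (.rfind' f)) 2 7) ::
      codeAxioms f

theorem pair_succ_cases (a b : ℕ) :
    (a + 1 < b ∧ Nat.pair (a + 1) b = Nat.pair a b + 1) ∨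
      (a + 1 = b ∧ Nat.pair b 0 = Nat.pair a b + 1) ∨
      (b < a ∧ Nat.pair a (b + 1) = Nat.pair a b + 1) ∨
      (a = b ∧ Nat.pair 0 (a + 1) = Nat.pair a b + 1) := by
  rcases lt_trichotomy a b with h | rfl | h
  · rcases (Nat.succ_le_of_lt h).lt_or_eq with h' | rfl
    · exact .inl ⟨h', by rw [Nat.pair, Nat.pair, if_pos h, if_pos h', Nat.add_assoc]⟩
    · exact .inr (.inl ⟨rfl, by simp [Nat.pair]; ring⟩)
  · exact .inr (.inr (.inr ⟨rfl, by simp [Nat.pair]; ring⟩))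
  · refine .inr (.inr (.inl ⟨h, ?_⟩))
    rw [Nat.pair, Nat.pair, if_neg (by omega), if_neg (by omega), ← Nat.add_assoc]

/-- The numbers, as interpreted in a model of the arithmetic axioms. -/
theorem exists_numerals {M : Type} [V.Structure M] (h : ∀ φ ∈ arithAxioms, M ⊨ φ) :
    ∃ ι : ℕ → M, ZeroRel (ι 0) ∧
      (∀ k, BinRel (graphSymbol .succ) (ι k) (ι (k + 1))) ∧
      ∀ a b, PairRel (ι a) (ι b) (ι (Nat.pair a b)) := by
  simp only [arithAxioms, List.forall_mem_cons, realize_hornClause, List.not_mem_nil,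
    false_imp_iff, implies_true, and_true, realize_zeroAt, realize_binAt, realize_pairAt] at h
  obtain ⟨hz, hs, hlt, hlt', hp0, hp1, hp2, hp3, hp4⟩ := h
  obtain ⟨o, ho⟩ : ∃ o : M, ZeroRel o := by
    by_contra! h0
    refine ((Sentence.realize_not M).1 hz) ((realize_hornClause _ _).2 fun xs hx => ?_)
    exact absurd ((realize_zeroAt 0 default xs).1 (hx _ List.mem_cons_self)) (h0 _)
  have hs' : ∀ x : M, ∃ y, BinRel (graphSymbol .succ) x y := by
    simpa [succTotal, Sentence.Realize, Formula.Realize, Fin.snoc] using hs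
  choose s hs' using hs'
  let ι : ℕ → M := fun k => s^[k] o
  have ho : ZeroRel (ι 0) := ho
  have hS (k : ℕ) : BinRel (graphSymbol .succ) (ι k) (ι (k + 1)) := by
    simp only [ι, Function.iterate_succ_apply']
    exact hs' _
  have hL {a b : ℕ} (hab : a < b) : BinRel 0 (ι a) (ι b) := by
    induction b, hab using Nat.le_induction with
    | base => simpa using hlt ![ι a, ι (a + 1)] (by simpa using hS a)
    | succ b _ ih => simpa using hlt' ![ι a, ι b, ι (b + 1)] (by simpa using ⟨ih, hS b⟩)
  have hP (k : ℕ) : PairRel (ι k.unpair.1) (ι k.unpair.2) (ι k) := by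
    induction k with
    | zero => simpa using hp0 ![ι 0] (by simpa using ho)
    | succ k ih =>
      generalize ha : k.unpair.1 = a at ih
      generalize hb : k.unpair.2 = b at ih
      have hk : Nat.pair a b = k := by rw [← ha, ← hb, Nat.pair_unpair]
      have hSk := hS k
      rcases pair_succ_cases a b with ⟨h, h'⟩ | ⟨h, h'⟩ | ⟨h, h'⟩ | ⟨h, h'⟩ <;>
        rw [hk] at h' <;> rw [← h', Nat.unpair_pair, h']
      · simpa using hp1 ![ι a, ι b, ι k, ι (k + 1), ι (a + 1)]
          (by simpa using ⟨ih, hSk, hS a, hL h⟩)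
      · subst h
        simpa using hp2 ![ι a, ι (a + 1), ι k, ι (k + 1), ι 0] (by simpa using ⟨ih, hSk, hS a, ho⟩)
      · simpa using hp3 ![ι a, ι b, ι k, ι (k + 1), ι (b + 1)]
          (by simpa using ⟨ih, hSk, hS b, hL h⟩)
      · subst h
        simpa using hp4 ![ι a, ι k, ι (k + 1), ι (a + 1), ι 0] (by simpa using ⟨ih, hSk, hS a, ho⟩)
  exact ⟨ι, ho, hS, fun a b => by simpa using hP (Nat.pair a b)⟩

end Axioms

section Representation

open Nat.Partrec (Code)

theorem mem_eval_rfind' {f : Code} {a m y : ℕ} : y ∈ (Code.rfind' f).eval (Nat.pair a m) ↔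
    ∃ k, (0 ∈ f.eval (Nat.pair a (k + m)) ∧
      ∀ j < k, ∃ z ∈ f.eval (Nat.pair a (j + m)), z ≠ 0) ∧ k + m = y := by
  simp only [Code.eval, Nat.unpaired, Nat.unpair_pair, Part.mem_map_iff]
  refine exists_congr fun k => and_congr_left fun _ => Nat.mem_rfind.trans ?_
  simp [Part.map_eq_map]

theorem mem_eval_pair {f g : Code} {x y : ℕ} : y ∈ (Code.pair f g).eval x ↔
    ∃ a ∈ f.eval x, ∃ b ∈ g.eval x, Nat.pair a b = y := by
  simp [Code.eval, Seq.seq]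

theorem mem_eval_succ {x y : ℕ} : y ∈ Code.succ.eval x ↔ y = x + 1 := by simp [Code.eval]

theorem binRel_graphSymbol_of_mem_eval {M : Type} [V.Structure M] {ι : ℕ → M}
    (hz : ZeroRel (ι 0)) (hs : ∀ k, BinRel (graphSymbol .succ) (ι k) (ι (k + 1)))
    (hp : ∀ a b, PairRel (ι a) (ι b) (ι (Nat.pair a b))) {c : Code}
    (hc : ∀ φ ∈ codeAxioms c, M ⊨ φ) {x y : ℕ} (h : y ∈ c.eval x) :
    BinRel (graphSymbol c) (ι x) (ι y) := by
  induction c generalizing x y with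
  | zero =>
    simp only [codeAxioms, List.forall_mem_cons, realize_hornClause, List.not_mem_nil,
      false_imp_iff, implies_true, and_true, realize_zeroAt, realize_binAt] at hc
    obtain rfl : y = 0 := by simpa [Code.eval, pure, PFun.pure] using h
    simpa using hc ![ι x, ι 0] (by simpa using hz)
  | succ =>
    obtain rfl : y = x + 1 := mem_eval_succ.1 h
    exact hs x
  | left =>
    simp only [codeAxioms, List.forall_mem_cons, realize_hornClause, List.not_mem_nil,
      false_imp_iff, implies_true, and_true, realize_pairAt, realize_binAt] at hc
    obtain rfl : y = x.unpair.1 := by simpa [Code.eval] using h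
    simpa using hc ![ι x.unpair.1, ι x.unpair.2, ι x] (by simpa using hp x.unpair.1 x.unpair.2)
  | right =>
    simp only [codeAxioms, List.forall_mem_cons, realize_hornClause, List.not_mem_nil,
      false_imp_iff, implies_true, and_true, realize_pairAt, realize_binAt] at hc
    obtain rfl : y = x.unpair.2 := by simpa [Code.eval] using h
    simpa using hc ![ι x.unpair.1, ι x.unpair.2, ι x] (by simpa using hp x.unpair.1 x.unpair.2)
  | pair f g ihf ihg =>
    simp only [codeAxioms, List.forall_mem_cons, List.forall_mem_append, realize_hornClause,
      List.not_mem_nil, false_imp_iff, implies_true, and_true, realize_pairAt,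
      realize_binAt] at hc
    obtain ⟨hc, hf, hg⟩ := hc
    obtain ⟨a, ha, b, hb, rfl⟩ := mem_eval_pair.1 h
    simpa using hc ![ι x, ι a, ι b, ι (Nat.pair a b)]
      (by simpa using ⟨ihf hf ha, ihg hg hb, hp a b⟩)
  | comp f g ihf ihg =>
    simp only [codeAxioms, List.forall_mem_cons, List.forall_mem_append, realize_hornClause,
      List.not_mem_nil, false_imp_iff, implies_true, and_true, realize_binAt] at hc
    obtain ⟨hc, hf, hg⟩ := hc
    obtain ⟨a, ha, hb⟩ : ∃ a ∈ g.eval x, y ∈ f.eval a := Part.mem_bind_iff.1 h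
    simpa using hc ![ι x, ι a, ι y] (by simpa using ⟨ihg hg ha, ihf hf hb⟩)
  | prec f g ihf ihg =>
    simp only [codeAxioms, List.forall_mem_cons, List.forall_mem_append, realize_hornClause,
      List.not_mem_nil, false_imp_iff, implies_true, and_true, realize_binAt, realize_pairAt,
      realize_zeroAt] at hc
    obtain ⟨hc0, hc1, hf, hg⟩ := hc
    obtain ⟨a, m, rfl⟩ : ∃ a m, x = Nat.pair a m := ⟨_, _, (Nat.pair_unpair x).symm⟩
    induction m generalizing y with
    | zero =>
      rw [Code.eval_prec_zero] at h
      simpa using hc0 ![ι a, ι 0, ι (Nat.pair a 0), ι y] (by simpa using ⟨hp a 0, hz, ihf hf h⟩)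
    | succ m ih =>
      rw [Code.eval_prec_succ] at h
      obtain ⟨i, hi, hy⟩ := Part.mem_bind_iff.1 h
      simpa using hc1 ![ι a, ι m, ι (Nat.pair a m), ι i, ι (m + 1), ι (Nat.pair a (m + 1)),
        ι (Nat.pair m i), ι (Nat.pair a (Nat.pair m i)), ι y]
        (by simpa using ⟨hp a m, ih hi, hs m, hp a (m + 1), hp m i, hp a _, ihg hg hy⟩)
  | rfind' f ih =>
    simp only [codeAxioms, List.forall_mem_cons, realize_hornClause, realize_binAt,
      realize_pairAt, realize_zeroAt] at hc
    obtain ⟨hc0, hc1, hf⟩ := hc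
    obtain ⟨a, m, rfl⟩ : ∃ a m, x = Nat.pair a m := ⟨_, _, (Nat.pair_unpair x).symm⟩
    obtain ⟨k, ⟨hk, hlt⟩, rfl⟩ := mem_eval_rfind'.1 h
    clear h
    induction k generalizing m with
    | zero =>
      rw [Nat.zero_add] at hk ⊢
      simpa using hc0 ![ι a, ι m, ι (Nat.pair a m), ι 0] (by simpa using ⟨hp a m, ih hf hk, hz⟩)
    | succ k ih' =>
      have hk' : k + 1 + m = k + (m + 1) := by omega
      obtain ⟨z, hz, hz'⟩ := hlt 0 (Nat.succ_pos k)
      obtain ⟨z, rfl⟩ := Nat.exists_eq_succ_of_ne_zero hz'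
      rw [Nat.zero_add] at hz
      have h1 := ih' (m + 1) (by rwa [← hk']) fun j hj => by
        have := hlt (j + 1) (Nat.succ_lt_succ hj)
        rwa [Nat.add_right_comm, Nat.add_assoc] at this
      rw [hk']
      simpa using hc1 ![ι a, ι m, ι (Nat.pair a m), ι (z + 1), ι z, ι (m + 1),
        ι (Nat.pair a (m + 1)), ι (k + (m + 1))]
        (by simpa using ⟨hp a m, ih hf hz, hs z, hs m, hp a (m + 1), h1⟩)

/-- The relations of the standard model. -/
def standardRel : (k : ℕ) → ℕ → (Fin k → ℕ) → Prop
  | 1, _, xs => xs 0 = 0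
  | 2, 0, xs => xs 0 < xs 1
  | 2, R + 1, xs => xs 1 ∈ (Denumerable.ofNat Code R).eval (xs 0)
  | 3, _, xs => Nat.pair (xs 0) (xs 1) = xs 2
  | _, _, _ => False

/-- The natural numbers with the graphs of all partial recursive functions. -/
abbrev standardModel : V.Structure ℕ where
  funMap f := isEmptyElim f
  RelMap R xs := standardRel _ (relIndex R) xs

attribute [local instance] standardModel

theorem standardModel_zeroRel {x : ℕ} : ZeroRel x ↔ x = 0 := Iff.rfl

theorem standardModel_binRel_zero {x y : ℕ} : BinRel 0 x y ↔ x < y := Iff.rfl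

theorem standardModel_binRel_graphSymbol {c : Code} {x y : ℕ} :
    BinRel (graphSymbol c) x y ↔ y ∈ c.eval x := by
  change y ∈ (Denumerable.ofNat Code (Encodable.encode c)).eval x ↔ _
  rw [Denumerable.ofNat_encode]

theorem standardModel_pairRel {x y z : ℕ} : PairRel x y z ↔ Nat.pair x y = z := Iff.rfl

theorem standardModel_arithAxioms : ∀ φ ∈ arithAxioms, ℕ ⊨ φ := by
  simp only [arithAxioms, List.forall_mem_cons, realize_hornClause, List.not_mem_nil,
    false_imp_iff, implies_true, and_true, realize_zeroAt, realize_binAt, realize_pairAt,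
    standardModel_zeroRel, standardModel_binRel_zero, standardModel_binRel_graphSymbol,
    standardModel_pairRel, mem_eval_succ]
  refine ⟨?_, ?_, ?_, ?_, ?_, ?_, ?_, ?_, ?_⟩
  · rw [zeroExists, Sentence.realize_not, realize_hornClause]
    intro h
    simpa [standardModel_zeroRel] using h ![0]
  · simp [succTotal, Sentence.Realize, Formula.Realize, Fin.snoc,
      standardModel_binRel_graphSymbol, mem_eval_succ]
  all_goals
    intro xs h
    have hc := pair_succ_cases (xs 0) (xs 1)
    have hc' := pair_succ_cases (xs 0) (xs 0)
  · omega
  · omega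
  · rw [h]; rfl
  all_goals grind

theorem standardModel_codeAxioms (c : Code) : ∀ φ ∈ codeAxioms c, ℕ ⊨ φ := by
  induction c <;>
    simp only [codeAxioms, List.forall_mem_cons, List.forall_mem_append, realize_hornClause,
      List.not_mem_nil, false_imp_iff, implies_true, and_true, realize_zeroAt, realize_binAt,
      realize_pairAt, standardModel_zeroRel, standardModel_binRel_graphSymbol,
      standardModel_pairRel, mem_eval_succ]
  case zero =>
    intro xs h
    simpa [Code.eval, pure, PFun.pure] using h
  case left =>
    intro xs h
    simp [Code.eval, ← h]
  case right =>
    intro xs h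
    simp [Code.eval, ← h]
  case pair f g ihf ihg =>
    refine ⟨fun xs h => ?_, ihf, ihg⟩
    exact mem_eval_pair.2 ⟨_, h.1, _, h.2⟩
  case comp f g ihf ihg =>
    refine ⟨fun xs h => ?_, ihf, ihg⟩
    exact Part.mem_bind_iff.2 ⟨_, h⟩
  case prec f g ihf ihg =>
    refine ⟨fun xs h => ?_, fun xs h => ?_, ihf, ihg⟩
    · obtain ⟨h1, h2, h3⟩ := h
      rwa [← h1, h2, Code.eval_prec_zero]
    · obtain ⟨h1, h2, h3, h4, h5, h6, h7⟩ := h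
      rw [← h4, h3, Code.eval_prec_succ]
      refine Part.mem_bind_iff.2 ⟨xs 3, by rwa [h1], ?_⟩
      rwa [h5, h6]
  case rfind' f ihf =>
    refine ⟨fun xs h => ?_, fun xs h => ?_, ihf⟩
    · obtain ⟨h1, h2, h3⟩ := h
      rw [← h1, mem_eval_rfind']
      refine ⟨0, ⟨?_, by simp⟩, Nat.zero_add _⟩
      rwa [Nat.zero_add, h1, ← h3]
    · obtain ⟨h1, h2, h3, h4, h5, h6⟩ := h
      rw [← h5, h4, mem_eval_rfind'] at h6
      obtain ⟨k, ⟨hk, hlt⟩, h6⟩ := h6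
      rw [← h1, mem_eval_rfind']
      have hk' : k + 1 + xs 1 = k + (xs 1 + 1) := by omega
      refine ⟨k + 1, ⟨by rwa [hk'], fun j hj => ?_⟩, by omega⟩
      cases j with
      | zero => exact ⟨xs 3, by rwa [Nat.zero_add, h1], by omega⟩
      | succ j =>
        have := hlt j (Nat.lt_of_succ_lt_succ hj)
        rwa [Nat.add_right_comm, Nat.add_assoc]

end Representation

section Halting

open Nat.Partrec (Code)

/-- The formula stating that the partial function with code `c` is undefined at the number that is
`j` more than the last variable. -/
def undefinedAfter (c : Code) : (j k : ℕ) → V.BoundedFormula Empty (k + 1)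
  | 0, k => (∼ (binAt (graphSymbol c) (Fin.last k).castSucc (Fin.last (k + 1)))).all
  | j + 1, k => ((binAt (graphSymbol .succ) (Fin.last k).castSucc (Fin.last (k + 1))).imp
      (undefinedAfter c j (k + 1))).all

/-- The sentence stating that the partial function with code `c` is undefined at `m`. -/
def undefinedAt (c : Code) (m : ℕ) : V.Sentence :=
  ((zeroAt (0 : Fin 1)).imp (undefinedAfter c m 0)).all

/-- The sentence describing computations of `c` and stating that it is undefined at `m`. -/
def divergence (c : Code) (m : ℕ) : V.Sentence :=
  ((arithAxioms ++ codeAxioms c).foldr (· ⊓ ·) ⊤) ⊓ undefinedAt c m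

theorem realize_divergence {M : Type} [V.Structure M] (c : Code) (m : ℕ) : M ⊨ divergence c m ↔
    (∀ φ ∈ arithAxioms, M ⊨ φ) ∧ (∀ φ ∈ codeAxioms c, M ⊨ φ) ∧ M ⊨ undefinedAt c m := by
  rw [divergence, Sentence.Realize, Formula.Realize, BoundedFormula.realize_inf,
    BoundedFormula.realize_foldr_inf, List.forall_mem_append, and_assoc]
  rfl

theorem not_binRel_of_undefinedAfter {M : Type} [V.Structure M] {c : Code} {ι : ℕ → M}
    (hs : ∀ k, BinRel (graphSymbol .succ) (ι k) (ι (k + 1))) {j : ℕ} :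
    ∀ {k l : ℕ} {xs : Fin (k + 1) → M}, xs (Fin.last k) = ι l →
      (undefinedAfter c j k).Realize default xs → ∀ y, ¬ BinRel (graphSymbol c) (ι (l + j)) y := by
  induction j with
  | zero =>
    intro k l xs hx h y hy
    refine BoundedFormula.realize_not.1 (h y) ?_
    simpa [hx] using hy
  | succ j ih =>
    intro k l xs hx h
    have := ih (l := l + 1) (by simp) (h (ι (l + 1)) (by simpa [hx] using hs l))
    rwa [Nat.add_right_comm, Nat.add_assoc] at this

attribute [local instance] standardModel in
theorem standardModel_undefinedAfter {c : Code} {j : ℕ} : ∀ {k l : ℕ} {v : Empty → ℕ}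
    {xs : Fin (k + 1) → ℕ}, xs (Fin.last k) = l → ¬ (c.eval (l + j)).Dom →
      (undefinedAfter c j k).Realize v xs := by
  induction j with
  | zero =>
    intro k l v xs hx h y hy
    refine h (Part.dom_iff_mem.2 ⟨y, ?_⟩)
    simpa [standardModel_binRel_graphSymbol, hx] using hy
  | succ j ih =>
    intro k l v xs hx h y hy
    obtain rfl : y = l + 1 := by
      simpa [standardModel_binRel_graphSymbol, mem_eval_succ, hx] using hy
    exact ih (l := l + 1) (by simp) (by rwa [Nat.add_right_comm, Nat.add_assoc])

attribute [local instance] standardModel in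
theorem sat_divergence_iff (c : Code) (m : ℕ) : Sat (divergence c m) ↔ ¬ (c.eval m).Dom := by
  constructor
  · rintro ⟨M, _, -, h⟩ hd
    obtain ⟨ha, hc, hu⟩ := (realize_divergence c m).1 h
    obtain ⟨ι, hz, hs, hp⟩ := exists_numerals ha
    obtain ⟨y, hy⟩ := Part.dom_iff_mem.1 hd
    have hu' := hu (ι 0) (by simpa [Fin.snoc] using hz)
    refine not_binRel_of_undefinedAfter hs (l := 0) rfl hu' (ι y) ?_
    rw [Nat.zero_add]
    exact binRel_graphSymbol_of_mem_eval hz hs hp hc hy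
  · intro h
    refine ⟨ℕ, standardModel, ⟨0⟩, ?_⟩
    refine (realize_divergence c m).2
      ⟨standardModel_arithAxioms, standardModel_codeAxioms c, fun x hx => ?_⟩
    obtain rfl : x = 0 := by simpa [standardModel_zeroRel, Fin.snoc] using hx
    refine standardModel_undefinedAfter (l := 0) ?_ (by rwa [Nat.zero_add])
    rfl

theorem formulaCode_binAt {n : ℕ} (R : ℕ) (i j : Fin n) :
    formulaCode (binAt R i j) = [relCode 2 R, markCode n, varCode n i, varCode n j] :=
  formulaCode_rel _ _

theorem formulaCode_not {n : ℕ} (φ : V.BoundedFormula Empty n) :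
    formulaCode (∼φ) = markCode 0 :: formulaCode φ ++ [markCode (n + 2)] :=
  formulaCode_imp _ _

/-- The code of the quantifier and hypothesis introducing the successor of the `k`-th variable. -/
def successorStepCode (k : ℕ) : List ℕ :=
  [markCode 1, markCode 0, relCode 2 (graphSymbol .succ), markCode (k + 2), varCode (k + 2) k,
    varCode (k + 2) (k + 1)]

/-- The code of the statement that the partial function with code `c` is undefined at the `k`-th
variable. -/
def undefinedAtVarCode (c : Code) (k : ℕ) : List ℕ :=
  [markCode 1, markCode 0, relCode 2 (graphSymbol c), markCode (k + 2), varCode (k + 2) k,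
    varCode (k + 2) (k + 1), markCode (k + 4)]

theorem formulaCode_undefinedAfter (c : Code) (j k : ℕ) : formulaCode (undefinedAfter c j k) =
    (List.range' k j).flatMap successorStepCode ++ undefinedAtVarCode c (k + j) := by
  induction j generalizing k with
  | zero =>
    rw [undefinedAfter, formulaCode_all, formulaCode_not, formulaCode_binAt]
    rfl
  | succ j ih =>
    have hk : k + 1 + j = k + (j + 1) := by omega
    rw [undefinedAfter, formulaCode_all, formulaCode_imp, formulaCode_binAt, ih,
      List.range'_succ, List.flatMap_cons, hk]
    rfl

theorem primrec_formulaCode_divergence (c : Code) :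
    Primrec fun m => formulaCode (divergence c m) := by
  have hk (i : ℕ) : Primrec fun k : ℕ => k + i := Primrec.nat_add.comp Primrec.id (Primrec.const i)
  have hm (i : ℕ) : Primrec fun k : ℕ => markCode (k + i) := primrec_markCode.comp (hk i)
  have hv (i : ℕ) : Primrec fun k : ℕ => varCode (k + 2) (k + i) :=
    primrec_varCode.comp (hk 2) (hk i)
  have hstep : Primrec successorStepCode :=
    Primrec.list_cons.comp (Primrec.const _) (Primrec.list_cons.comp (Primrec.const _)
      (Primrec.list_cons.comp (Primrec.const _) (Primrec.list_cons.comp (hm 2)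
        (Primrec.list_cons.comp (hv 0) (primrec_singleton (hv 1))))))
  have hend : Primrec (undefinedAtVarCode c) :=
    Primrec.list_cons.comp (Primrec.const _) (Primrec.list_cons.comp (Primrec.const _)
      (Primrec.list_cons.comp (Primrec.const _) (Primrec.list_cons.comp (hm 2)
        (Primrec.list_cons.comp (hv 0) (Primrec.list_cons.comp (hv 1)
          (primrec_singleton (hm 4)))))))
  have h : Primrec fun m => formulaCode (undefinedAfter c m 0) := by
    refine (Primrec.list_append.comp (Primrec.list_flatMap Primrec.list_range
      (hstep.comp Primrec.snd).to₂) hend).of_eq fun m => ?_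
    rw [formulaCode_undefinedAfter, List.range_eq_range', Nat.zero_add]
  have h' : Primrec fun m => formulaCode (undefinedAt c m) := by
    refine (Primrec.list_append.comp (Primrec.const (markCode 1 :: markCode 0 ::
      formulaCode (zeroAt (0 : Fin 1)))) h).of_eq fun m => ?_
    rw [undefinedAt, formulaCode_all, formulaCode_imp]
    rfl
  refine (Primrec.list_append.comp (Primrec.list_append.comp (Primrec.const (markCode 0 ::
    markCode 0 :: formulaCode ((arithAxioms ++ codeAxioms c).foldr (· ⊓ ·) ⊤) ++ [markCode 0])) h')
    (Primrec.const [markCode 2, markCode 2])).of_eq fun m => ?_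
  change _ = formulaCode (BoundedFormula.imp (BoundedFormula.imp _
    (BoundedFormula.imp (undefinedAt c m) .falsum)) .falsum)
  simp only [formulaCode_imp, formulaCode_falsum]
  simp

end Halting

/-- The (general) satisfiability problem of any computable fragment that is
equi-expressive with FO over all models is undecidable. -/
theorem general_sat_undecidable (L : Set V.Sentence)
    (hcomp : ComputablePred (fun k => ∃ φ ∈ L, Encodable.encode φ = k))
    (hexpr : SameExprAll L) :
    ¬ ComputablePred fun k => ∃ φ ∈ L, Encodable.encode φ = k ∧ Sat φ := by
  intro hL
  obtain ⟨u, hu⟩ := (Nat.Partrec.Code.exists_code (f := fun n =>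
    (Denumerable.ofNat Nat.Partrec.Code n).eval 0)).1 (Partrec.nat_iff.1
      (Nat.Partrec.Code.eval_part.comp (Computable.ofNat _) (Computable.const 0)))
  refine ComputablePred.halting_problem_not_re 0 ?_
  refine (rePred_sat_of_computablePred hexpr hL
    ((primrec_formulaCode_divergence u).comp Primrec.encode)).of_eq fun c => ?_
  simp [sat_divergence_iff, hu]
end

section
/- The satisfiability problem of first-order logic over words is decidable: the set of (codes of) sentences over the word vocabulary W that are satisfied by at least one word is a computable subset of ℕ. -/
open FirstOrder Language

/-- The word vocabulary `W`: countably many unary relation symbols `P_i` and a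
single binary relation symbol `<`. -/
def W : FirstOrder.Language :=
  ⟨fun _ => Empty, fun n => match n with
    | 1 => ℕ
    | 2 => Unit
    | _ => Empty⟩

instance : ∀ n, IsEmpty (W.Functions n) := fun _ => inferInstanceAs (IsEmpty Empty)
instance : ∀ n, Encodable (W.Functions n) := fun _ => inferInstanceAs (Encodable Empty)
instance : ∀ n, Encodable (W.Relations n)
  | 0 => inferInstanceAs (Encodable Empty)
  | 1 => inferInstanceAs (Encodable ℕ)
  | 2 => inferInstanceAs (Encodable Unit)
  | (_ + 3) => inferInstanceAs (Encodable Empty)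

/-- The unary relation symbol `P_i` of `W`. -/
def unSym (i : ℕ) : W.Relations 1 := i

/-- The binary relation symbol `<` of `W`. -/
def ltSym : W.Relations 2 := Unit.unit

/-- A computable encoding of (sigma-)bounded `W`-formulas as naturals. -/
instance : Encodable (Σ n, W.BoundedFormula Empty n) :=
  Encodable.ofLeftInjection (fun φ => φ.2.listEncode)
    (fun l => (BoundedFormula.listDecode l)[0]?)
    (fun φ => BoundedFormula.encoding.decode_encode φ)

/-- A computable encoding of `W`-sentences as naturals. -/
instance : Encodable W.Sentence :=
  Encodable.ofLeftInjection (fun φ => (⟨0, φ⟩ : Σ n, W.BoundedFormula Empty n))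
    (fun p => match p with
      | ⟨0, φ⟩ => some φ
      | _ => none)
    (fun _ => rfl)

/-- A `W`-structure is a word if it is finite and nonempty, `<` is interpreted as a
strict linear order, and every element satisfies exactly one unary relation symbol. -/
def IsWord (M : Type) [W.Structure M] : Prop :=
  Finite M ∧ Nonempty M ∧
    IsStrictTotalOrder M (fun a b => Structure.RelMap ltSym ![a, b]) ∧
    ∀ a : M, ∃! i : ℕ, Structure.RelMap (unSym i) ![a]

/-- A `W`-sentence is satisfiable over words if some word satisfies it. -/
def WordSat (φ : W.Sentence) : Prop :=
  ∃ (M : Type) (_ : W.Structure M), IsWord M ∧ M ⊨ φ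

/-- First-order formulas over words, in de Bruijn levels, with the symbols of `W` spelled out. -/
inductive WordFormula : ℕ → Type
  | fal {n : ℕ} : WordFormula n
  | eq {n : ℕ} (i j : Fin n) : WordFormula n
  | letter {n : ℕ} (a : ℕ) (i : Fin n) : WordFormula n
  | lt {n : ℕ} (i j : Fin n) : WordFormula n
  | imp {n : ℕ} (f g : WordFormula n) : WordFormula n
  | all {n : ℕ} (f : WordFormula (n + 1)) : WordFormula n

namespace WordFormula

/-- The `W`-formula denoted by a word formula. -/
def toBounded : ∀ {n : ℕ}, WordFormula n → W.BoundedFormula Empty n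
  | _, fal => .falsum
  | _, eq i j => .equal (.var (.inr i)) (.var (.inr j))
  | _, letter a i => .rel (unSym a) ![.var (.inr i)]
  | _, lt i j => .rel ltSym ![.var (.inr i), .var (.inr j)]
  | _, imp f g => .imp f.toBounded g.toBounded
  | _, all f => .all f.toBounded

theorem exists_term_eq_var {n : ℕ} (t : W.Term (Empty ⊕ Fin n)) :
    ∃ i : Fin n, t = .var (.inr i) := by
  rcases t with (e | i) | ⟨f, _⟩
  · exact e.elim
  · exact ⟨i, rfl⟩
  · exact isEmptyElim f

theorem toBounded_surjective {n : ℕ} (φ : W.BoundedFormula Empty n) :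
    ∃ f : WordFormula n, f.toBounded = φ := by
  induction φ with
  | falsum => exact ⟨fal, rfl⟩
  | equal t₁ t₂ =>
    obtain ⟨i, rfl⟩ := exists_term_eq_var t₁
    obtain ⟨j, rfl⟩ := exists_term_eq_var t₂
    exact ⟨eq i j, rfl⟩
  | @rel n l R ts =>
    match l, R, ts with
    | 0, R, _ => exact Empty.elim R
    | 1, R, ts =>
      obtain ⟨i, hi⟩ := exists_term_eq_var (ts 0)
      refine ⟨letter R i, ?_⟩
      have : ts = ![.var (.inr i)] := by
        funext j
        rw [Subsingleton.elim j 0, hi]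
        rfl
      rw [this]
      rfl
    | 2, R, ts =>
      obtain ⟨i, hi⟩ := exists_term_eq_var (ts 0)
      obtain ⟨j, hj⟩ := exists_term_eq_var (ts 1)
      refine ⟨lt i j, ?_⟩
      have : ts = ![.var (.inr i), .var (.inr j)] := by
        funext k
        fin_cases k
        · exact hi
        · exact hj
      rw [this]
      rfl
    | _ + 3, R, _ => exact Empty.elim R
  | imp _ _ ih₁ ih₂ =>
    obtain ⟨f, rfl⟩ := ih₁
    obtain ⟨g, rfl⟩ := ih₂
    exact ⟨imp f g, rfl⟩
  | all _ ih =>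
    obtain ⟨f, rfl⟩ := ih
    exact ⟨all f, rfl⟩

/-! ### Codes of formulas -/

/-- The code of the variable `i` in a context of `n` variables. -/
def varCode (n i : ℕ) : ℕ := 2 * Nat.pair n (Nat.pair (2 * (2 * i + 1)) 0 + 1)

/-- The code of the number `m` used as a symbol. -/
def numCode (m : ℕ) : ℕ := 2 * (2 * m + 1) + 1

/-- The code of the relation symbol number `a` of arity `l`. -/
def relCode (l a : ℕ) : ℕ := 2 * (2 * Nat.pair l a) + 1

/-- The list of the codes of the symbols of a formula. -/
def code : ∀ {n : ℕ}, WordFormula n → List ℕ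
  | n, fal => [numCode (n + 2)]
  | n, eq i j => [varCode n i, varCode n j]
  | n, letter a i => [relCode 1 a, numCode n, varCode n i]
  | n, lt i j => [relCode 2 0, numCode n, varCode n i, varCode n j]
  | _, imp f g => numCode 0 :: (f.code ++ g.code)
  | _, all f => numCode 1 :: f.code

theorem encode_eq_encode_map {α : Type*} [Encodable α] (l : List α) :
    Encodable.encode l = Encodable.encode (l.map Encodable.encode) := by
  induction l with
  | nil => rfl
  | cons a l ih => simp [ih]

theorem map_encode_listEncode {n : ℕ} (f : WordFormula n) :
    f.toBounded.listEncode.map Encodable.encode = f.code := by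
  induction f with
  | fal => rfl
  | eq i j => rfl
  | letter a i => rfl
  | lt i j => rfl
  | imp f g ihf ihg =>
    simp only [toBounded, BoundedFormula.listEncode, code, List.map_append, List.map_cons, ihf, ihg]
    rfl
  | all f ih =>
    simp only [toBounded, BoundedFormula.listEncode, code, List.map_cons, ih]
    rfl

theorem encode_toBounded (f : WordFormula 0) :
    Encodable.encode (f.toBounded : W.Sentence) = Encodable.encode f.code := by
  rw [← map_encode_listEncode, ← encode_eq_encode_map]
  rfl

/-! ### Semantics in terms of positions -/

/-- The truth of a formula in the word `w` under the assignment `t` of positions to variables. -/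
def Holds (w : List ℕ) : ∀ {n : ℕ}, WordFormula n → List ℕ → Prop
  | _, fal, _ => False
  | _, eq i j, t => t.getD i 0 = t.getD j 0
  | _, letter a i, t => w[t.getD i 0]? = some a
  | _, lt i j, t => t.getD i 0 < t.getD j 0
  | _, imp f g, t => f.Holds w t → g.Holds w t
  | _, all f, t => ∀ a < w.length, f.Holds w (t ++ [a])

theorem getD_ofFn {n : ℕ} (v : Fin n → ℕ) (i : Fin n) : (List.ofFn v).getD i 0 = v i := by
  simp [List.getD_eq_getElem?_getD]

theorem realize_iff_holds {M : Type} [W.Structure M] (w : List ℕ) (e : M ≃ Fin w.length)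
    (hlt : ∀ a b, Structure.RelMap ltSym ![a, b] ↔ e a < e b)
    (hun : ∀ i a, Structure.RelMap (unSym i) ![a] ↔ w[e a] = i)
    {n : ℕ} (f : WordFormula n) (v : Fin n → M) :
    f.toBounded.Realize default v ↔ f.Holds w (List.ofFn fun i => (e (v i) : ℕ)) := by
  induction f with
  | fal => rfl
  | eq i j =>
    simp only [toBounded, BoundedFormula.Realize, Holds, getD_ofFn]
    simp [Term.realize, Fin.val_inj]
  | letter a i =>
    simp only [toBounded, BoundedFormula.Realize, Holds, getD_ofFn]
    rw [List.getElem?_eq_getElem (e (v i)).2, Option.some_inj]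
    refine (iff_of_eq (congrArg _ ?_)).trans (hun a (v i))
    funext k
    fin_cases k
    rfl
  | lt i j =>
    simp only [toBounded, BoundedFormula.Realize, Holds, getD_ofFn, Fin.val_fin_lt, ← hlt]
    refine iff_of_eq (congrArg _ ?_)
    funext k
    fin_cases k <;> rfl
  | imp f g ihf ihg => simp only [toBounded, BoundedFormula.Realize, Holds, ihf, ihg]
  | @all n f ih =>
    have key (x : M) : (List.ofFn fun i => (e ((Fin.snoc v x : Fin (n + 1) → M) i) : ℕ)) =
        (List.ofFn fun i => (e (v i) : ℕ)) ++ [(e x : ℕ)] := by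
      rw [List.ofFn_succ', List.concat_eq_append]
      simp
    simp only [toBounded, BoundedFormula.Realize, Holds, ih, key]
    exact ⟨fun h a ha => by simpa using h (e.symm ⟨a, ha⟩), fun h x => h _ (e x).2⟩

theorem wordSat_iff_holds (f : WordFormula 0) :
    WordSat f.toBounded ↔ ∃ w : List ℕ, w ≠ [] ∧ f.Holds w [] := by
  constructor
  · rintro ⟨M, _, ⟨hfin, hne, hord, hun⟩, hsat⟩
    choose l hl hl' using hun
    classical
    let _ : LinearOrder M := linearOrderOfSTO fun a b => Structure.RelMap ltSym ![a, b]
    have : Fintype M := Fintype.ofFinite M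
    let e := Fintype.orderIsoFinOfCardEq M rfl
    let w : List ℕ := List.ofFn fun i => l (e i)
    have hw : w.length = Fintype.card M := List.length_ofFn
    let e' : M ≃ Fin w.length := e.symm.toEquiv.trans (finCongr hw.symm)
    refine ⟨w, fun h => Fintype.card_ne_zero (α := M) (by rw [← hw, h, List.length_nil]), ?_⟩
    refine (realize_iff_holds w e' (fun a b => ?_) (fun i a => ?_) f default).1 hsat
    · change a < b ↔ _
      simp [e', Fin.lt_def]
    · have : w[e' a] = l a := by simp [w, e']
      rw [this]
      exact ⟨fun h => (hl' a i h).symm, fun h => h ▸ hl a⟩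
  · rintro ⟨w, hw, h⟩
    let str : W.Structure (Fin w.length) :=
      { funMap := fun g => isEmptyElim g
        RelMap := fun {n} => match n with
          | 0 => fun _ _ => False
          | 1 => fun i v => w[v 0] = i
          | 2 => fun _ v => v 0 < v 1
          | _ + 3 => fun _ _ => False }
    refine ⟨Fin w.length, str,
      ⟨inferInstance, ⟨⟨0, List.length_pos_iff.2 hw⟩⟩, ?_, fun a => ?_⟩, ?_⟩
    · exact inferInstanceAs (IsStrictTotalOrder (Fin w.length) (· < ·))
    · exact ⟨w[a], rfl, fun i hi => Eq.symm hi⟩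
    · exact (realize_iff_holds w (Equiv.refl _) (fun a b => Iff.rfl) (fun i a => Iff.rfl) f
        default).2 h

end WordFormula

/-! ### Types of words -/

/-- The possible types of rank `k` of words over `α`. -/
def WordType (α : Type) : ℕ → Type
  | 0 => Unit
  | k + 1 => Set (WordType α k × α × WordType α k)

/-- The type of rank `k + 1` of a word records the types of rank `k` of the two factors around
each of its letters. -/
def wordType {α : Type} : ∀ k : ℕ, List α → WordType α k
  | 0, _ => ()
  | k + 1, w => {x | ∃ u a v, w = u ++ a :: v ∧ x = (wordType k u, a, wordType k v)}

section WordType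

variable {α β : Type}

theorem wordType_succ_eq_iff {k : ℕ} {w w' : List α} :
    wordType (k + 1) w = wordType (k + 1) w' ↔
      (∀ u a v, w = u ++ a :: v → ∃ u' v', w' = u' ++ a :: v' ∧
        wordType k u = wordType k u' ∧ wordType k v = wordType k v') ∧
      (∀ u a v, w' = u ++ a :: v → ∃ u' v', w = u' ++ a :: v' ∧
        wordType k u = wordType k u' ∧ wordType k v = wordType k v') := by
  constructor
  · intro h
    refine ⟨fun u a v hw => ?_, fun u a v hw => ?_⟩
    · have hm : wordType (k + 1) w (wordType k u, a, wordType k v) := ⟨u, a, v, hw, rfl⟩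
      rw [h] at hm
      obtain ⟨u', a', v', hw', he⟩ := hm
      simp only [Prod.mk.injEq] at he
      obtain ⟨h1, rfl, h2⟩ := he
      exact ⟨u', v', hw', h1, h2⟩
    · have hm : wordType (k + 1) w' (wordType k u, a, wordType k v) := ⟨u, a, v, hw, rfl⟩
      rw [← h] at hm
      obtain ⟨u', a', v', hw', he⟩ := hm
      simp only [Prod.mk.injEq] at he
      obtain ⟨h1, rfl, h2⟩ := he
      exact ⟨u', v', hw', h1, h2⟩
  · rintro ⟨h1, h2⟩
    refine Set.ext fun x => ⟨?_, ?_⟩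
    · rintro ⟨u, a, v, hw, rfl⟩
      obtain ⟨u', v', hw', hu, hv⟩ := h1 u a v hw
      exact ⟨u', a, v', hw', by rw [hu, hv]⟩
    · rintro ⟨u, a, v, hw, rfl⟩
      obtain ⟨u', v', hw', hu, hv⟩ := h2 u a v hw
      exact ⟨u', a, v', hw', by rw [hu, hv]⟩

theorem wordType_eq_of_succ {k : ℕ} {w w' : List α} (h : wordType (k + 1) w = wordType (k + 1) w') :
    wordType k w = wordType k w' := by
  induction k generalizing w w' with
  | zero => rfl
  | succ k ih =>
    rw [wordType_succ_eq_iff] at h ⊢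
    refine ⟨fun u a v hw => ?_, fun u a v hw => ?_⟩
    · obtain ⟨u', v', hw', hu, hv⟩ := h.1 u a v hw
      exact ⟨u', v', hw', ih hu, ih hv⟩
    · obtain ⟨u', v', hw', hu, hv⟩ := h.2 u a v hw
      exact ⟨u', v', hw', ih hu, ih hv⟩

theorem wordType_append {k : ℕ} {u u' v v' : List α} (hu : wordType k u = wordType k u')
    (hv : wordType k v = wordType k v') : wordType k (u ++ v) = wordType k (u' ++ v') := by
  induction k generalizing u u' v v' with
  | zero => rfl
  | succ k ih =>
    have key {u u' v v' : List α} (hu : wordType (k + 1) u = wordType (k + 1) u')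
        (hv : wordType (k + 1) v = wordType (k + 1) v') (x : List α) (a : α) (y : List α)
        (h : u ++ v = x ++ a :: y) : ∃ x' y', u' ++ v' = x' ++ a :: y' ∧
          wordType k x = wordType k x' ∧ wordType k y = wordType k y' := by
      rcases List.append_eq_append_iff.1 h with ⟨z, rfl, hz⟩ | ⟨z, rfl, hz⟩
      · obtain ⟨z', y', rfl, h1, h2⟩ := (wordType_succ_eq_iff.1 hv).1 z a y hz
        exact ⟨u' ++ z', y', by simp, ih (wordType_eq_of_succ hu) h1, h2⟩
      · cases z with
        | nil =>
          obtain ⟨z', y', rfl, h1, h2⟩ := (wordType_succ_eq_iff.1 hv).1 [] a y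
            (by simpa using hz.symm)
          refine ⟨u' ++ z', y', by simp, ?_, h2⟩
          simpa using ih (wordType_eq_of_succ hu) h1
        | cons b z =>
          obtain ⟨rfl, rfl⟩ := List.cons.inj hz
          obtain ⟨x', z', rfl, h1, h2⟩ := (wordType_succ_eq_iff.1 hu).1 x _ z rfl
          exact ⟨x', z' ++ v', by simp, h1, ih h2 (wordType_eq_of_succ hv)⟩
    exact wordType_succ_eq_iff.2 ⟨key hu hv, key hu.symm hv.symm⟩

theorem wordType_singleton_append {k : ℕ} {u u' v v' : List α} (hu : wordType k u = wordType k u')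
    (a : α) (hv : wordType k v = wordType k v') :
    wordType k (u ++ a :: v) = wordType k (u' ++ a :: v') :=
  wordType_append hu (wordType_append (u := [a]) (u' := [a]) rfl hv)

theorem wordType_map {k : ℕ} {w w' : List α} (f : α → β) (h : wordType k w = wordType k w') :
    wordType k (w.map f) = wordType k (w'.map f) := by
  induction k generalizing w w' with
  | zero => rfl
  | succ k ih =>
    have key {w w' : List α} (h : wordType (k + 1) w = wordType (k + 1) w')
        (u : List β) (a : β) (v : List β) (hw : w.map f = u ++ a :: v) :
        ∃ u' v', w'.map f = u' ++ a :: v' ∧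
          wordType k u = wordType k u' ∧ wordType k v = wordType k v' := by
      obtain ⟨x, y, rfl, rfl, hy⟩ := List.map_eq_append_iff.1 hw
      obtain ⟨b, z, rfl, rfl, rfl⟩ := List.map_eq_cons_iff.1 hy
      obtain ⟨x', z', rfl, h1, h2⟩ := (wordType_succ_eq_iff.1 h).1 x b z rfl
      exact ⟨x'.map f, z'.map f, by simp, ih h1, ih h2⟩
    exact wordType_succ_eq_iff.2 ⟨key h, key h.symm⟩

theorem eq_nil_of_wordType_eq {k : ℕ} {w : List α}
    (h : wordType (k + 1) w = wordType (k + 1) []) : w = [] := by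
  cases w with
  | nil => rfl
  | cons a w =>
    obtain ⟨u, v, hnil, -⟩ := (wordType_succ_eq_iff.1 h).1 [] a w rfl
    simp at hnil

/-- An upper bound for the number of types of rank `k` over `c` letters. -/
def typeBound (c k : ℕ) : ℕ := Nat.rec 1 (fun _ b => 2 ^ (b * (c * b))) k

theorem finite_wordType [Finite α] (k : ℕ) :
    Finite (WordType α k) ∧ Nat.card (WordType α k) = typeBound (Nat.card α) k := by
  induction k with
  | zero => exact ⟨inferInstanceAs (Finite Unit), Nat.card_unique (α := Unit)⟩
  | succ k ih =>
    obtain ⟨hfin, hcard⟩ := ih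
    refine ⟨inferInstanceAs (Finite (Set (WordType α k × α × WordType α k))), ?_⟩
    change Nat.card (Set (WordType α k × α × WordType α k)) = _
    rw [Set, Nat.card_fun, Nat.card_prod, Nat.card_prod, hcard]
    simp [typeBound]

theorem exists_short_wordType_eq [Finite α] (k : ℕ) (w : List α) :
    ∃ w' : List α, w'.length < typeBound (Nat.card α) k ∧ wordType k w' = wordType k w := by
  obtain ⟨hfin, hcard⟩ := finite_wordType (α := α) k
  induction hn : w.length using Nat.strong_induction_on generalizing w with
  | _ n ih =>
    by_cases hlt : n < typeBound (Nat.card α) k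
    · exact ⟨w, hn ▸ hlt, rfl⟩
    have : ¬ Function.Injective fun i : Fin (n + 1) => wordType k (w.take i) := fun hinj => by
      have := Nat.card_le_card_of_injective _ hinj
      rw [hcard, Nat.card_eq_fintype_card, Fintype.card_fin] at this
      omega
    obtain ⟨i, j, hij, hne⟩ : ∃ i j : Fin (n + 1),
        wordType k (w.take i) = wordType k (w.take j) ∧ i ≠ j := by
      simpa [Function.Injective] using this
    wlog hlt' : i < j generalizing i j
    · exact this j i hij.symm hne.symm (lt_of_le_of_ne (not_lt.1 hlt') hne.symm)
    have hi := i.2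
    have hj := j.2
    have hlt'' : (i : ℕ) < j := hlt'
    obtain ⟨w', h1, h2⟩ := ih (w.take i ++ w.drop j).length (by simp; omega) _ rfl
    refine ⟨w', h1, h2.trans ?_⟩
    conv_rhs => rw [← List.take_append_drop j w]
    exact wordType_append hij rfl

end WordType

namespace WordFormula

/-! ### Semantics in marked words -/

/-- The truth of a formula in a word whose letters are marked by the variables placed there. -/
def HoldsMarked : ∀ {n : ℕ}, WordFormula n → List (ℕ × Set ℕ) → Prop
  | _, fal, _ => False
  | _, eq i j, u => ∃ x ∈ u, (i : ℕ) ∈ x.2 ∧ (j : ℕ) ∈ x.2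
  | _, letter a i, u => ∃ x ∈ u, (i : ℕ) ∈ x.2 ∧ x.1 = a
  | _, lt i j, u => ∃ u₁ x u₂, u = u₁ ++ x :: u₂ ∧ (i : ℕ) ∈ x.2 ∧ ∃ y ∈ u₂, (j : ℕ) ∈ y.2
  | _, imp f g, u => f.HoldsMarked u → g.HoldsMarked u
  | n, all f, u => ∀ u₁ x u₂, u = u₁ ++ x :: u₂ →
      f.HoldsMarked (u₁ ++ (x.1, insert n x.2) :: u₂)

/-- A bound for the rank of the types that determine the truth of a formula. -/
def rank : ∀ {n : ℕ}, WordFormula n → ℕ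
  | _, fal => 0
  | _, eq _ _ => 1
  | _, letter _ _ => 1
  | _, lt _ _ => 2
  | _, imp f g => max f.rank g.rank
  | _, all f => f.rank + 1

theorem exists_mem_of_wordType_eq {α : Type} {k : ℕ} {w w' : List α}
    (h : wordType (k + 1) w = wordType (k + 1) w') {x : α} (hx : x ∈ w) : x ∈ w' := by
  obtain ⟨u, v, rfl⟩ := List.append_of_mem hx
  obtain ⟨u', v', rfl, -⟩ := (wordType_succ_eq_iff.1 h).1 u x v rfl
  simp

theorem HoldsMarked.of_wordType_eq {n : ℕ} {f : WordFormula n} {k : ℕ} (hk : f.rank ≤ k)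
    {u u' : List (ℕ × Set ℕ)} (h : wordType k u = wordType k u') (hf : f.HoldsMarked u) :
    f.HoldsMarked u' := by
  induction f generalizing k u u' with
  | fal => exact hf
  | eq i j =>
    obtain ⟨k, rfl⟩ := Nat.exists_eq_add_of_le' hk
    obtain ⟨x, hx, hij⟩ := hf
    exact ⟨x, exists_mem_of_wordType_eq h hx, hij⟩
  | letter a i =>
    obtain ⟨k, rfl⟩ := Nat.exists_eq_add_of_le' hk
    obtain ⟨x, hx, hij⟩ := hf
    exact ⟨x, exists_mem_of_wordType_eq h hx, hij⟩
  | lt i j =>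
    obtain ⟨k, rfl⟩ := Nat.exists_eq_add_of_le' hk
    obtain ⟨u₁, x, u₂, rfl, hi, y, hy, hj⟩ := hf
    obtain ⟨v₁, v₂, rfl, -, h2⟩ := (wordType_succ_eq_iff.1 h).1 _ _ _ rfl
    exact ⟨v₁, x, v₂, rfl, hi, y, exists_mem_of_wordType_eq h2 hy, hj⟩
  | imp f g ihf ihg =>
    have hk' := max_le_iff.1 hk
    exact fun hf' => ihg hk'.2 h (hf (ihf hk'.1 h.symm hf'))
  | all f ih =>
    cases k with
    | zero => simp [rank] at hk
    | succ k =>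
      intro u₁ x u₂ hu
      obtain ⟨v₁, v₂, rfl, h1, h2⟩ := (wordType_succ_eq_iff.1 h).2 u₁ x u₂ hu
      exact ih (Nat.le_of_succ_le_succ hk) (wordType_singleton_append h1.symm _ h2.symm)
        (hf _ _ _ rfl)

/-- All letters mentioned in the formula are smaller than `c`. -/
def LettersLT (c : ℕ) : ∀ {n : ℕ}, WordFormula n → Prop
  | _, fal => True
  | _, eq _ _ => True
  | _, letter a _ => a < c
  | _, lt _ _ => True
  | _, imp f g => f.LettersLT c ∧ g.LettersLT c
  | _, all f => f.LettersLT c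

theorem holdsMarked_map_min {c n : ℕ} {f : WordFormula n} (hf : f.LettersLT c)
    (u : List (ℕ × Set ℕ)) :
    f.HoldsMarked (u.map (Prod.map (min c) id)) ↔ f.HoldsMarked u := by
  induction f generalizing u with
  | fal => rfl
  | eq i j => simp [HoldsMarked, -Prod.exists]
  | letter a i =>
    have (b : ℕ) : min c b = a ↔ b = a := by
      have : a < c := hf
      omega
    simp [HoldsMarked, -Prod.exists, this]
  | lt i j =>
    constructor
    · rintro ⟨u₁, x, u₂, hu, hi, y, hy, hj⟩
      obtain ⟨v₁, v, rfl, rfl, hv⟩ := List.map_eq_append_iff.1 hu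
      obtain ⟨b, v₂, rfl, rfl, rfl⟩ := List.map_eq_cons_iff.1 hv
      obtain ⟨z, hz, rfl⟩ := List.mem_map.1 hy
      exact ⟨v₁, b, v₂, rfl, hi, z, hz, hj⟩
    · rintro ⟨u₁, x, u₂, rfl, hi, y, hy, hj⟩
      exact ⟨u₁.map (Prod.map (min c) id), Prod.map (min c) id x, u₂.map (Prod.map (min c) id),
        by rw [List.map_append, List.map_cons], hi, _, List.mem_map_of_mem hy, hj⟩
  | imp f g ihf ihg => simp only [HoldsMarked, ihf hf.1, ihg hf.2]
  | @all n f ih =>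
    have key (v₁ : List (ℕ × Set ℕ)) (x : ℕ × Set ℕ) (v₂ : List (ℕ × Set ℕ)) :
        f.HoldsMarked (v₁.map (Prod.map (min c) id) ++
          ((Prod.map (min c) id x).1, insert n (Prod.map (min c) id x).2) ::
          v₂.map (Prod.map (min c) id)) ↔
        f.HoldsMarked (v₁ ++ (x.1, insert n x.2) :: v₂) := by
      rw [← ih hf (v₁ ++ _), List.map_append, List.map_cons]
      rfl
    constructor
    · rintro h v₁ x v₂ rfl
      exact (key _ _ _).1 (h _ _ _ (by rw [List.map_append, List.map_cons]))
    · intro h u₁ x u₂ hu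
      obtain ⟨v₁, v, rfl, rfl, hv⟩ := List.map_eq_append_iff.1 hu
      obtain ⟨b, v₂, rfl, rfl, rfl⟩ := List.map_eq_cons_iff.1 hv
      exact (key _ _ _).2 (h _ _ _ rfl)

/-- The marked word `u` represents the word `w` with the assignment `t`. -/
def Represents (u : List (ℕ × Set ℕ)) (w t : List ℕ) : Prop :=
  u.map Prod.fst = w ∧ ∀ (p : ℕ) (x : ℕ × Set ℕ), u[p]? = some x → ∀ i, i ∈ x.2 ↔ t[i]? = some p

theorem Represents.getElem?_fst {u : List (ℕ × Set ℕ)} {w t : List ℕ} (h : Represents u w t)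
    (p : ℕ) : w[p]? = u[p]?.map Prod.fst := by
  rw [← h.1, List.getElem?_map]

theorem Represents.snoc {u₁ u₂ : List (ℕ × Set ℕ)} {x : ℕ × Set ℕ} {w t : List ℕ}
    (h : Represents (u₁ ++ x :: u₂) w t) :
    Represents (u₁ ++ (x.1, insert t.length x.2) :: u₂) w (t ++ [u₁.length]) := by
  refine ⟨by simpa using h.1, fun p y hy i => ?_⟩
  have hi : (t ++ [u₁.length])[i]? = some p ↔
      t[i]? = some p ∨ i = t.length ∧ p = u₁.length := by
    rcases lt_trichotomy i t.length with hi | rfl | hi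
    · rw [List.getElem?_append_left hi]
      simp [hi.ne]
    · simp [eq_comm]
    · rw [List.getElem?_eq_none (by simpa using hi), List.getElem?_eq_none hi.le]
      simp [hi.ne']
  rw [hi]
  rcases eq_or_ne p u₁.length with rfl | hp
  · have hx := h.2 u₁.length x (by simp) i
    obtain rfl : (x.1, insert t.length x.2) = y := by simpa using hy
    simp [hx, or_comm]
  · have : (u₁ ++ x :: u₂)[p]? = some y := by
      rw [← hy]
      rcases lt_or_gt_of_ne hp with hp | hp
      · rw [List.getElem?_append_left hp, List.getElem?_append_left hp]
      · obtain ⟨q, rfl⟩ := Nat.exists_eq_add_of_lt hp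
        rw [List.getElem?_append_right (by omega), List.getElem?_append_right (by omega),
          show u₁.length + q + 1 - u₁.length = q + 1 by omega]
        rfl
    simp [h.2 p y this i, hp]

theorem Represents.mem_iff {u : List (ℕ × Set ℕ)} {w t : List ℕ} (h : Represents u w t)
    (htw : ∀ p ∈ t, p < w.length) {i : ℕ} (hi : i < t.length) :
    ∃ _ : t.getD i 0 < u.length, ∀ p x, u[p]? = some x → (i ∈ x.2 ↔ p = t.getD i 0) := by
  have he : t.getD i 0 = t[i] := by simp [List.getD_eq_getElem?_getD, hi]
  have hlen : u.length = w.length := by rw [← h.1, List.length_map]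
  refine ⟨by rw [he, hlen]; exact htw _ (List.getElem_mem hi), fun p x hx => ?_⟩
  rw [h.2 p x hx, List.getElem?_eq_getElem hi, Option.some_inj, he, eq_comm]

theorem holdsMarked_iff_holds {n : ℕ} (f : WordFormula n) {u : List (ℕ × Set ℕ)} {w t : List ℕ}
    (h : Represents u w t) (ht : t.length = n) (htw : ∀ p ∈ t, p < w.length) :
    f.HoldsMarked u ↔ f.Holds w t := by
  induction f generalizing u t with
  | fal => rfl
  | eq i j =>
    obtain ⟨hi, hi'⟩ := h.mem_iff htw (i.2.trans_eq ht.symm)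
    obtain ⟨hj, hj'⟩ := h.mem_iff htw (j.2.trans_eq ht.symm)
    constructor
    · rintro ⟨x, hx, h1, h2⟩
      obtain ⟨p, hp⟩ := List.mem_iff_getElem?.1 hx
      exact ((hi' p x hp).1 h1).symm.trans ((hj' p x hp).1 h2)
    · intro hij
      exact ⟨u[t.getD i 0], List.getElem_mem hi, (hi' _ _ (List.getElem?_eq_getElem hi)).2 rfl,
        (hj' _ _ (List.getElem?_eq_getElem hi)).2 hij⟩
  | letter a i =>
    obtain ⟨hi, hi'⟩ := h.mem_iff htw (i.2.trans_eq ht.symm)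
    simp only [HoldsMarked, Holds, h.getElem?_fst, List.getElem?_eq_getElem hi, Option.map_some,
      Option.some_inj]
    constructor
    · rintro ⟨x, hx, h1, h2⟩
      obtain ⟨p, hp⟩ := List.mem_iff_getElem?.1 hx
      obtain rfl := (hi' p x hp).1 h1
      rw [List.getElem?_eq_getElem hi, Option.some_inj] at hp
      rw [hp, h2]
    · exact fun h2 =>
        ⟨u[t.getD i 0], List.getElem_mem hi, (hi' _ _ (List.getElem?_eq_getElem hi)).2 rfl, h2⟩
  | lt i j =>
    obtain ⟨hi, hi'⟩ := h.mem_iff htw (i.2.trans_eq ht.symm)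
    obtain ⟨hj, hj'⟩ := h.mem_iff htw (j.2.trans_eq ht.symm)
    constructor
    · rintro ⟨u₁, x, u₂, rfl, h1, y, hy, h2⟩
      obtain ⟨q, hq⟩ := List.mem_iff_getElem?.1 hy
      have e1 := (hi' u₁.length x (by simp)).1 h1
      have e2 := (hj' (u₁.length + (q + 1)) y (by
        rw [List.getElem?_append_right (by omega)]
        simpa using hq)).1 h2
      simp only [Holds]
      omega
    · intro hij
      refine ⟨u.take (t.getD i 0), u[t.getD i 0], u.drop (t.getD i 0 + 1), ?_,
        (hi' _ _ (List.getElem?_eq_getElem hi)).2 rfl, u[t.getD j 0], ?_,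
        (hj' _ _ (List.getElem?_eq_getElem hj)).2 rfl⟩
      · simp
      · rw [List.mem_drop_iff_getElem]
        simp only [Holds] at hij
        exact ⟨t.getD j 0 - (t.getD i 0 + 1), by omega, by congr 1; omega⟩
  | imp f g ihf ihg =>
    exact imp_congr (ihf h ht htw) (ihg h ht htw)
  | all f ih =>
    have hlen : u.length = w.length := by rw [← h.1, List.length_map]
    have hsnoc {a : ℕ} (ha : a < w.length) : ∀ p ∈ t ++ [a], p < w.length := by
      intro p hp
      rcases List.mem_append.1 hp with hp | hp
      · exact htw p hp
      · rwa [List.mem_singleton.1 hp]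
    subst ht
    constructor
    · intro hf a ha
      have hu : u = u.take a ++ u[a] :: u.drop (a + 1) := by simp
      have hla : (u.take a).length = a := by simp; omega
      have hr := Represents.snoc (hu ▸ h)
      rw [hla] at hr
      exact (ih hr (by simp) (hsnoc ha)).1 (hf _ _ _ hu)
    · rintro hf u₁ x u₂ rfl
      have ha : u₁.length < w.length := by rw [← hlen]; simp
      exact (ih h.snoc (by simp) (hsnoc ha)).2 (hf _ ha)

theorem holds_iff_holdsMarked (f : WordFormula 0) (w : List ℕ) :
    f.Holds w [] ↔ f.HoldsMarked (w.map fun a => (a, ∅)) := by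
  refine (holdsMarked_iff_holds f ⟨by simp [Function.comp_def], fun p x hx i => ?_⟩ rfl
    (by simp)).symm
  obtain ⟨a, -, rfl⟩ := List.mem_map.1 (List.mem_of_getElem? hx)
  simp

theorem rank_le_sum_code {n : ℕ} (f : WordFormula n) : f.rank ≤ f.code.sum := by
  induction f with
  | fal => simp [rank]
  | eq i j => simp [rank, code, varCode]; grind [Nat.right_le_pair]
  | letter a i => simp [rank, code, relCode]; omega
  | lt i j => simp [rank, code, relCode, numCode]; omega
  | imp f g ihf ihg => simp [rank, code]; omega
  | all f ih => simp [rank, code, numCode]; omega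

theorem lettersLT_of_sum_code_lt {n c : ℕ} (f : WordFormula n) (h : f.code.sum < c) :
    f.LettersLT c := by
  induction f with
  | fal => trivial
  | eq i j => trivial
  | letter a i =>
    have := Nat.right_le_pair 1 a
    simp [code, relCode] at h
    change a < c
    omega
  | lt i j => trivial
  | imp f g ihf ihg =>
    simp [code] at h
    exact ⟨ihf (by omega), ihg (by omega)⟩
  | all f ih =>
    simp [code] at h
    exact ih (by omega)

/-- A bound for the length of a shortest model of a formula whose code has sum `s`. -/
def modelBound (s : ℕ) : ℕ := typeBound (s + 2) (s + 1)

theorem exists_small_model (f : WordFormula 0) {w : List ℕ} (hw : w ≠ []) (h : f.Holds w []) :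
    ∃ w' : List ℕ, w' ≠ [] ∧ w'.length < modelBound f.code.sum ∧ (∀ a ∈ w', a < f.code.sum + 2) ∧
      f.Holds w' [] := by
  set s := f.code.sum with hs
  let r (a : ℕ) : Fin (s + 2) := ⟨min (s + 1) a, by omega⟩
  obtain ⟨v, hv, hvw⟩ := exists_short_wordType_eq (s + 1) (w.map r)
  rw [Nat.card_eq_fintype_card, Fintype.card_fin] at hv
  refine ⟨v.map Fin.val, ?_, by rw [List.length_map]; exact hv, by simp, ?_⟩
  · intro hnil
    rw [List.map_eq_nil_iff.1 hnil] at hvw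
    exact hw (List.map_eq_nil_iff.1 (eq_nil_of_wordType_eq hvw.symm))
  · rw [holds_iff_holdsMarked] at h ⊢
    rw [← holdsMarked_map_min (lettersLT_of_sum_code_lt f (Nat.lt_succ_self _))] at h
    refine h.of_wordType_eq (f.rank_le_sum_code.trans (Nat.le_succ _)) ?_
    have := wordType_map (fun i : Fin (s + 2) => ((i : ℕ), (∅ : Set ℕ))) hvw.symm
    simpa [Function.comp_def, r] using this

/-! ### Evaluation of codes -/

/-- All lists of length `n` with entries smaller than `m`. -/
def tuples (m n : ℕ) : List (List ℕ) :=
  Nat.rec [ [] ] (fun _ ts => ts.flatMap fun t => (List.range m).map fun a => t ++ [a]) n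

theorem mem_tuples {m n : ℕ} {t : List ℕ} :
    t ∈ tuples m n ↔ t.length = n ∧ ∀ a ∈ t, a < m := by
  induction n generalizing t with
  | zero =>
    change t ∈ [ [] ] ↔ _
    rw [List.mem_singleton, List.length_eq_zero_iff]
    exact ⟨fun h => ⟨h, by simp [h]⟩, And.left⟩
  | succ n ih =>
    change t ∈ (tuples m n).flatMap (fun t => (List.range m).map fun a => t ++ [a]) ↔ _
    simp only [List.mem_flatMap, List.mem_map, List.mem_range, ih]
    constructor
    · rintro ⟨s, ⟨rfl, hs⟩, a, ha, rfl⟩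
      refine ⟨by simp, fun b hb => ?_⟩
      rcases List.mem_append.1 hb with hb | hb
      · exact hs b hb
      · rwa [List.mem_singleton.1 hb]
    · rintro ⟨hl, ht⟩
      have hne : t ≠ [] := by
        rintro rfl
        simp at hl
      exact ⟨t.dropLast, ⟨by simp [hl], fun a ha => ht a (List.mem_of_mem_dropLast ha)⟩,
        t.getLast hne, ht _ (List.getLast_mem hne), List.dropLast_append_getLast hne⟩

/-- The number of variables and the truth table of a formula. -/
abbrev Table : Type := ℕ × List (List ℕ)

open Classical in
/-- The truth table of a formula in the word `w`. -/
noncomputable def table (w : List ℕ) {n : ℕ} (f : WordFormula n) : Table :=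
  (n, (tuples w.length n).filter fun t => f.Holds w t)

theorem table_eq_iff (w : List ℕ) (f : WordFormula 0) : table w f = (0, [ [] ]) ↔ f.Holds w [] := by
  simp [table, tuples]

/-- The table of an equality. -/
def eqTable (m n i j : ℕ) : Table :=
  (n, (tuples m n).filter fun t => t.getD i 0 = t.getD j 0)

/-- The table of a letter predicate. -/
def letterTable (w : List ℕ) (n a i : ℕ) : Table :=
  (n, (tuples w.length n).filter fun t => w[t.getD i 0]? = some a)

/-- The table of an inequality. -/
def ltTable (m n i j : ℕ) : Table :=
  (n, (tuples m n).filter fun t => t.getD i 0 < t.getD j 0)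

/-- The table of an implication. -/
def impTable (m : ℕ) (x y : Table) : Table :=
  (x.1, (tuples m x.1).filter fun t => t ∉ x.2 ∨ t ∈ y.2)

/-- The table of a universal quantification. -/
def allTable (m : ℕ) (x : Table) : Table :=
  (x.1 - 1, (tuples m (x.1 - 1)).filter fun t => ∀ a ∈ List.range m, t ++ [a] ∈ x.2)

theorem table_fal (w : List ℕ) (n : ℕ) : table w (fal : WordFormula n) = (n, []) :=
  congrArg (Prod.mk n) (List.filter_eq_nil_iff.2 fun _ _ h => @of_decide_eq_true _ (_) h)

theorem table_eq (w : List ℕ) {n : ℕ} (i j : Fin n) :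
    table w (eq i j) = eqTable w.length n i j := by
  simp [table, Holds, eqTable]

theorem table_letter (w : List ℕ) {n : ℕ} (a : ℕ) (i : Fin n) :
    table w (letter a i) = letterTable w n a i := by
  simp [table, Holds, letterTable]

theorem table_lt (w : List ℕ) {n : ℕ} (i j : Fin n) :
    table w (lt i j) = ltTable w.length n i j := by
  simp [table, Holds, ltTable]

theorem table_imp (w : List ℕ) {n : ℕ} (f g : WordFormula n) :
    table w (imp f g) = impTable w.length (table w f) (table w g) := by
  simp only [table, impTable, Prod.mk.injEq, true_and]
  refine List.filter_congr fun t ht => decide_eq_decide.2 ?_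
  simp [Holds, ht, imp_iff_not_or]

theorem table_all (w : List ℕ) {n : ℕ} (f : WordFormula (n + 1)) :
    table w (all f) = allTable w.length (table w f) := by
  simp only [table, allTable, Prod.mk.injEq, Nat.add_sub_cancel, true_and]
  refine List.filter_congr fun t ht => decide_eq_decide.2 ?_
  have key (a : ℕ) (ha : a < w.length) : t ++ [a] ∈ tuples w.length (n + 1) := by
    rw [mem_tuples] at ht ⊢
    refine ⟨by simp [ht.1], fun b hb => ?_⟩
    rcases List.mem_append.1 hb with hb | hb
    · exact ht.2 b hb
    · rwa [List.mem_singleton.1 hb]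
  simp only [Holds, List.mem_range, List.mem_filter, decide_eq_true_eq]
  exact forall₂_congr fun a ha => by simp [key a ha]

/-- The number of variables in the context of a coded variable. -/
def ctxOf (s : ℕ) : ℕ := (s / 2).unpair.1

/-- The index of a coded variable. -/
def idxOf (s : ℕ) : ℕ := ((s / 2).unpair.2 - 1).unpair.1 / 4

/-- The letter of a coded letter predicate. -/
def letterOf (s : ℕ) : ℕ := (s / 4).unpair.2

/-- `s` is the code of a variable. -/
def IsVar (s : ℕ) : Prop := idxOf s < ctxOf s ∧ s = varCode (ctxOf s) (idxOf s)

instance : DecidablePred IsVar := fun _ => inferInstanceAs (Decidable (_ ∧ _))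

theorem ctxOf_varCode (n i : ℕ) : ctxOf (varCode n i) = n := by
  simp [ctxOf, varCode]

theorem idxOf_varCode (n i : ℕ) : idxOf (varCode n i) = i := by
  simp [idxOf, varCode]
  omega

theorem letterOf_relCode (l a : ℕ) : letterOf (relCode l a) = a := by
  have : relCode l a / 4 = Nat.pair l a := by
    rw [relCode]
    omega
  simp [letterOf, this]

theorem isVar_iff {s : ℕ} : IsVar s ↔ ∃ (n : ℕ) (i : Fin n), s = varCode n i := by
  constructor
  · exact fun h => ⟨ctxOf s, ⟨idxOf s, h.1⟩, h.2⟩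
  · rintro ⟨n, i, rfl⟩
    simp [IsVar, ctxOf_varCode, idxOf_varCode]

theorem varCode_ne_numCode (n i m : ℕ) : varCode n i ≠ numCode m := by
  rw [varCode, numCode]
  omega

theorem relCode_ne_numCode (l a m : ℕ) : relCode l a ≠ numCode m := by
  rw [relCode, numCode]
  omega

theorem relCode_ne_varCode (l a n i : ℕ) : relCode l a ≠ varCode n i := by
  rw [relCode, varCode]
  omega

theorem relCode_inj {l a l' a' : ℕ} : relCode l a = relCode l' a' ↔ l = l' ∧ a = a' := by
  rw [← Nat.pair_eq_pair, relCode, relCode]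
  omega

/-- The stack of tables of the formulas in a concatenation of codes `l`, computed from the stacks
`q` of the tails of `l`. -/
def evalStep (w l : List ℕ) (q : List (Option (List Table))) : Option (List Table) :=
  if l.getD 0 0 = numCode 0 then
    (q.getD 0 none).bind fun vs =>
      if 2 ≤ vs.length ∧ (vs.getD 0 (0, [])).1 = (vs.getD 1 (0, [])).1 then
        some (impTable w.length (vs.getD 0 (0, [])) (vs.getD 1 (0, [])) :: vs.drop 2)
      else none
  else if l.getD 0 0 = numCode 1 then
    (q.getD 0 none).bind fun vs =>
      if 1 ≤ vs.length ∧ 1 ≤ (vs.getD 0 (0, [])).1 then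
        some (allTable w.length (vs.getD 0 (0, [])) :: vs.drop 1)
      else none
  else if l.getD 0 0 = numCode (l.getD 0 0 / 4 - 2 + 2) then
    (q.getD 0 none).map fun vs => (l.getD 0 0 / 4 - 2, []) :: vs
  else if IsVar (l.getD 0 0) ∧ IsVar (l.getD 1 0) ∧ ctxOf (l.getD 0 0) = ctxOf (l.getD 1 0) then
    (q.getD 1 none).map fun vs =>
      eqTable w.length (ctxOf (l.getD 0 0)) (idxOf (l.getD 0 0)) (idxOf (l.getD 1 0)) :: vs
  else if l.getD 0 0 = relCode 1 (letterOf (l.getD 0 0)) ∧ IsVar (l.getD 2 0) ∧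
      l.getD 1 0 = numCode (ctxOf (l.getD 2 0)) then
    (q.getD 2 none).map fun vs =>
      letterTable w (ctxOf (l.getD 2 0)) (letterOf (l.getD 0 0)) (idxOf (l.getD 2 0)) :: vs
  else if l.getD 0 0 = relCode 2 0 ∧ IsVar (l.getD 2 0) ∧ IsVar (l.getD 3 0) ∧
      l.getD 1 0 = numCode (ctxOf (l.getD 2 0)) ∧ ctxOf (l.getD 2 0) = ctxOf (l.getD 3 0) then
    (q.getD 3 none).map fun vs =>
      ltTable w.length (ctxOf (l.getD 2 0)) (idxOf (l.getD 2 0)) (idxOf (l.getD 3 0)) :: vs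
  else none

/-- The stacks of tables of all tails of a list. -/
def evalTails (w : List ℕ) : List ℕ → List (Option (List Table))
  | [] => [some [] ]
  | s :: l => evalStep w (s :: l) (evalTails w l) :: evalTails w l

/-- The stack of tables of a concatenation of codes of formulas, or `none` for other lists. -/
def eval (w l : List ℕ) : Option (List Table) := (evalTails w l).getD 0 none

theorem getD_zero_evalTails (w l : List ℕ) : (evalTails w l).getD 0 none = eval w l := rfl

theorem getD_one_evalTails (w : List ℕ) (s : ℕ) (l : List ℕ) :
    (evalTails w (s :: l)).getD 1 none = eval w l := rfl

theorem getD_two_evalTails (w : List ℕ) (s₀ s₁ : ℕ) (l : List ℕ) :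
    (evalTails w (s₀ :: s₁ :: l)).getD 2 none = eval w l := rfl

theorem getD_three_evalTails (w : List ℕ) (s₀ s₁ s₂ : ℕ) (l : List ℕ) :
    (evalTails w (s₀ :: s₁ :: s₂ :: l)).getD 3 none = eval w l := rfl

theorem eval_cons (w : List ℕ) (s : ℕ) (l : List ℕ) :
    eval w (s :: l) = evalStep w (s :: l) (evalTails w l) := rfl

theorem eval_code_append (w : List ℕ) {n : ℕ} (f : WordFormula n) (l : List ℕ) :
    eval w (f.code ++ l) = (eval w l).map (table w f :: ·) := by
  induction f generalizing l with
  | @fal n =>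
    have h0 : numCode (n + 2) ≠ numCode 0 := by simp [numCode]
    have h1 : numCode (n + 2) ≠ numCode 1 := by unfold numCode; omega
    have h2 : numCode (n + 2) / 4 - 2 = n := by simp [numCode]; omega
    change eval w (numCode (n + 2) :: l) = _
    rw [eval_cons, evalStep, getD_zero_evalTails]
    simp [h0, h1, h2, table_fal]
  | @eq n i j =>
    have hi : IsVar (varCode n i) := isVar_iff.2 ⟨n, i, rfl⟩
    have hj : IsVar (varCode n j) := isVar_iff.2 ⟨n, j, rfl⟩
    change eval w (varCode n i :: varCode n j :: l) = _
    rw [eval_cons, evalStep, getD_one_evalTails]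
    simp [varCode_ne_numCode, hi, hj, ctxOf_varCode, idxOf_varCode, table_eq]
  | @letter n a i =>
    have hi : IsVar (varCode n i) := isVar_iff.2 ⟨n, i, rfl⟩
    have hr : ¬ IsVar (relCode 1 a) := fun h => by
      obtain ⟨n, i, h⟩ := isVar_iff.1 h
      exact relCode_ne_varCode _ _ _ _ h
    change eval w (relCode 1 a :: numCode n :: varCode n i :: l) = _
    rw [eval_cons, evalStep, getD_two_evalTails]
    simp [relCode_ne_numCode, hi, hr, ctxOf_varCode, idxOf_varCode, letterOf_relCode, table_letter]
  | @lt n i j =>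
    have hi : IsVar (varCode n i) := isVar_iff.2 ⟨n, i, rfl⟩
    have hj : IsVar (varCode n j) := isVar_iff.2 ⟨n, j, rfl⟩
    have hr : ¬ IsVar (relCode 2 0) := fun h => by
      obtain ⟨n, i, h⟩ := isVar_iff.1 h
      exact relCode_ne_varCode _ _ _ _ h
    change eval w (relCode 2 0 :: numCode n :: varCode n i :: varCode n j :: l) = _
    rw [eval_cons, evalStep, getD_three_evalTails]
    simp [relCode_ne_numCode, hi, hj, hr, ctxOf_varCode, idxOf_varCode, relCode_inj, table_lt]
  | imp f g ihf ihg =>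
    have h : (evalTails w (f.code ++ (g.code ++ l))).getD 0 none =
        (eval w l).map fun vs => table w f :: table w g :: vs := by
      rw [getD_zero_evalTails, ihf, ihg, Option.map_map]
      rfl
    rw [code, List.cons_append, List.append_assoc, eval_cons, evalStep, h]
    rw [table_imp]
    cases eval w l <;> simp [table]
  | all f ih =>
    have h : (evalTails w (f.code ++ l)).getD 0 none =
        (eval w l).map fun vs => table w f :: vs := by
      rw [getD_zero_evalTails, ih]
    have h0 : numCode 1 ≠ numCode 0 := by simp [numCode]
    rw [code, List.cons_append, eval_cons, evalStep, h]
    rw [table_all]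
    cases eval w l <;> simp [table, h0]

theorem not_isVar_zero : ¬ IsVar 0 := fun h => by
  obtain ⟨n, i, h⟩ := isVar_iff.1 h
  have := Nat.right_le_pair n (Nat.pair (2 * (2 * i + 1)) 0 + 1)
  rw [varCode] at h
  omega

theorem exists_of_eval_eq_some (w : List ℕ) {l : List ℕ} {vs : List Table}
    (h : eval w l = some vs) : ∃ fs : List (Σ n, WordFormula n),
      l = fs.flatMap (fun f => f.2.code) ∧ vs = fs.map fun f => table w f.2 := by
  induction hn : l.length using Nat.strong_induction_on generalizing l vs with
  | _ n ih =>
  subst hn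
  obtain _ | ⟨s, l⟩ := l
  · exact ⟨[], rfl, (Option.some.inj h).symm⟩
  rw [eval_cons, evalStep] at h
  split_ifs at h with h₁ h₂ h₃ h₄ h₅ h₆
  · rw [getD_zero_evalTails, Option.bind_eq_some_iff] at h
    obtain ⟨us, hus, h⟩ := h
    obtain ⟨fs, rfl, rfl⟩ := ih _ (by simp) hus rfl
    obtain _ | ⟨⟨n, f⟩, _ | ⟨⟨m, g⟩, fs⟩⟩ := fs
    · simp at h
    · simp at h
    · by_cases hnm : n = m
      · subst hnm
        refine ⟨⟨n, imp f g⟩ :: fs, ?_, ?_⟩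
        · change s = _ at h₁
          simp [h₁, code]
        · rw [if_pos (by exact ⟨by simp, rfl⟩)] at h
          rw [List.map_cons, table_imp]
          exact (Option.some.inj h).symm
      · exact absurd h (by simp [table, hnm])
  · rw [getD_zero_evalTails, Option.bind_eq_some_iff] at h
    obtain ⟨us, hus, h⟩ := h
    obtain ⟨fs, rfl, rfl⟩ := ih _ (by simp) hus rfl
    obtain _ | ⟨⟨_ | n, f⟩, fs⟩ := fs
    · simp at h
    · exact absurd h (by simp [table])
    · refine ⟨⟨n, all f⟩ :: fs, ?_, ?_⟩
      · change s = _ at h₂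
        simp [h₂, code]
      · rw [if_pos (by exact ⟨by simp, Nat.le_add_left 1 n⟩)] at h
        rw [List.map_cons, table_all]
        exact (Option.some.inj h).symm
  · rw [getD_zero_evalTails, Option.map_eq_some_iff] at h
    obtain ⟨us, hus, rfl⟩ := h
    obtain ⟨fs, rfl, rfl⟩ := ih _ (by simp) hus rfl
    refine ⟨⟨s / 4 - 2, fal⟩ :: fs, ?_, ?_⟩
    · simpa [code] using h₃
    · rw [List.map_cons, table_fal]
      rfl
  · obtain ⟨h₄, h₅, h₆⟩ := h₄
    obtain _ | ⟨t, l⟩ := l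
    · exact absurd h₅ not_isVar_zero
    rw [getD_one_evalTails, Option.map_eq_some_iff] at h
    obtain ⟨us, hus, rfl⟩ := h
    obtain ⟨fs, rfl, rfl⟩ := ih _ (by simp) hus rfl
    obtain ⟨n, i, hi⟩ := isVar_iff.1 h₄
    obtain ⟨m, j, hj⟩ := isVar_iff.1 h₅
    change s = _ at hi
    change t = _ at hj
    subst hi hj
    change ctxOf (varCode n i) = ctxOf (varCode m j) at h₆
    rw [ctxOf_varCode, ctxOf_varCode] at h₆
    subst h₆
    refine ⟨⟨n, eq i j⟩ :: fs, rfl, ?_⟩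
    rw [List.map_cons, table_eq]
    simp [ctxOf_varCode, idxOf_varCode]
  · obtain ⟨h₅, h₆, h₇⟩ := h₅
    obtain _ | ⟨t, _ | ⟨u, l⟩⟩ := l
    · exact absurd h₆ not_isVar_zero
    · exact absurd h₆ not_isVar_zero
    rw [getD_two_evalTails, Option.map_eq_some_iff] at h
    obtain ⟨us, hus, rfl⟩ := h
    obtain ⟨fs, rfl, rfl⟩ := ih _ (by simp; omega) hus rfl
    obtain ⟨n, i, hi⟩ := isVar_iff.1 h₆
    change u = _ at hi
    subst hi
    change t = numCode (ctxOf (varCode n i)) at h₇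
    rw [ctxOf_varCode] at h₇
    subst h₇
    change s = relCode 1 (letterOf s) at h₅
    refine ⟨⟨n, letter (letterOf s) i⟩ :: fs, by simp [code, ← h₅], ?_⟩
    rw [List.map_cons, table_letter]
    simp [ctxOf_varCode, idxOf_varCode]
  · obtain ⟨h₆, h₇, h₈, h₉, h₁₀⟩ := h₆
    obtain _ | ⟨t, _ | ⟨u, _ | ⟨v, l⟩⟩⟩ := l
    · exact absurd h₈ not_isVar_zero
    · exact absurd h₈ not_isVar_zero
    · exact absurd h₈ not_isVar_zero
    rw [getD_three_evalTails, Option.map_eq_some_iff] at h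
    obtain ⟨us, hus, rfl⟩ := h
    obtain ⟨fs, rfl, rfl⟩ := ih _ (by simp; omega) hus rfl
    obtain ⟨n, i, hi⟩ := isVar_iff.1 h₇
    obtain ⟨m, j, hj⟩ := isVar_iff.1 h₈
    change u = _ at hi
    change v = _ at hj
    subst hi hj
    change ctxOf (varCode n i) = ctxOf (varCode m j) at h₁₀
    rw [ctxOf_varCode, ctxOf_varCode] at h₁₀
    subst h₁₀
    change t = numCode (ctxOf (varCode n i)) at h₉
    rw [ctxOf_varCode] at h₉
    change s = relCode 2 0 at h₆
    subst h₉ h₆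
    refine ⟨⟨n, lt i j⟩ :: fs, rfl, ?_⟩
    rw [List.map_cons, table_lt]
    simp [ctxOf_varCode, idxOf_varCode]

/-! ### Primitive recursiveness of evaluation -/

section Primrec

variable {α β : Type*} [Primcodable α] [Primcodable β]

theorem primrec_filter {f : α → List β} {R : β → α → Prop} [DecidableRel R] (hf : Primrec f)
    (hR : PrimrecRel R) : Primrec fun a => (f a).filter fun b => R b a :=
  hR.listFilter.comp hf .id

theorem primrecPred_mem {f : α → β} {g : α → List β} (hf : Primrec f) (hg : Primrec g) :
    PrimrecPred fun a => f a ∈ g a :=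
  (PrimrecRel.comp Primrec.eq.exists_mem_list hg hf).of_eq fun a => by simp

theorem primrecPred_forall_mem {f : α → List β} {R : β → α → Prop} (hf : Primrec f)
    (hR : PrimrecRel R) : PrimrecPred fun a => ∀ b ∈ f a, R b a :=
  PrimrecRel.comp hR.forall_mem_list hf .id

theorem primrecPred_exists_mem {f : α → List β} {R : β → α → Prop} (hf : Primrec f)
    (hR : PrimrecRel R) : PrimrecPred fun a => ∃ b ∈ f a, R b a :=
  PrimrecRel.comp hR.exists_mem_list hf .id

theorem primrec_pow : Primrec₂ fun a b : ℕ => a ^ b :=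
  Primrec₂.unpaired'.1 Nat.Primrec.pow

theorem primrec_typeBound : Primrec₂ typeBound := by
  refine (Primrec.nat_rec (f := fun _ : ℕ => 1) (g := fun c p => 2 ^ (p.2 * (c * p.2)))
    (.const 1) ?_).of_eq fun c k => rfl
  have hb : Primrec fun q : ℕ × ℕ × ℕ => q.2.2 := .comp .snd .snd
  exact primrec_pow.comp (.const 2) (Primrec.nat_mul.comp hb (Primrec.nat_mul.comp .fst hb))

theorem primrec_modelBound : Primrec modelBound :=
  primrec_typeBound.comp (Primrec.succ.comp .succ) .succ

theorem primrec_tuples : Primrec₂ tuples := by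
  refine (Primrec.nat_rec (f := fun _ : ℕ => [ ([] : List ℕ) ])
    (g := fun m p => p.2.flatMap fun t => (List.range m).map fun a => t ++ [a])
    (.const _) ?_).of_eq fun m n => rfl
  refine Primrec.list_flatMap (.comp .snd .snd) ?_
  refine Primrec.list_map (Primrec.list_range.comp (.comp .fst .fst)) ?_
  exact Primrec.list_concat.comp (.comp .snd .fst) .snd

theorem primrec_eqTable {m n i j : α → ℕ} (hm : Primrec m) (hn : Primrec n) (hi : Primrec i)
    (hj : Primrec j) : Primrec fun x => eqTable (m x) (n x) (i x) (j x) := by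
  refine .pair hn (primrec_filter (primrec_tuples.comp hm hn) ?_)
  exact Primrec.eq.comp ((Primrec.list_getD 0).comp .fst (hi.comp .snd))
    ((Primrec.list_getD 0).comp .fst (hj.comp .snd))

theorem primrec_ltTable {m n i j : α → ℕ} (hm : Primrec m) (hn : Primrec n) (hi : Primrec i)
    (hj : Primrec j) : Primrec fun x => ltTable (m x) (n x) (i x) (j x) := by
  refine .pair hn (primrec_filter (primrec_tuples.comp hm hn) ?_)
  exact Primrec.nat_lt.comp ((Primrec.list_getD 0).comp .fst (hi.comp .snd))
    ((Primrec.list_getD 0).comp .fst (hj.comp .snd))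

theorem primrec_letterTable {w : α → List ℕ} {n a i : α → ℕ} (hw : Primrec w) (hn : Primrec n)
    (ha : Primrec a) (hi : Primrec i) :
    Primrec fun x => letterTable (w x) (n x) (a x) (i x) := by
  refine .pair hn (primrec_filter (primrec_tuples.comp (Primrec.list_length.comp hw) hn) ?_)
  exact Primrec.eq.comp (Primrec.list_getElem?.comp (hw.comp .snd)
    ((Primrec.list_getD 0).comp .fst (hi.comp .snd))) (Primrec.option_some.comp (ha.comp .snd))

theorem primrec_impTable {m : α → ℕ} {x y : α → Table} (hm : Primrec m) (hx : Primrec x)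
    (hy : Primrec y) : Primrec fun z => impTable (m z) (x z) (y z) := by
  have hn : Primrec fun z => (x z).1 := .comp .fst hx
  refine .pair hn (primrec_filter (primrec_tuples.comp hm hn) ?_)
  exact (primrecPred_mem .fst (.comp .snd (hx.comp .snd))).not.or
    (primrecPred_mem .fst (.comp .snd (hy.comp .snd)))

theorem primrec_allTable {m : α → ℕ} {x : α → Table} (hm : Primrec m) (hx : Primrec x) :
    Primrec fun z => allTable (m z) (x z) := by
  have hn : Primrec fun z => (x z).1 - 1 := Primrec.nat_sub.comp (.comp .fst hx) (.const 1)
  refine .pair hn (primrec_filter (primrec_tuples.comp hm hn) ?_)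
  refine primrecPred_forall_mem (Primrec.list_range.comp (hm.comp .snd))
    (R := fun a (q : List ℕ × α) => q.1 ++ [a] ∈ (x q.2).2) ?_
  exact primrecPred_mem (Primrec.list_concat.comp (.comp .fst .snd) .fst)
    (.comp .snd (hx.comp (.comp .snd .snd)))

theorem primrec_ctxOf : Primrec ctxOf :=
  Primrec.fst.comp (Primrec.unpair.comp (Primrec.nat_div.comp .id (.const 2)))

theorem primrec_idxOf : Primrec idxOf := by
  refine Primrec.nat_div.comp (.comp .fst (Primrec.unpair.comp ?_)) (.const 4)
  exact Primrec.nat_sub.comp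
    (.comp .snd (Primrec.unpair.comp (Primrec.nat_div.comp .id (.const 2)))) (.const 1)

theorem primrec_letterOf : Primrec letterOf :=
  Primrec.snd.comp (Primrec.unpair.comp (Primrec.nat_div.comp .id (.const 4)))

theorem primrec_numCode : Primrec numCode :=
  Primrec.succ.comp (Primrec.nat_mul.comp (.const 2)
    (Primrec.succ.comp (Primrec.nat_mul.comp (.const 2) .id)))

theorem primrec_varCode : Primrec₂ varCode := by
  refine Primrec.nat_mul.comp (.const 2) (Primrec₂.natPair.comp .fst (Primrec.succ.comp
    (Primrec₂.natPair.comp (Primrec.nat_mul.comp (.const 2) (Primrec.succ.comp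
      (Primrec.nat_mul.comp (.const 2) .snd))) (.const 0))))

theorem primrec_relCode : Primrec₂ relCode :=
  Primrec.succ.comp (Primrec.nat_mul.comp (.const 2) (Primrec.nat_mul.comp (.const 2)
    (Primrec₂.natPair.comp .fst .snd)))

theorem primrecPred_isVar : PrimrecPred IsVar :=
  (Primrec.nat_lt.comp primrec_idxOf primrec_ctxOf).and
    (Primrec.eq.comp .id (primrec_varCode.comp primrec_ctxOf primrec_idxOf))

theorem primrec_evalStep {w l : α → List ℕ} {q : α → List (Option (List Table))} (hw : Primrec w)
    (hl : Primrec l) (hq : Primrec q) : Primrec fun x => evalStep (w x) (l x) (q x) := by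
  have hs (i : ℕ) : Primrec fun x => (l x).getD i 0 := (Primrec.list_getD 0).comp hl (.const i)
  have ht (i : ℕ) : Primrec fun x => (q x).getD i none :=
    (Primrec.list_getD none).comp hq (.const i)
  have hv (i : ℕ) : Primrec fun p : α × List Table => p.2.getD i (0, []) :=
    (Primrec.list_getD (0, [])).comp .snd (.const i)
  have hlen : Primrec fun p : α × List Table => p.2.length := Primrec.list_length.comp .snd
  have hm : Primrec fun x => (w x).length := Primrec.list_length.comp hw
  have hvar (i : ℕ) : PrimrecPred fun x => IsVar ((l x).getD i 0) := primrecPred_isVar.comp (hs i)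
  have hctx (i : ℕ) : Primrec fun x => ctxOf ((l x).getD i 0) := primrec_ctxOf.comp (hs i)
  have hidx (i : ℕ) : Primrec fun x => idxOf ((l x).getD i 0) := primrec_idxOf.comp (hs i)
  have hlet : Primrec fun x => letterOf ((l x).getD 0 0) := primrec_letterOf.comp (hs 0)
  have hfal : Primrec fun x => (l x).getD 0 0 / 4 - 2 :=
    Primrec.nat_sub.comp (Primrec.nat_div.comp (hs 0) (.const 4)) (.const 2)
  refine Primrec.ite (Primrec.eq.comp (hs 0) (.const _)) ?_ <|
    Primrec.ite (Primrec.eq.comp (hs 0) (.const _)) ?_ <|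
    Primrec.ite (Primrec.eq.comp (hs 0) (primrec_numCode.comp (Primrec.succ.comp
      (Primrec.succ.comp hfal)))) ?_ <|
    Primrec.ite ((hvar 0).and ((hvar 1).and (Primrec.eq.comp (hctx 0) (hctx 1)))) ?_ <|
    Primrec.ite ((Primrec.eq.comp (hs 0) (primrec_relCode.comp (.const 1) hlet)).and
      ((hvar 2).and (Primrec.eq.comp (hs 1) (primrec_numCode.comp (hctx 2))))) ?_ <|
    Primrec.ite ((Primrec.eq.comp (hs 0) (.const _)).and ((hvar 2).and ((hvar 3).and
      ((Primrec.eq.comp (hs 1) (primrec_numCode.comp (hctx 2))).and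
        (Primrec.eq.comp (hctx 2) (hctx 3)))))) ?_ (.const none)
  · refine Primrec.option_bind (ht 0) (Primrec.ite ?_ ?_ (.const none))
    · exact (Primrec.nat_le.comp (.const 2) hlen).and
        (Primrec.eq.comp (.comp .fst (hv 0)) (.comp .fst (hv 1)))
    · exact Primrec.option_some.comp (Primrec.list_cons.comp
        (primrec_impTable (hm.comp .fst) (hv 0) (hv 1)) (Primrec.list_drop.comp (.const 2) .snd))
  · refine Primrec.option_bind (ht 0) (Primrec.ite ?_ ?_ (.const none))
    · exact (Primrec.nat_le.comp (.const 1) hlen).and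
        (Primrec.nat_le.comp (.const 1) (.comp .fst (hv 0)))
    · exact Primrec.option_some.comp (Primrec.list_cons.comp
        (primrec_allTable (hm.comp .fst) (hv 0)) (Primrec.list_drop.comp (.const 1) .snd))
  · exact Primrec.option_map (ht 0)
      (Primrec.list_cons.comp (.pair (hfal.comp .fst) (.const [])) .snd)
  · exact Primrec.option_map (ht 1) (Primrec.list_cons.comp
      ((primrec_eqTable hm (hctx 0) (hidx 0) (hidx 1)).comp .fst) .snd)
  · exact Primrec.option_map (ht 2) (Primrec.list_cons.comp
      ((primrec_letterTable hw (hctx 2) hlet (hidx 2)).comp .fst) .snd)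
  · exact Primrec.option_map (ht 3) (Primrec.list_cons.comp
      ((primrec_ltTable hm (hctx 2) (hidx 2) (hidx 3)).comp .fst) .snd)

theorem primrec_eval : Primrec₂ eval := by
  suffices h : Primrec fun p : List ℕ × List ℕ => evalTails p.1 p.2 from
    (Primrec.list_getD none).comp h (.const 0)
  refine (Primrec.list_rec (f := fun p : List ℕ × List ℕ => p.2)
    (g := fun _ => [some ([] : List Table)])
    (h := fun p q => evalStep p.1 (q.1 :: q.2.1) q.2.2 :: q.2.2) .snd (.const _) ?_).of_eq ?_
  · have hr : Primrec fun x : (List ℕ × List ℕ) × ℕ × List ℕ × List (Option (List Table)) =>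
        x.2.2.2 := .comp .snd (.comp .snd .snd)
    refine Primrec.list_cons.comp (primrec_evalStep (.comp .fst .fst) ?_ hr) hr
    exact Primrec.list_cons.comp (.comp .fst .snd) (.comp .fst (.comp .snd .snd))
  · rintro ⟨w, l⟩
    induction l with
    | nil => rfl
    | cons s l ih => simp only [evalTails, ← ih]

theorem primrec_sum : Primrec (List.sum : List ℕ → ℕ) :=
  Primrec.list_foldr .id (.const 0)
    (Primrec.nat_add.comp (.comp .fst .snd) (.comp .snd .snd)).to₂

end Primrec

/-! ### The decision procedure -/

/-- The words of bounded length and with bounded letters that have to be checked for satisfying a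
formula whose code has sum `s`. -/
def candidates (s : ℕ) : List (List ℕ) :=
  (List.range (modelBound s)).flatMap (tuples (s + 2))

theorem mem_candidates {s : ℕ} {w : List ℕ} :
    w ∈ candidates s ↔ w.length < modelBound s ∧ ∀ a ∈ w, a < s + 2 := by
  simp [candidates, mem_tuples]

theorem primrec_candidates : Primrec candidates :=
  Primrec.list_flatMap (Primrec.list_range.comp primrec_modelBound)
    (primrec_tuples.comp (Primrec.succ.comp (Primrec.succ.comp .fst)) .snd)

theorem eval_code (w : List ℕ) (f : WordFormula 0) : eval w f.code = some [table w f] := by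
  have := eval_code_append w f []
  rwa [List.append_nil] at this

theorem exists_candidate_iff (l : List ℕ) :
    (∃ w ∈ candidates l.sum, w ≠ [] ∧ eval w l = some [(0, [ [] ])]) ↔
      ∃ f : WordFormula 0, f.code = l ∧ WordSat f.toBounded := by
  constructor
  · rintro ⟨w, -, hw, h⟩
    obtain ⟨fs, rfl, hfs⟩ := exists_of_eval_eq_some w h
    obtain _ | ⟨⟨n, f⟩, _ | ⟨g, fs⟩⟩ := fs
    · simp at hfs
    · have hf : (0, [ [] ]) = table w f := (List.cons.inj hfs).1
      obtain rfl : 0 = n := congrArg Prod.fst hf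
      exact ⟨f, by simp, (wordSat_iff_holds f).2 ⟨w, hw, (table_eq_iff w f).1 hf.symm⟩⟩
    · simp at hfs
  · rintro ⟨f, rfl, hf⟩
    obtain ⟨w, hw, h⟩ := (wordSat_iff_holds f).1 hf
    obtain ⟨v, hv, hlen, hlt, h⟩ := exists_small_model f hw h
    exact ⟨v, mem_candidates.2 ⟨hlen, hlt⟩, hv, by rw [eval_code, (table_eq_iff v f).2 h]⟩

theorem exists_encode_eq_and_wordSat_iff (k : ℕ) :
    (∃ φ : W.Sentence, Encodable.encode φ = k ∧ WordSat φ) ↔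
      ∃ f : WordFormula 0, f.code = Denumerable.ofNat (List ℕ) k ∧ WordSat f.toBounded := by
  have key (f : WordFormula 0) : Encodable.encode (f.toBounded : W.Sentence) = k ↔
      f.code = Denumerable.ofNat (List ℕ) k := by
    rw [encode_toBounded]
    exact ⟨fun h => by rw [← h, Denumerable.ofNat_encode],
      fun h => by rw [h, Denumerable.encode_ofNat]⟩
  constructor
  · rintro ⟨φ, hk, h⟩
    obtain ⟨f, rfl⟩ := toBounded_surjective φ
    exact ⟨f, (key f).1 hk, h⟩
  · rintro ⟨f, hk, h⟩
    exact ⟨f.toBounded, (key f).2 hk, h⟩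

theorem primrecPred_exists_candidate : PrimrecPred fun l : List ℕ =>
    ∃ w ∈ candidates l.sum, w ≠ [] ∧ eval w l = some [(0, [ [] ])] :=
  primrecPred_exists_mem (primrec_candidates.comp primrec_sum)
    (R := fun w l => w ≠ [] ∧ eval w l = some [(0, [ [] ])]) <|
      (Primrec.eq.comp .fst (.const [])).not.and
        (Primrec.eq.comp (primrec_eval.comp .fst .snd) (.const _))

end WordFormula

/-- The satisfiability problem of first-order logic over words is decidable. -/
theorem wordSat_decidable :
    ComputablePred fun k => ∃ φ : W.Sentence, Encodable.encode φ = k ∧ WordSat φ := by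
  refine (PrimrecPred.comp WordFormula.primrecPred_exists_candidate
    (Primrec.ofNat (List ℕ))).computablePred.of_eq fun k => ?_
  rw [WordFormula.exists_encode_eq_and_wordSat_iff, WordFormula.exists_candidate_iff]
end
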